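/- Let R be a regular local ring and let M and N be nonzero finitely generated R-modules. Then dim M + dim N ≤ dim R + dim(M ⊗_R N). -/

import Mathlib

/-!
STATEMENT 14: If `R` is a regular local ring and `M`, `N` are nonzero finitely generated
`R`-modules, then `dim M + dim N ≤ dim R + dim (M ⊗_R N)`.
-/

open scoped TensorProduct

universe u

/-- A Noetherian local ring is regular if its maximal ideal can be generated by
(Krull dimension of the ring) many elements. -/
def IsRegularLocal (Q : Type u) [CommRing Q] [IsLocalRing Q] : Prop :=
  IsNoetherianRing Q ∧ ∃ s : Finset Q, Ideal.span (s : Set Q) = IsLocalRing.maximalIdeal Q ∧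
    (s.card : WithBot ℕ∞) = ringKrullDim Q

/-- The Krull dimension of a commutative ring, valued in `WithBot ℕ∞`. -/
noncomputable def ringDim (R : Type u) [CommRing R] : WithBot ℕ∞ := ringKrullDim R

/-- The Krull dimension of a module `M`: the Krull dimension of `R ⧸ ann M`. -/
noncomputable def moduleDim (R : Type u) [CommRing R] (M : Type u) [AddCommGroup M]
    [Module R M] : WithBot ℕ∞ :=
  ringDim (R ⧸ Module.annihilator R M)

section QuotientDimension

open IsLocalRing

variable {Λ : Type u} [CommRing Λ]

lemma ringKrullDim_quotient_anti {I J : Ideal Λ} (h : I ≤ J) :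
    ringKrullDim (Λ ⧸ J) ≤ ringKrullDim (Λ ⧸ I) :=
  ringKrullDim_le_of_surjective (Ideal.Quotient.factor h) (Ideal.Quotient.factor_surjective h)

lemma exists_isPrime_le_ringKrullDim_quotient {I : Ideal Λ} {n : ℕ}
    (h : (n : WithBot ℕ∞) ≤ ringKrullDim (Λ ⧸ I)) :
    ∃ p : Ideal Λ, p.IsPrime ∧ I ≤ p ∧ (n : WithBot ℕ∞) ≤ ringKrullDim (Λ ⧸ p) := by
  rw [ringKrullDim_quotient, Order.le_krullDim_iff] at h
  obtain ⟨l, hl⟩ := h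
  refine ⟨l.head.1.asIdeal, l.head.1.isPrime, ?_, ?_⟩
  · exact (PrimeSpectrum.mem_zeroLocus _ _).1 l.head.2
  · rw [ringKrullDim_quotient, Order.le_krullDim_iff]
    have hle : ∀ i, l.head ≤ l i := fun i => l.head_le i
    refine ⟨⟨l.length, fun i => ⟨(l i).1, by simpa using hle i⟩, fun i => l.step i⟩, hl⟩

lemma ringKrullDim_quotient_sup_span_singleton_add_one_le {p : Ideal Λ} [p.IsPrime] {z : Λ}
    (hz : z ∉ p) : ringKrullDim (Λ ⧸ p ⊔ Ideal.span {z}) + 1 ≤ ringKrullDim (Λ ⧸ p) := by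
  have h := ringKrullDim_quotient_succ_le_of_nonZeroDivisor (R := Λ ⧸ p)
    (r := Ideal.Quotient.mk p z)
    (mem_nonZeroDivisors_of_ne_zero (by rwa [Ne, Ideal.Quotient.eq_zero_iff_mem]))
  have e : ((Λ ⧸ p) ⧸ Ideal.span {Ideal.Quotient.mk p z}) ≃+* Λ ⧸ p ⊔ Ideal.span {z} :=
    (Ideal.quotEquivOfEq (by simp [Ideal.map_span])).trans
      (DoubleQuot.quotQuotEquivQuotSup p (Ideal.span {z}))
  rwa [ringKrullDim_eq_of_ringEquiv e] at h

variable [IsLocalRing Λ] [IsNoetherianRing Λ]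

lemma ringKrullDim_quotient_le_sup_span_singleton (I : Ideal Λ) {z : Λ}
    (hz : z ∈ maximalIdeal Λ) :
    ringKrullDim (Λ ⧸ I) ≤ ringKrullDim (Λ ⧸ I ⊔ Ideal.span {z}) + 1 := by
  have e : ((Λ ⧸ I) ⧸ Ideal.span {Ideal.Quotient.mk I z}) ≃+* Λ ⧸ I ⊔ Ideal.span {z} :=
    (Ideal.quotEquivOfEq (by simp [Ideal.map_span])).trans
      (DoubleQuot.quotQuotEquivQuotSup I (Ideal.span {z}))
  rw [← ringKrullDim_eq_of_ringEquiv e]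
  rcases subsingleton_or_nontrivial (Λ ⧸ I) with h | h
  · simp [ringKrullDim_eq_bot_of_subsingleton]
  · have : IsLocalRing (Λ ⧸ I) := .of_surjective' _ Ideal.Quotient.mk_surjective
    have := ringKrullDim_le_ringKrullDim_quotient_add_card (R := Λ ⧸ I) {Ideal.Quotient.mk I z} (by
      rw [IsLocalRing.ringJacobson_eq_maximalIdeal]
      intro y hy
      rw [Finset.coe_singleton, Set.mem_singleton_iff] at hy
      have := ((local_hom_TFAE (Ideal.Quotient.mk I)).out 0 4).1
        (IsLocalHom.of_surjective _ Ideal.Quotient.mk_surjective)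
      subst hy
      exact (Ideal.mem_comap.1 (this ▸ hz)))
    rw [Finset.coe_singleton] at this
    simpa using this

lemma ringKrullDim_quotient_le_sup_ofList (zs : List Λ) :
    ∀ (I : Ideal Λ), (∀ z ∈ zs, z ∈ maximalIdeal Λ) →
    ringKrullDim (Λ ⧸ I) ≤ ringKrullDim (Λ ⧸ I ⊔ Ideal.ofList zs) + zs.length := by
  induction zs with
  | nil => intro I _; simpa using ringKrullDim_quotient_anti (by simp)
  | cons z zs ih =>
    intro I h
    have h1 := ringKrullDim_quotient_le_sup_span_singleton I (h z (by simp))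
    have h2 := ih (I ⊔ Ideal.span {z}) (fun w hw => h w (by simp [hw]))
    rw [sup_assoc, ← Ideal.ofList_cons] at h2
    refine h1.trans ((add_le_add_left h2 1).trans ?_)
    simp [add_assoc]

omit [IsNoetherianRing Λ] in
lemma ringKrullDim_quotient_le_zero {I : Ideal Λ} (h : maximalIdeal Λ ≤ I.radical) :
    ringKrullDim (Λ ⧸ I) ≤ 0 := by
  rw [← Nat.cast_zero, ← Ring.krullDimLE_iff]
  refine Ring.KrullDimLE.mk₀ fun J hJ => ?_
  have h1 : maximalIdeal Λ ≤ J.comap (Ideal.Quotient.mk I) :=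
    h.trans ((Ideal.IsPrime.radical_le_iff inferInstance).2
      (fun x hx => by simp [Ideal.mem_comap, Ideal.Quotient.eq_zero_iff_mem.2 hx]))
  have h2 : (J.comap (Ideal.Quotient.mk I)).IsMaximal := by
    rw [← (maximalIdeal.isMaximal Λ).eq_of_le (Ideal.IsPrime.ne_top inferInstance) h1]
    infer_instance
  have h3 := Ideal.map_comap_of_surjective (Ideal.Quotient.mk I) Ideal.Quotient.mk_surjective J
  rw [← h3]
  refine (Ideal.map_eq_top_or_isMaximal_of_surjective _ Ideal.Quotient.mk_surjective h2).resolve_left ?_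
  rw [h3]; exact hJ.ne_top

omit [IsNoetherianRing Λ] in
lemma maximalIdeal_le_radical_of_ringKrullDim_le_zero {I : Ideal Λ}
    (h : ringKrullDim (Λ ⧸ I) ≤ 0) : maximalIdeal Λ ≤ I.radical := by
  rw [← Nat.cast_zero, ← Ring.krullDimLE_iff] at h
  rw [Ideal.radical_eq_sInf]
  refine le_sInf fun J hJ => ?_
  have := hJ.2
  have hm : J.IsMaximal := by
    have : (J.map (Ideal.Quotient.mk I)).IsPrime :=
      Ideal.map_isPrime_of_surjective Ideal.Quotient.mk_surjective (by simpa using hJ.1)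
    have h3 : (J.map (Ideal.Quotient.mk I)).IsMaximal := Ideal.isMaximal_of_isPrime _
    have := Ideal.comap_isMaximal_of_surjective (Ideal.Quotient.mk I) Ideal.Quotient.mk_surjective
      (K := J.map (Ideal.Quotient.mk I))
    rwa [Ideal.comap_map_of_surjective _ Ideal.Quotient.mk_surjective, ← RingHom.ker_eq_comap_bot,
      Ideal.mk_ker, sup_eq_left.2 hJ.1] at this
  exact (IsLocalRing.eq_maximalIdeal hm).ge

end QuotientDimension

section EulerChar

open Module Function IsLocalRing
open scoped Pointwise

variable {Λ : Type u} [CommRing Λ]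

/-- The Euler characteristic of the Koszul complex of a sequence `zs` with coefficients in `D`. -/
noncomputable def koszulChar : List Λ → (D : Type u) → [AddCommGroup D] → [Module Λ D] → ℤ
  | [], D, _, _ => ((Module.length Λ D).toNat : ℤ)
  | z :: zs, D, _, _ => koszulChar zs (QuotSMulTop z D) - koszulChar zs (Submodule.torsionBy Λ D z)

/-- `χ` is additive on short exact sequences of finite modules annihilated by `I`. -/
def AdditiveOn (I : Ideal Λ)
    (χ : (D : Type u) → [AddCommGroup D] → [Module Λ D] → ℤ) : Prop :=
  ∀ {X Y W : Type u} [AddCommGroup X] [Module Λ X] [AddCommGroup Y] [Module Λ Y]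
    [AddCommGroup W] [Module Λ W] (f : X →ₗ[Λ] Y) (g : Y →ₗ[Λ] W), Module.Finite Λ Y →
    I ≤ annihilator Λ Y → Injective f → Surjective g → Exact f g → χ Y = χ X + χ W

namespace AdditiveOn

variable {I : Ideal Λ} {χ : (D : Type u) → [AddCommGroup D] → [Module Λ D] → ℤ}
  {X Y W : Type u} [AddCommGroup X] [Module Λ X] [AddCommGroup Y] [Module Λ Y]
  [AddCommGroup W] [Module Λ W]

lemma eq_zero (h : AdditiveOn I χ) [Subsingleton X] : χ X = 0 := by
  have h1 : I ≤ annihilator Λ X := by rw [annihilator_eq_top_iff.2 ‹_›]; exact le_top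
  have := h (LinearMap.id : X →ₗ[Λ] X) (LinearMap.id : X →ₗ[Λ] X) inferInstance h1
    injective_id surjective_id (fun x => ⟨fun _ => ⟨x, rfl⟩, fun _ => Subsingleton.elim _ _⟩)
  lia

lemma congr (h : AdditiveOn I χ) [Module.Finite Λ X] (hI : I ≤ annihilator Λ X)
    (e : X ≃ₗ[Λ] Y) : χ X = χ Y := by
  have h1 : I ≤ annihilator Λ Y := by rwa [← e.annihilator_eq]
  have := h e.toLinearMap (0 : Y →ₗ[Λ] PUnit.{u+1}) (Module.Finite.equiv e) h1
    e.injective (fun x => ⟨0, rfl⟩) (fun x => by simp)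
  rw [h.eq_zero (X := PUnit.{u+1})] at this
  lia

lemma eq_ker_add_range (h : AdditiveOn I χ) [Module.Finite Λ Y] (hI : I ≤ annihilator Λ Y)
    (g : Y →ₗ[Λ] W) : χ Y = χ (LinearMap.ker g) + χ (LinearMap.range g) :=
  h (LinearMap.ker g).subtype g.rangeRestrict inferInstance hI
    (Submodule.injective_subtype _) g.surjective_rangeRestrict
    (fun y => by simp [LinearMap.rangeRestrict, ← LinearMap.mem_ker])

lemma eq_range_add_range (h : AdditiveOn I χ) [Module.Finite Λ Y] (hI : I ≤ annihilator Λ Y)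
    (f : X →ₗ[Λ] Y) (g : Y →ₗ[Λ] W) (hfg : Exact f g) :
    χ Y = χ (LinearMap.range f) + χ (LinearMap.range g) := by
  rw [h.eq_ker_add_range hI g, hfg.linearMap_ker_eq]

lemma eq_range_of_injective (h : AdditiveOn I χ) [Module.Finite Λ X] (hI : I ≤ annihilator Λ X)
    (f : X →ₗ[Λ] Y) (hf : Injective f) : χ X = χ (LinearMap.range f) :=
  h.congr hI (LinearEquiv.ofInjective f hf)

lemma eq_range_of_surjective (h : AdditiveOn I χ) [Module.Finite Λ Y] (hI : I ≤ annihilator Λ Y)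
    (f : X →ₗ[Λ] Y) (hf : Surjective f) : χ Y = χ (LinearMap.range f) :=
  h.congr hI ((LinearEquiv.ofTop _ (LinearMap.range_eq_top.2 hf)).symm)

end AdditiveOn

lemma le_annihilator_quotSMulTop {I : Ideal Λ} {D : Type u} [AddCommGroup D] [Module Λ D]
    (h : I ≤ annihilator Λ D) (z : Λ) :
    I ⊔ Ideal.span {z} ≤ annihilator Λ (QuotSMulTop z D) := by
  refine sup_le (h.trans ?_) ((Ideal.span_singleton_le_iff_mem _).2 (QuotSMulTop.mem_annihilator _ z))
  exact LinearMap.annihilator_le_of_surjective _ (Submodule.mkQ_surjective _)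

lemma le_annihilator_torsionBy {I : Ideal Λ} {D : Type u} [AddCommGroup D] [Module Λ D]
    (h : I ≤ annihilator Λ D) (z : Λ) :
    I ⊔ Ideal.span {z} ≤ annihilator Λ (Submodule.torsionBy Λ D z) := by
  refine sup_le (h.trans ?_) ((Ideal.span_singleton_le_iff_mem _).2 ?_)
  · exact LinearMap.annihilator_le_of_injective _ (Submodule.injective_subtype _)
  · rw [mem_annihilator]; rintro ⟨m, hm⟩; ext; simpa using hm

lemma exact_six_term_torsionBy_quotSMulTop {X Y W : Type u} [AddCommGroup X] [Module Λ X]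
    [AddCommGroup Y] [Module Λ Y] [AddCommGroup W] [Module Λ W] (f : X →ₗ[Λ] Y) (g : Y →ₗ[Λ] W)
    (hf : Injective f) (hg : Surjective g) (hfg : Exact f g) (z : Λ) :
    ∃ (f' : Submodule.torsionBy Λ X z →ₗ[Λ] Submodule.torsionBy Λ Y z)
      (g' : Submodule.torsionBy Λ Y z →ₗ[Λ] Submodule.torsionBy Λ W z)
      (δ : Submodule.torsionBy Λ W z →ₗ[Λ] QuotSMulTop z X),
      Injective f' ∧ Exact f' g' ∧ Exact g' δ ∧ Exact δ (QuotSMulTop.map z f) := by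
  have hx : ∀ (X : Type u) [AddCommGroup X] [Module Λ X],
      Exact (Submodule.torsionBy Λ X z).subtype (LinearMap.lsmul Λ X z) := fun X _ _ x => by simp
  have hy : ∀ (X : Type u) [AddCommGroup X] [Module Λ X],
      Exact (LinearMap.lsmul Λ X z) (Submodule.mkQ (z • ⊤ : Submodule Λ X)) := fun X _ _ x => by
    simp [Submodule.mem_smul_pointwise_iff_exists]
  let f' : Submodule.torsionBy Λ X z →ₗ[Λ] Submodule.torsionBy Λ Y z :=
    f.restrict fun x hx => by
      rw [Submodule.mem_torsionBy_iff] at hx ⊢; rw [← map_smul, hx, map_zero]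
  let g' : Submodule.torsionBy Λ Y z →ₗ[Λ] Submodule.torsionBy Λ W z :=
    g.restrict fun x hx => by
      rw [Submodule.mem_torsionBy_iff] at hx ⊢; rw [← map_smul, hx, map_zero]
  refine ⟨f', g', SnakeLemma.δ' (LinearMap.lsmul Λ X z) (LinearMap.lsmul Λ Y z)
    (LinearMap.lsmul Λ W z) f g hfg f g hfg (by ext; simp) (by ext; simp)
    (Submodule.torsionBy Λ W z).subtype (hx W) (Submodule.mkQ (z • ⊤ : Submodule Λ X)) (hy X)
    hg hf, ?_, ?_, ?_, ?_⟩
  · intro a b hab; ext; exact hf (congrArg Subtype.val hab)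
  · intro y
    constructor
    · intro h
      obtain ⟨x, hx⟩ := (hfg y.1).1 (congrArg Subtype.val h)
      refine ⟨⟨x, ?_⟩, Subtype.ext hx⟩
      rw [Submodule.mem_torsionBy_iff]
      apply hf; simp [hx]
    · rintro ⟨x, rfl⟩; ext; exact (hfg _).2 ⟨x.1, rfl⟩
  · exact SnakeLemma.exact_δ'_right _ _ _ f g hfg f g hfg _ _
      (Submodule.torsionBy Λ Y z).subtype (hx Y) _ _ _ _ hg hf g' rfl
      (Submodule.injective_subtype _)
  · exact SnakeLemma.exact_δ'_left _ _ _ f g hfg f g hfg _ _ _ _ _ _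
      (Submodule.mkQ (z • ⊤ : Submodule Λ Y)) (hy Y) hg hf (QuotSMulTop.map z f) rfl
      (Submodule.mkQ_surjective _)

variable [IsNoetherianRing Λ] [IsLocalRing Λ]

lemma length_ne_top_of_maximalIdeal_le_radical {D : Type u} [AddCommGroup D] [Module Λ D]
    [Module.Finite Λ D] {I : Ideal Λ} (h : maximalIdeal Λ ≤ I.radical)
    (hI : I ≤ annihilator Λ D) : Module.length Λ D ≠ ⊤ := by
  rw [Module.length_ne_top_iff, isFiniteLength_iff_isNoetherian_isArtinian]
  refine ⟨inferInstance, ?_⟩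
  let _ : Module (Λ ⧸ I) D := Module.IsTorsionBySet.module
    (fun x a => mem_annihilator.1 (hI a.2) x)
  have : IsScalarTower Λ (Λ ⧸ I) D := Module.IsTorsionBySet.isScalarTower _
  have : Module.Finite (Λ ⧸ I) D := Module.Finite.of_restrictScalars_finite Λ _ _
  have : IsArtinianRing (Λ ⧸ I) := by
    rw [isArtinianRing_iff_krullDimLE_zero, Ring.krullDimLE_iff]
    exact ringKrullDim_quotient_le_zero h
  exact (isArtinian_of_surjective_algebraMap (R := Λ ⧸ I) (M := D) (S := Λ)
    Ideal.Quotient.mk_surjective)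

theorem additiveOn_koszulChar (zs : List Λ) : ∀ (I : Ideal Λ),
    maximalIdeal Λ ≤ (I ⊔ Ideal.ofList zs).radical → AdditiveOn I (koszulChar zs) := by
  induction zs with
  | nil =>
    intro I h X Y W _ _ _ _ _ _ f g _ hI hf hg hfg
    simp only [Ideal.ofList_nil, sup_bot_eq] at h
    have := length_ne_top_of_maximalIdeal_le_radical h hI
    have h2 := Module.length_eq_add_of_exact f g hf hg hfg
    simp only [koszulChar]
    rw [h2] at this ⊢
    rw [ENat.toNat_add (fun h => this (by simp [h])) (fun h => this (by simp [h]))]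
    push_cast; rfl
  | cons z zs ih =>
    intro I h X Y W _ _ _ _ _ _ f g _ hI hf hg hfg
    rw [Ideal.ofList_cons, ← sup_assoc] at h
    have ha : AdditiveOn _ (koszulChar zs) := ih _ h
    obtain ⟨f', g', δ, h1, h2, h3, h4⟩ := exact_six_term_torsionBy_quotSMulTop f g hf hg hfg z
    have h5 := QuotSMulTop.map_exact z hfg hg
    have h6 := QuotSMulTop.map_surjective z hg
    have hX : I ≤ annihilator Λ X := hI.trans (LinearMap.annihilator_le_of_injective f hf)
    have hW : I ≤ annihilator Λ W := hI.trans (LinearMap.annihilator_le_of_surjective g hg)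
    have : Module.Finite Λ X := Module.Finite.of_injective f hf
    have : Module.Finite Λ W := Module.Finite.of_surjective g hg
    have e1 := ha.eq_range_of_injective (le_annihilator_torsionBy hX z) f' h1
    have e2 := ha.eq_range_add_range (le_annihilator_torsionBy hI z) _ _ h2
    have e3 := ha.eq_range_add_range (le_annihilator_torsionBy hW z) _ _ h3
    have e4 := ha.eq_range_add_range (le_annihilator_quotSMulTop hX z) _ _ h4
    have e5 := ha.eq_range_add_range (le_annihilator_quotSMulTop hI z) _ _ h5
    have e6 := ha.eq_range_of_surjective (le_annihilator_quotSMulTop hW z) _ h6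
    simp only [koszulChar]
    lia

end EulerChar

section EulerCharPos

open Module Function IsLocalRing
open scoped Pointwise

variable {Λ : Type u} [CommRing Λ]

/-- The support of `D` has a point whose closure has dimension at least `n`. -/
def HasSupportDim (n : ℕ) (D : Type u) [AddCommGroup D] [Module Λ D] : Prop :=
  ∃ p ∈ Module.support Λ D, (n : WithBot ℕ∞) ≤ ringKrullDim (Λ ⧸ p.asIdeal)

variable [IsNoetherianRing Λ] [IsLocalRing Λ]

lemma WithBot.natCast_le_of_succ_le_add_one {n : ℕ} {x : WithBot ℕ∞}
    (h : ((n + 1 : ℕ) : WithBot ℕ∞) ≤ x + 1) : (n : WithBot ℕ∞) ≤ x := by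
  induction x using WithBot.recBotCoe with
  | bot => simp at h
  | coe x =>
    have : ((n + 1 : ℕ) : ℕ∞) ≤ x + 1 := by exact_mod_cast h
    have : (n : ℕ∞) ≤ x := by
      rwa [Nat.cast_add, Nat.cast_one, ENat.add_le_add_iff_right (by simp)] at this
    exact_mod_cast this

theorem koszulChar_nonneg_and_pos_iff (zs : List Λ) : ∀ (I : Ideal Λ),
    maximalIdeal Λ ≤ (I ⊔ Ideal.ofList zs).radical → (∀ z ∈ zs, z ∈ maximalIdeal Λ) →
    ∀ (D : Type u) [AddCommGroup D] [Module Λ D] [Module.Finite Λ D], I ≤ annihilator Λ D →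
      0 ≤ koszulChar zs D ∧ (0 < koszulChar zs D ↔ HasSupportDim (Λ := Λ) zs.length D) := by
  induction zs with
  | nil =>
    intro I hI _ D _ _ _ hD
    refine ⟨by simp [koszulChar], ?_⟩
    simp only [Ideal.ofList_nil, sup_bot_eq] at hI
    have hl := length_ne_top_of_maximalIdeal_le_radical hI hD
    have h1 : 0 < koszulChar ([] : List Λ) D ↔ ¬ Subsingleton D := by
      rw [← Module.length_eq_zero_iff (R := Λ)]
      simp only [koszulChar, Nat.cast_pos, Nat.pos_iff_ne_zero, ne_eq, ENat.toNat_eq_zero, hl,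
        or_false]
    rw [h1, not_subsingleton_iff_nontrivial, ← Module.nonempty_support_iff (R := Λ)]
    constructor
    · rintro ⟨p, hp⟩
      exact ⟨p, hp, by simpa using ringKrullDim_nonneg_of_nontrivial⟩
    · rintro ⟨p, hp, -⟩; exact ⟨p, hp⟩
  | cons z zs ih =>
    intro I hI hz D _ _ hfin
    have hadd : AdditiveOn I (koszulChar (z :: zs)) := additiveOn_koszulChar _ _ hI
    rw [Ideal.ofList_cons, ← sup_assoc] at hI
    have hadd' : AdditiveOn _ (koszulChar zs) := additiveOn_koszulChar zs _ hI
    have hz0 := hz z (by simp)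
    have hzs : ∀ w ∈ zs, w ∈ maximalIdeal Λ := fun w hw => hz w (by simp [hw])
    induction hfin using IsNoetherianRing.induction_on_isQuotientEquivQuotientPrime Λ with
    | subsingleton N =>
      intro _
      rw [hadd.eq_zero]
      simp [HasSupportDim, Module.support_eq_empty]
    | quotient N p e =>
      intro hN
      have hs : ∀ q : PrimeSpectrum Λ, q ∈ support Λ N ↔ p.asIdeal ≤ q.asIdeal := fun q => by
        rw [mem_support_iff_of_finite, e.annihilator_eq, Ideal.annihilator_quotient]
      have hIp : I ≤ p.asIdeal := by
        rwa [e.annihilator_eq, Ideal.annihilator_quotient] at hN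
      by_cases hzp : z ∈ p.asIdeal
      · have hzN : z ∈ annihilator Λ N := by
          rwa [e.annihilator_eq, Ideal.annihilator_quotient]
        have hN' : I ⊔ Ideal.span {z} ≤ annihilator Λ N :=
          sup_le hN ((Ideal.span_singleton_le_iff_mem _).2 hzN)
        have e1 : (z • ⊤ : Submodule Λ N) = ⊥ := by
          rw [eq_bot_iff]
          intro x hx
          obtain ⟨y, -, rfl⟩ := (Submodule.mem_smul_pointwise_iff_exists _ _ _).1 hx
          exact mem_annihilator.1 hzN y
        have e2 : Submodule.torsionBy Λ N z = ⊤ := by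
          rw [eq_top_iff]; intro x _; exact mem_annihilator.1 hzN x
        have h0 : koszulChar (z :: zs) N = 0 := by
          simp only [koszulChar]
          rw [← hadd'.congr hN' (Submodule.quotEquivOfEqBot _ e1).symm,
            hadd'.congr hN' (LinearEquiv.ofTop _ e2).symm, sub_self]
        rw [h0]
        refine ⟨le_rfl, by simp, ?_⟩
        rintro ⟨q, hq, hq'⟩
        exfalso
        have h1 := ringKrullDim_quotient_le_sup_ofList zs p.asIdeal hzs
        have h2 : ringKrullDim (Λ ⧸ p.asIdeal ⊔ Ideal.ofList zs) ≤ 0 :=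
          ringKrullDim_quotient_le_zero (hI.trans (Ideal.radical_mono (sup_le_sup_right
            (sup_le hIp ((Ideal.span_singleton_le_iff_mem _).2 hzp)) _)))
        have h3 := (hq'.trans (ringKrullDim_quotient_anti ((hs q).1 hq))).trans
          (h1.trans (add_le_add_left h2 _))
        rw [zero_add, List.length_cons] at h3
        have : zs.length + 1 ≤ zs.length := by exact_mod_cast h3
        lia
      · have ht : Subsingleton (Submodule.torsionBy Λ N z) := by
          rw [Submodule.subsingleton_iff_eq_bot, eq_bot_iff]
          intro x hx
          rw [Submodule.mem_torsionBy_iff] at hx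
          have h1 : Ideal.Quotient.mk p.asIdeal z * e x = 0 := by
            have := congrArg e hx
            rwa [map_smul, map_zero, Algebra.smul_def] at this
          rcases mul_eq_zero.1 h1 with h | h
          · exact absurd (Ideal.Quotient.eq_zero_iff_mem.1 h) hzp
          · exact (LinearEquiv.map_eq_zero_iff e).1 h
        have h0 : koszulChar (z :: zs) N = koszulChar zs (QuotSMulTop z N) := by
          simp only [koszulChar]
          rw [hadd'.eq_zero (X := Submodule.torsionBy Λ N z), sub_zero]
        rw [h0]
        obtain ⟨h1, h2⟩ := ih _ hI hzs (QuotSMulTop z N) (le_annihilator_quotSMulTop hN z)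
        refine ⟨h1, h2.trans ?_⟩
        unfold HasSupportDim
        rw [support_quotSMulTop]
        constructor
        · rintro ⟨q, ⟨hq1, hq2⟩, hq3⟩
          refine ⟨p, (hs p).2 le_rfl, ?_⟩
          have h4 : p.asIdeal ⊔ Ideal.span {z} ≤ q.asIdeal :=
            sup_le ((hs q).1 hq1) (Ideal.span_le.2 hq2)
          refine le_trans ?_ (ringKrullDim_quotient_sup_span_singleton_add_one_le hzp)
          rw [List.length_cons, Nat.cast_add, Nat.cast_one]
          exact add_le_add_left (hq3.trans (ringKrullDim_quotient_anti h4)) 1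
        · rintro ⟨q, hq, hq'⟩
          have h4 := (hq'.trans (ringKrullDim_quotient_anti ((hs q).1 hq))).trans
            (ringKrullDim_quotient_le_sup_span_singleton p.asIdeal hz0)
          obtain ⟨r, hr, hr1, hr2⟩ := exists_isPrime_le_ringKrullDim_quotient
            (WithBot.natCast_le_of_succ_le_add_one h4)
          refine ⟨⟨r, hr⟩, ⟨(hs _).2 (le_sup_left.trans hr1), ?_⟩, hr2⟩
          exact Ideal.span_le.1 (le_sup_right.trans hr1)
    | exact N₁ N₂ N₃ f g hf hg hfg h₁ h₃ =>
      intro hN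
      obtain ⟨a1, b1⟩ := h₁ (hN.trans (LinearMap.annihilator_le_of_injective f hf))
      obtain ⟨a3, b3⟩ := h₃ (hN.trans (LinearMap.annihilator_le_of_surjective g hg))
      have h := hadd f g inferInstance hN hf hg hfg
      have h' : HasSupportDim (Λ := Λ) (z :: zs).length N₂ ↔
          HasSupportDim (Λ := Λ) (z :: zs).length N₁ ∨
          HasSupportDim (Λ := Λ) (z :: zs).length N₃ := by
        unfold HasSupportDim
        rw [support_of_exact hfg hf hg]
        simp only [Set.mem_union, or_and_right, exists_or]
      rw [h', ← b1, ← b3]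
      lia

end EulerCharPos

section Homology

open Module Function

variable {Λ : Type u} [CommRing Λ]

/-- The homology at `Y` of a pair of maps `X → Y → W`, as a submodule of `Y ⧸ range f`. -/
abbrev pairHomology {X Y W : Type u} [AddCommGroup X] [Module Λ X] [AddCommGroup Y] [Module Λ Y]
    [AddCommGroup W] [Module Λ W] (f : X →ₗ[Λ] Y) (g : Y →ₗ[Λ] W) : Type u :=
  ↥((LinearMap.ker g).map (LinearMap.range f).mkQ)

namespace pairHomology

variable {X Y W X' Y' W' : Type u} [AddCommGroup X] [Module Λ X] [AddCommGroup Y] [Module Λ Y]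
  [AddCommGroup W] [Module Λ W] [AddCommGroup X'] [Module Λ X'] [AddCommGroup Y'] [Module Λ Y']
  [AddCommGroup W'] [Module Λ W']

/-- The homology class of a cycle. -/
def mk (f : X →ₗ[Λ] Y) (g : Y →ₗ[Λ] W) : LinearMap.ker g →ₗ[Λ] pairHomology f g :=
  ((LinearMap.range f).mkQ.domRestrict (LinearMap.ker g)).codRestrict _
    fun y => ⟨y.1, y.2, rfl⟩

lemma mk_surjective (f : X →ₗ[Λ] Y) (g : Y →ₗ[Λ] W) : Surjective (mk f g) := by
  rintro ⟨_, y, hy, rfl⟩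
  exact ⟨⟨y, hy⟩, rfl⟩

lemma mk_eq_zero {f : X →ₗ[Λ] Y} {g : Y →ₗ[Λ] W} {y : LinearMap.ker g} :
    mk f g y = 0 ↔ ∃ x, f x = y := by
  rw [← Subtype.val_inj]
  exact (Submodule.Quotient.mk_eq_zero _)

lemma subsingleton {f : X →ₗ[Λ] Y} {g : Y →ₗ[Λ] W} (h : ∀ y, g y = 0 → ∃ x, f x = y) :
    Subsingleton (pairHomology f g) := by
  refine subsingleton_of_forall_eq 0 fun a => ?_
  obtain ⟨y, rfl⟩ := mk_surjective f g a
  exact mk_eq_zero.2 (h y.1 y.2)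

lemma exists_of_subsingleton {f : X →ₗ[Λ] Y} {g : Y →ₗ[Λ] W} (h : Subsingleton (pairHomology f g))
    (y : Y) (hy : g y = 0) : ∃ x, f x = y :=
  (mk_eq_zero (f := f) (g := g) (y := ⟨y, hy⟩)).1 (Subsingleton.elim _ _)

/-- The map induced on homology by a morphism of complexes. -/
def map {f : X →ₗ[Λ] Y} {g : Y →ₗ[Λ] W} {f' : X' →ₗ[Λ] Y'} {g' : Y' →ₗ[Λ] W'}
    (a : X →ₗ[Λ] X') (b : Y →ₗ[Λ] Y') (c : W →ₗ[Λ] W')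
    (hab : b ∘ₗ f = f' ∘ₗ a) (hbc : c ∘ₗ g = g' ∘ₗ b) :
    pairHomology f g →ₗ[Λ] pairHomology f' g' :=
  ((LinearMap.range f).mapQ (LinearMap.range f') b
    (by rintro _ ⟨x, rfl⟩; exact ⟨a x, (LinearMap.congr_fun hab x).symm⟩)).restrict
    (by
      rintro _ ⟨y, hy, rfl⟩
      refine ⟨b y, ?_, rfl⟩
      have := LinearMap.congr_fun hbc y
      simp only [LinearMap.comp_apply, LinearMap.mem_ker.1 hy, map_zero] at this
      exact this.symm)

lemma map_mk {f : X →ₗ[Λ] Y} {g : Y →ₗ[Λ] W} {f' : X' →ₗ[Λ] Y'} {g' : Y' →ₗ[Λ] W'}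
    (a : X →ₗ[Λ] X') (b : Y →ₗ[Λ] Y') (c : W →ₗ[Λ] W')
    (hab : b ∘ₗ f = f' ∘ₗ a) (hbc : c ∘ₗ g = g' ∘ₗ b) (y : LinearMap.ker g) (y' : LinearMap.ker g')
    (h : y'.1 = b y.1) : map a b c hab hbc (mk f g y) = mk f' g' y' := by
  obtain ⟨y', hy'⟩ := y'
  obtain rfl : y' = b y.1 := h
  rfl

end pairHomology

section LongExact

variable {X Y W : ℕ → Type u} [∀ j, AddCommGroup (X j)] [∀ j, Module Λ (X j)]
  [∀ j, AddCommGroup (Y j)] [∀ j, Module Λ (Y j)] [∀ j, AddCommGroup (W j)] [∀ j, Module Λ (W j)]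
  (dX : ∀ j, X (j + 1) →ₗ[Λ] X j) (dY : ∀ j, Y (j + 1) →ₗ[Λ] Y j) (dW : ∀ j, W (j + 1) →ₗ[Λ] W j)
  (f : ∀ j, X j →ₗ[Λ] Y j) (g : ∀ j, Y j →ₗ[Λ] W j)

/-- The homology at spot `j + 1`. -/
abbrev seqHomology (j : ℕ) : Type u := pairHomology (dX (j + 1)) (dX j)

/-- The map induced on homology by a morphism of sequences. -/
abbrev seqHomologyMap (hf : ∀ j, f j ∘ₗ dX j = dY j ∘ₗ f (j + 1)) (j : ℕ) :
    seqHomology dX j →ₗ[Λ] seqHomology dY j :=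
  pairHomology.map (f (j + 2)) (f (j + 1)) (f j) (hf _) (hf _)

theorem exists_long_exact (hX : ∀ j, dX j ∘ₗ dX (j + 1) = 0) (hY : ∀ j, dY j ∘ₗ dY (j + 1) = 0)
    (hW : ∀ j, dW j ∘ₗ dW (j + 1) = 0)
    (hf : ∀ j, f j ∘ₗ dX j = dY j ∘ₗ f (j + 1)) (hg : ∀ j, g j ∘ₗ dY j = dW j ∘ₗ g (j + 1))
    (hi : ∀ j, Injective (f j)) (hs : ∀ j, Surjective (g j)) (he : ∀ j, Exact (f j) (g j)) (j : ℕ) :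
    ∃ δ : seqHomology dW (j + 1) →ₗ[Λ] seqHomology dX j,
      Exact (seqHomologyMap dY dW g hg (j + 1)) δ ∧ Exact δ (seqHomologyMap dX dY f hf j) ∧
      Exact (seqHomologyMap dX dY f hf j) (seqHomologyMap dY dW g hg j) := by
  have hXa : ∀ j x, dX j (dX (j + 1) x) = 0 := fun j x => LinearMap.congr_fun (hX j) x
  have hYa : ∀ j x, dY j (dY (j + 1) x) = 0 := fun j x => LinearMap.congr_fun (hY j) x
  have hWa : ∀ j x, dW j (dW (j + 1) x) = 0 := fun j x => LinearMap.congr_fun (hW j) x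
  have hfa : ∀ j x, f j (dX j x) = dY j (f (j + 1) x) := fun j x => LinearMap.congr_fun (hf j) x
  have hga : ∀ j x, g j (dY j x) = dW j (g (j + 1) x) := fun j x => LinearMap.congr_fun (hg j) x
  have hgf : ∀ j x, g j (f j x) = 0 := fun j x => (he j _).2 ⟨x, rfl⟩
  let iX : (X (j + 2) ⧸ LinearMap.range (dX (j + 2))) →ₗ[Λ] LinearMap.ker (dX j) :=
    Submodule.liftQ _ ((dX (j + 1)).codRestrict _ fun x => hXa j x)
      (by rintro _ ⟨x, rfl⟩; ext; exact hXa _ _)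
  let iY : (Y (j + 2) ⧸ LinearMap.range (dY (j + 2))) →ₗ[Λ] LinearMap.ker (dY j) :=
    Submodule.liftQ _ ((dY (j + 1)).codRestrict _ fun x => hYa j x)
      (by rintro _ ⟨x, rfl⟩; ext; exact hYa _ _)
  let iW : (W (j + 2) ⧸ LinearMap.range (dW (j + 2))) →ₗ[Λ] LinearMap.ker (dW j) :=
    Submodule.liftQ _ ((dW (j + 1)).codRestrict _ fun x => hWa j x)
      (by rintro _ ⟨x, rfl⟩; ext; exact hWa _ _)
  let f₁ : (X (j + 2) ⧸ LinearMap.range (dX (j + 2))) →ₗ[Λ] (Y (j + 2) ⧸ LinearMap.range (dY (j + 2))) :=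
    Submodule.mapQ _ _ (f (j + 2)) (by rintro _ ⟨x, rfl⟩; exact ⟨f _ x, (hfa _ _).symm⟩)
  let f₂ : (Y (j + 2) ⧸ LinearMap.range (dY (j + 2))) →ₗ[Λ] (W (j + 2) ⧸ LinearMap.range (dW (j + 2))) :=
    Submodule.mapQ _ _ (g (j + 2)) (by rintro _ ⟨x, rfl⟩; exact ⟨g _ x, (hga _ _).symm⟩)
  let g₁ : LinearMap.ker (dX j) →ₗ[Λ] LinearMap.ker (dY j) :=
    (f (j + 1)).restrict (fun x hx => by
      rw [LinearMap.mem_ker] at hx ⊢; rw [← hfa, hx, map_zero])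
  let g₂ : LinearMap.ker (dY j) →ₗ[Λ] LinearMap.ker (dW j) :=
    (g (j + 1)).restrict (fun x hx => by
      rw [LinearMap.mem_ker] at hx ⊢; rw [← hga, hx, map_zero])
  have hf₂ : Surjective f₂ := by
    intro w
    obtain ⟨w, rfl⟩ := Submodule.mkQ_surjective _ w
    obtain ⟨y, rfl⟩ := hs _ w
    exact ⟨Submodule.Quotient.mk y, rfl⟩
  have hg₁ : Injective g₁ := fun a b h => Subtype.ext (hi _ (congrArg Subtype.val h))
  have hff : Exact f₁ f₂ := by
    intro y
    obtain ⟨y, rfl⟩ := Submodule.mkQ_surjective _ y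
    constructor
    · intro h
      obtain ⟨w, hw⟩ := (Submodule.Quotient.mk_eq_zero _).1 h
      obtain ⟨y', rfl⟩ := hs _ w
      obtain ⟨x, hx⟩ := (he _ (y - dY _ y')).1 (by rw [map_sub, hga, hw, sub_self])
      refine ⟨Submodule.Quotient.mk x, ?_⟩
      change Submodule.Quotient.mk (f _ x) = Submodule.Quotient.mk y
      rw [hx, Submodule.Quotient.eq]
      exact ⟨-y', by simp⟩
    · rintro ⟨x, hx⟩
      obtain ⟨x, rfl⟩ := Submodule.mkQ_surjective _ x
      rw [← hx]
      change Submodule.Quotient.mk (g _ (f _ x)) = 0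
      rw [hgf]; rfl
  have hgg : Exact g₁ g₂ := by
    intro y
    constructor
    · intro h
      obtain ⟨x, hx⟩ := (he _ y.1).1 (congrArg Subtype.val h)
      refine ⟨⟨x, ?_⟩, Subtype.ext hx⟩
      rw [LinearMap.mem_ker]
      apply hi
      rw [hfa, hx, map_zero]
      exact y.2
    · rintro ⟨x, rfl⟩; exact Subtype.ext (hgf _ _)
  have hsq₁ : g₁ ∘ₗ iX = iY ∘ₗ f₁ := by
    ext x; exact hfa _ x
  have hsq₂ : g₂ ∘ₗ iY = iW ∘ₗ f₂ := by
    ext x; exact hga _ x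
  have hιW : Exact (Submodule.subtype ((LinearMap.ker (dW (j + 1))).map
      (LinearMap.range (dW (j + 2))).mkQ)) iW := by
    intro w
    obtain ⟨w, rfl⟩ := Submodule.mkQ_surjective _ w
    constructor
    · intro h
      exact ⟨⟨_, w, congrArg Subtype.val h, rfl⟩, rfl⟩
    · rintro ⟨⟨_, x, hx, rfl⟩, h⟩
      rw [← h]
      exact Subtype.ext hx
  have hιY : Exact (Submodule.subtype ((LinearMap.ker (dY (j + 1))).map
      (LinearMap.range (dY (j + 2))).mkQ)) iY := by
    intro w
    obtain ⟨w, rfl⟩ := Submodule.mkQ_surjective _ w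
    constructor
    · intro h
      exact ⟨⟨_, w, congrArg Subtype.val h, rfl⟩, rfl⟩
    · rintro ⟨⟨_, x, hx, rfl⟩, h⟩
      rw [← h]
      exact Subtype.ext hx
  have hπX : Exact iX (pairHomology.mk (dX (j + 1)) (dX j)) := by
    intro z
    rw [pairHomology.mk_eq_zero]
    constructor
    · rintro ⟨x, hx⟩; exact ⟨Submodule.Quotient.mk x, Subtype.ext hx⟩
    · rintro ⟨x, hx⟩
      obtain ⟨x, rfl⟩ := Submodule.mkQ_surjective _ x
      exact ⟨x, congrArg Subtype.val hx⟩
  have hπY : Exact iY (pairHomology.mk (dY (j + 1)) (dY j)) := by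
    intro z
    rw [pairHomology.mk_eq_zero]
    constructor
    · rintro ⟨x, hx⟩; exact ⟨Submodule.Quotient.mk x, Subtype.ext hx⟩
    · rintro ⟨x, hx⟩
      obtain ⟨x, rfl⟩ := Submodule.mkQ_surjective _ x
      exact ⟨x, congrArg Subtype.val hx⟩
  refine ⟨SnakeLemma.δ' iX iY iW f₁ f₂ hff g₁ g₂ hgg hsq₁ hsq₂ (Submodule.subtype _) hιW _ hπX
    hf₂ hg₁, ?_, ?_, ?_⟩
  · exact SnakeLemma.exact_δ'_right iX iY iW f₁ f₂ hff g₁ g₂ hgg hsq₁ hsq₂ (Submodule.subtype _)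
      hιY _ _ _ _ hf₂ hg₁ _ rfl (Submodule.injective_subtype _)
  · exact SnakeLemma.exact_δ'_left iX iY iW f₁ f₂ hff g₁ g₂ hgg hsq₁ hsq₂ _ _ _ _
      _ hπY hf₂ hg₁ _ (by ext; rfl) (pairHomology.mk_surjective _ _)
  · intro a
    obtain ⟨y, rfl⟩ := pairHomology.mk_surjective _ _ a
    constructor
    · intro h
      rw [pairHomology.map_mk _ _ _ _ _ y (g₂ y) rfl, pairHomology.mk_eq_zero] at h
      obtain ⟨w, hw⟩ := h
      obtain ⟨y', rfl⟩ := hs _ w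
      obtain ⟨x, hx⟩ := (he _ (y.1 - dY _ y')).1 (by rw [map_sub, hga, hw]; exact sub_self _)
      have hxk : x ∈ LinearMap.ker (dX j) := by
        rw [LinearMap.mem_ker]
        apply hi
        rw [hfa, hx, map_sub, hYa, map_zero, sub_zero]
        exact y.2
      refine ⟨pairHomology.mk _ _ ⟨x, hxk⟩, ?_⟩
      rw [pairHomology.map_mk _ _ _ _ _ _ (g₁ ⟨x, hxk⟩) rfl, ← sub_eq_zero, ← map_sub,
        pairHomology.mk_eq_zero]
      refine ⟨-y', ?_⟩
      change _ = f (j + 1) x - y.1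
      rw [hx, map_neg]; abel
    · rintro ⟨b, hb⟩
      obtain ⟨x, rfl⟩ := pairHomology.mk_surjective _ _ b
      rw [← hb, pairHomology.map_mk _ _ _ _ _ _ (g₁ x) rfl,
        pairHomology.map_mk _ _ _ _ _ _ (g₂ (g₁ x)) rfl, pairHomology.mk_eq_zero]
      exact ⟨0, by rw [map_zero]; exact (hgf _ _).symm⟩

end LongExact

end Homology

section MatrixComplex

set_option linter.unusedSectionVars false

open Module Function IsLocalRing
open scoped Pointwise

variable {Λ : Type u} [CommRing Λ]

/-- The action of a matrix with entries in `Λ` on vectors with entries in a `Λ`-module. -/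
def matAct {m n : Type} [Fintype n] (A : Matrix m n Λ) (E : Type u) [AddCommGroup E]
    [Module Λ E] : (n → E) →ₗ[Λ] (m → E) :=
  LinearMap.pi fun i => ∑ k, A i k • LinearMap.proj k

variable {m n l : Type} [Fintype n] [Fintype l] {E P : Type u} [AddCommGroup E]
    [Module Λ E] [AddCommGroup P] [Module Λ P]

lemma matAct_apply (A : Matrix m n Λ) (v : n → E) (i : m) :
    matAct A E v i = ∑ k, A i k • v k := by
  simp [matAct]

lemma matAct_comp (A : Matrix m n Λ) (B : Matrix n l Λ) (v : l → E) :
    matAct A E (matAct B E v) = matAct (A * B) E v := by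
  ext i
  simp only [matAct_apply, Matrix.mul_apply, Finset.smul_sum, Finset.sum_smul, mul_smul]
  exact Finset.sum_comm

lemma matAct_zero (v : n → E) : matAct (0 : Matrix m n Λ) E v = 0 := by
  ext i; simp [matAct_apply]

lemma matAct_naturality (A : Matrix m n Λ) (φ : E →ₗ[Λ] P) :
    φ.compLeft m ∘ₗ matAct A E = matAct A P ∘ₗ φ.compLeft n := by
  ext v i; simp [matAct_apply]

variable {ι : ℕ → Type} [∀ j, Fintype (ι j)] (A : ∀ j, Matrix (ι j) (ι (j + 1)) Λ)

/-- The homology of a complex of free modules, given by matrices, with coefficients in `E`. -/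
abbrev matHomology (E : Type u) [AddCommGroup E] [Module Λ E] (j : ℕ) : Type u :=
  seqHomology (X := fun j => ι j → E) (fun j => matAct (A j) E) j

/-- Functoriality of homology in the coefficients. -/
def matHomologyMap (φ : E →ₗ[Λ] P) (j : ℕ) : matHomology A E j →ₗ[Λ] matHomology A P j :=
  seqHomologyMap (X := fun j => ι j → E) (Y := fun j => ι j → P) _ _ (fun j => φ.compLeft (ι j)) (fun j => matAct_naturality (A j) φ) j

lemma matHomologyMap_bijective (e : E ≃ₗ[Λ] P) (j : ℕ) :
    Bijective (matHomologyMap A e.toLinearMap j) := by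
  have h : ∀ {E P : Type u} [AddCommGroup E] [Module Λ E] [AddCommGroup P] [Module Λ P]
      (e : E ≃ₗ[Λ] P), LeftInverse (matHomologyMap A e.symm.toLinearMap j)
        (matHomologyMap A e.toLinearMap j) := by
    intro E P _ _ _ _ e a
    obtain ⟨y, rfl⟩ := pairHomology.mk_surjective _ _ a
    unfold matHomologyMap
    have h1 : e.toLinearMap.compLeft (ι (j + 1)) y.1 ∈ LinearMap.ker (matAct (A j) P) := by
      have := LinearMap.congr_fun (matAct_naturality (A j) e.toLinearMap) y.1
      simp only [LinearMap.comp_apply, LinearMap.mem_ker.1 y.2, map_zero] at this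
      exact this.symm
    rw [pairHomology.map_mk _ _ _ _ _ y ⟨_, h1⟩ rfl, pairHomology.map_mk _ _ _ _ _ ⟨_, h1⟩ y]
    ext; simp
  exact ⟨(h e).injective, (h e.symm).surjective⟩

/-- Isomorphic coefficients have isomorphic homology. -/
noncomputable def matHomologyCongr (e : E ≃ₗ[Λ] P) (j : ℕ) :
    matHomology A E j ≃ₗ[Λ] matHomology A P j :=
  LinearEquiv.ofBijective _ (matHomologyMap_bijective A e j)

lemma matHomologyMap_smul (z : Λ) (j : ℕ) (a : matHomology A E j) :
    matHomologyMap A (LinearMap.lsmul Λ E z) j a = z • a := by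
  obtain ⟨y, rfl⟩ := pairHomology.mk_surjective _ _ a
  rw [← map_smul]
  unfold matHomologyMap
  rw [pairHomology.map_mk _ _ _ _ _ y (z • y) rfl]

variable {A}

lemma exists_exact_matHomology (hA : ∀ j, A j * A (j + 1) = 0) {X Y W : Type u} [AddCommGroup X]
    [Module Λ X] [AddCommGroup Y] [Module Λ Y] [AddCommGroup W] [Module Λ W]
    (f : X →ₗ[Λ] Y) (g : Y →ₗ[Λ] W) (hi : Injective f) (hs : Surjective g) (he : Exact f g) (j : ℕ) :
    ∃ δ : matHomology A W (j + 1) →ₗ[Λ] matHomology A X j,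
      Exact (matHomologyMap A g (j + 1)) δ ∧ Exact δ (matHomologyMap A f j) ∧
      Exact (matHomologyMap A f j) (matHomologyMap A g j) := by
  have h0 : ∀ (E : Type u) [AddCommGroup E] [Module Λ E] (j : ℕ),
      matAct (A j) E ∘ₗ matAct (A (j + 1)) E = 0 := by
    intro E _ _ j; ext1 x
    rw [LinearMap.comp_apply, matAct_comp, hA, matAct_zero]; rfl
  have hi' : ∀ j, Injective (f.compLeft (ι j)) := fun j a b h =>
    funext fun i => hi (congr_fun h i)
  have hs' : ∀ j, Surjective (g.compLeft (ι j)) := fun j w => by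
    choose v hv using fun i => hs (w i)
    exact ⟨v, funext hv⟩
  have he' : ∀ j, Exact (f.compLeft (ι j)) (g.compLeft (ι j)) := by
    intro j y
    constructor
    · intro h
      choose v hv using fun i => (he (y i)).1 (congr_fun h i)
      exact ⟨v, funext hv⟩
    · rintro ⟨x, rfl⟩; ext i; exact (he _).2 ⟨x i, rfl⟩
  exact exists_long_exact (X := fun j => ι j → X) (Y := fun j => ι j → Y)
    (W := fun j => ι j → W) (fun j => matAct (A j) X) (fun j => matAct (A j) Y)
    (fun j => matAct (A j) W) (fun j => f.compLeft (ι j)) (fun j => g.compLeft (ι j))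
    (h0 X) (h0 Y) (h0 W) (fun j => matAct_naturality (A j) f)
    (fun j => matAct_naturality (A j) g) hi' hs' he' j

lemma matHomologyMap_zero_surjective [IsEmpty (ι 0)] (g : E →ₗ[Λ] P) (hs : Surjective g) :
    Surjective (matHomologyMap A g 0) := by
  intro a
  obtain ⟨w, rfl⟩ := pairHomology.mk_surjective _ _ a
  choose v hv using fun i => hs (w.1 i)
  refine ⟨pairHomology.mk _ _ ⟨v, LinearMap.mem_ker.2 (Subsingleton.elim _ _)⟩, ?_⟩
  unfold matHomologyMap
  rw [pairHomology.map_mk _ _ _ _ _ _ w (funext fun i => (hv i).symm)]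

lemma annihilator_le_matHomology (j : ℕ) :
    annihilator Λ E ≤ annihilator Λ (matHomology A E j) := by
  intro r hr
  refine mem_annihilator.2 fun a => ?_
  obtain ⟨y, rfl⟩ := pairHomology.mk_surjective _ _ a
  rw [← map_smul]
  have h0 : r • y = 0 := by
    ext i
    exact mem_annihilator.1 hr _
  rw [h0, map_zero]

variable [IsNoetherianRing Λ] [IsLocalRing Λ]

lemma AdditiveOn.matHomology_succ {I : Ideal Λ}
    {χ : (D : Type u) → [AddCommGroup D] → [Module Λ D] → ℤ} (z : Λ)
    (hχ : AdditiveOn (I ⊔ Ideal.span {z}) χ) (hA : ∀ j, A j * A (j + 1) = 0)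
    [Module.Finite Λ E] (hz : IsSMulRegular E z)
    (hI : ∀ j, I ≤ annihilator Λ (matHomology A E j))
    (hI' : ∀ j, I ≤ annihilator Λ (matHomology A (QuotSMulTop z E) j)) (j : ℕ) :
    χ (matHomology A (QuotSMulTop z E) (j + 1)) = χ (QuotSMulTop z (matHomology A E (j + 1))) +
      χ (Submodule.torsionBy Λ (matHomology A E j) z) := by
  have he : Exact (LinearMap.lsmul Λ E z) (Submodule.mkQ (z • ⊤ : Submodule Λ E)) := fun x => by
    simp [Submodule.mem_smul_pointwise_iff_exists]
  obtain ⟨δ, h1, h2, -⟩ := exists_exact_matHomology hA (LinearMap.lsmul Λ E z)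
    (Submodule.mkQ (z • ⊤ : Submodule Λ E)) (fun a b h => hz h) (Submodule.mkQ_surjective _) he j
  obtain ⟨-, -, -, h3⟩ := exists_exact_matHomology hA (LinearMap.lsmul Λ E z)
    (Submodule.mkQ (z • ⊤ : Submodule Λ E)) (fun a b h => hz h) (Submodule.mkQ_surjective _) he (j + 1)
  have hE : I ⊔ Ideal.span {z} ≤ annihilator Λ (matHomology A (QuotSMulTop z E) (j + 1)) := by
    refine sup_le (hI' _) ((Ideal.span_singleton_le_iff_mem _).2 
      (annihilator_le_matHomology _ (QuotSMulTop.mem_annihilator _ z)))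
  rw [hχ.eq_range_add_range hE _ _ h1]
  congr 1
  · symm
    refine hχ.congr (le_annihilator_quotSMulTop (hI _) z) ?_
    refine (Submodule.quotEquivOfEq _ _ ?_).trans (LinearMap.quotKerEquivRange _)
    rw [h3.linearMap_ker_eq]
    ext a
    simp only [Submodule.mem_smul_pointwise_iff_exists, LinearMap.mem_range, matHomologyMap_smul]
    simp
  · symm
    refine hχ.congr (le_annihilator_torsionBy (hI _) z) (LinearEquiv.ofEq _ _ ?_)
    rw [← h2.linearMap_ker_eq]
    ext a
    simp [matHomologyMap_smul]

lemma AdditiveOn.matHomology_zero {I : Ideal Λ} [IsEmpty (ι 0)]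
    {χ : (D : Type u) → [AddCommGroup D] → [Module Λ D] → ℤ} (z : Λ)
    (hχ : AdditiveOn (I ⊔ Ideal.span {z}) χ) (hA : ∀ j, A j * A (j + 1) = 0)
    [Module.Finite Λ E] (hz : IsSMulRegular E z)
    (hI : ∀ j, I ≤ annihilator Λ (matHomology A E j)) :
    χ (matHomology A (QuotSMulTop z E) 0) = χ (QuotSMulTop z (matHomology A E 0)) := by
  have he : Exact (LinearMap.lsmul Λ E z) (Submodule.mkQ (z • ⊤ : Submodule Λ E)) := fun x => by
    simp [Submodule.mem_smul_pointwise_iff_exists]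
  obtain ⟨-, -, -, h3⟩ := exists_exact_matHomology hA (LinearMap.lsmul Λ E z)
    (Submodule.mkQ (z • ⊤ : Submodule Λ E)) (fun a b h => hz h) (Submodule.mkQ_surjective _) he 0
  symm
  refine hχ.congr (le_annihilator_quotSMulTop (hI _) z) ?_
  refine (Submodule.quotEquivOfEq _ _ ?_).trans (LinearMap.quotKerEquivOfSurjective _
    (matHomologyMap_zero_surjective (A := A) _ (Submodule.mkQ_surjective (z • ⊤ : Submodule Λ E))))
  rw [h3.linearMap_ker_eq]
  ext a
  simp only [Submodule.mem_smul_pointwise_iff_exists, LinearMap.mem_range, matHomologyMap_smul]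
  simp

lemma subsingleton_matHomology_of_quotSMulTop [Module.Finite Λ E]
    (hA : ∀ j, A j * A (j + 1) = 0) {z : Λ} (hz : IsSMulRegular E z) (hzm : z ∈ maximalIdeal Λ)
    (j : ℕ) (h : Subsingleton (matHomology A (QuotSMulTop z E) j)) :
    Subsingleton (matHomology A E j) := by
  have he : Exact (LinearMap.lsmul Λ E z) (Submodule.mkQ (z • ⊤ : Submodule Λ E)) := fun x => by
    simp [Submodule.mem_smul_pointwise_iff_exists]
  obtain ⟨-, -, -, h3⟩ := exists_exact_matHomology hA (LinearMap.lsmul Λ E z)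
    (Submodule.mkQ (z • ⊤ : Submodule Λ E)) (fun a b h => hz h) (Submodule.mkQ_surjective _) he j
  have h4 : (⊤ : Submodule Λ (matHomology A E j)) ≤ Ideal.span {z} • ⊤ := by
    intro a _
    obtain ⟨b, rfl⟩ := (h3 a).1 (Subsingleton.elim _ _)
    rw [matHomologyMap_smul]
    exact Submodule.smul_mem_smul (Ideal.mem_span_singleton_self z) trivial
  have h5 := Submodule.eq_bot_of_le_smul_of_le_jacobson_bot (Ideal.span {z}) ⊤
    (Module.Finite.fg_top) h4 (by
      rw [IsLocalRing.jacobson_eq_maximalIdeal _ bot_ne_top]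
      exact (Ideal.span_singleton_le_iff_mem _).2 hzm)
  exact (Submodule.subsingleton_iff Λ).1 ((subsingleton_iff_bot_eq_top).1 h5.symm)

/-- Alternating sums of Koszul characteristics of homology are preserved by cutting with
a regular sequence. -/
theorem sum_koszulChar_matHomology (hA : ∀ j, A j * A (j + 1) = 0) [IsEmpty (ι 0)] (J : ℕ)
    {I : Ideal Λ} (hI : ∀ (E : Type u) [AddCommGroup E] [Module Λ E] (j : ℕ),
      I ≤ annihilator Λ (matHomology A E j)) (zs : List Λ) :
    ∀ (K : Ideal Λ), maximalIdeal Λ ≤ (I ⊔ K ⊔ Ideal.ofList zs).radical →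
    (∀ z ∈ zs, z ∈ maximalIdeal Λ) →
    ∀ (E P : Type u) [AddCommGroup E] [Module Λ E] [Module.Finite Λ E] [AddCommGroup P]
      [Module Λ P], K ≤ annihilator Λ E → RingTheory.Sequence.IsWeaklyRegular E zs →
      ((E ⧸ (Ideal.ofList zs • ⊤ : Submodule Λ E)) ≃ₗ[Λ] P) →
      (∀ j ≥ J, Subsingleton (matHomology A P j)) →
      (∀ j ≥ J, Subsingleton (matHomology A E j)) ∧
      ∑ j ∈ Finset.range (J + 1), (-1) ^ j * koszulChar zs (matHomology A E j) =
        ∑ j ∈ Finset.range (J + 1), (-1) ^ j * ((length Λ (matHomology A P j)).toNat : ℤ) := by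
  induction zs with
  | nil =>
    intro _ _ _ E P _ _ _ _ _ _ _ e hP
    have e' : E ≃ₗ[Λ] P := (Submodule.quotEquivOfEqBot _ (by simp)).symm.trans e
    refine ⟨fun j hj => ?_, ?_⟩
    · have := hP j hj
      exact (matHomologyCongr A e' j).toEquiv.subsingleton
    · simp only [koszulChar]
      refine Finset.sum_congr rfl fun j _ => ?_
      rw [(matHomologyCongr A e' j).length_eq]
  | cons z zs ih =>
    intro K hK hz E P _ _ _ _ _ hE hreg e hP
    rw [RingTheory.Sequence.isWeaklyRegular_cons_iff] at hreg
    rw [Ideal.ofList_cons, ← sup_assoc] at hK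
    have hχ : AdditiveOn _ (koszulChar zs) := additiveOn_koszulChar zs _ hK
    have hz0 := hz z (by simp)
    have hE' := le_annihilator_quotSMulTop hE z
    obtain ⟨h1, h2⟩ := ih (K ⊔ Ideal.span {z}) (by rwa [← sup_assoc])
      (fun w hw => hz w (by simp [hw])) (QuotSMulTop z E) P hE' hreg.2
      ((Submodule.quotOfListConsSMulTopEquivQuotSMulTopInner E z zs).symm.trans e) hP
    have hk : ∀ j, I ⊔ K ≤ annihilator Λ (matHomology A E j) := fun j =>
      sup_le (hI _ _) (hE.trans (annihilator_le_matHomology j))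
    have hk' : ∀ j, I ⊔ K ≤ annihilator Λ (matHomology A (QuotSMulTop z E) j) := fun j =>
      sup_le (hI _ _) ((le_sup_left.trans hE').trans (annihilator_le_matHomology j))
    have h3 : ∀ j ≥ J, Subsingleton (matHomology A E j) := fun j hj =>
      subsingleton_matHomology_of_quotSMulTop hA hreg.1 hz0 j (h1 j hj)
    refine ⟨h3, h2 ▸ ?_⟩
    have h4 : ∀ J, ∑ j ∈ Finset.range (J + 1), (-1) ^ j * koszulChar (z :: zs) (matHomology A E j) =
        ∑ j ∈ Finset.range (J + 1), (-1) ^ j * koszulChar zs (matHomology A (QuotSMulTop z E) j)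
        - (-1) ^ J * koszulChar zs (Submodule.torsionBy Λ (matHomology A E J) z) := by
      intro J
      induction J with
      | zero => simp [koszulChar, hχ.matHomology_zero z hA hreg.1 hk]
      | succ J ihJ =>
        rw [Finset.sum_range_succ, ihJ, Finset.sum_range_succ _ (J + 1),
          hχ.matHomology_succ z hA hreg.1 hk hk']
        simp only [koszulChar]
        ring
    have := h3 J le_rfl
    rw [h4, hχ.eq_zero, mul_zero, sub_zero]

end MatrixComplex

section Homotopy

open Module Function Matrix

variable {S : Type u} [CommRing S] {ι : ℕ → Type} [∀ j, Fintype (ι j)]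
  {A : ∀ j, Matrix (ι j) (ι (j + 1)) S}

lemma Matrix.exists_mul_eq_of_mulVec {m n l : Type} [Fintype n] [Fintype l] (A : Matrix m n S)
    (C : Matrix m l S) (h : ∀ i, ∃ w, A *ᵥ w = C.col i) : ∃ k : Matrix n l S, A * k = C := by
  choose w hw using h
  refine ⟨(Matrix.of w)ᵀ, ?_⟩
  ext i j
  exact congr_fun (hw j) i

variable [∀ j, DecidableEq (ι j)]

/-- A scalar killing the zeroth homology of a free resolution is null-homotopic on it. -/
theorem exists_matrix_homotopy (hA : ∀ j, A j * A (j + 1) = 0) [IsEmpty (ι 0)]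
    (hex : ∀ j (v : ι (j + 2) → S), A (j + 1) *ᵥ v = 0 → ∃ w, A (j + 2) *ᵥ w = v) {q : S}
    (hq : ∀ v : ι 1 → S, ∃ w, A 1 *ᵥ w = q • v) (j : ℕ) :
    ∃ (h : Matrix (ι (j + 1)) (ι j) S) (k : Matrix (ι (j + 2)) (ι (j + 1)) S),
      A (j + 1) * k + h * A j = q • 1 := by
  induction j with
  | zero =>
    obtain ⟨k, hk⟩ := Matrix.exists_mul_eq_of_mulVec (A 1) (q • 1) fun i => hq (Pi.single i 1)
      |>.imp fun w hw => by
        rw [hw]; ext j; simp [Matrix.one_apply, Pi.single_apply]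
    exact ⟨0, k, by simp [hk]⟩
  | succ j ih =>
    obtain ⟨h, k, hk⟩ := ih
    have h0 : A (j + 1) * (q • 1 - k * A (j + 1)) = 0 := by
      have : A (j + 1) * (q • 1 - k * A (j + 1)) = (q • 1 - A (j + 1) * k) * A (j + 1) := by
        simp [Matrix.mul_sub, Matrix.sub_mul, Matrix.mul_assoc]
      rw [this, ← hk, add_sub_cancel_left, Matrix.mul_assoc, hA, Matrix.mul_zero]
    obtain ⟨k', hk'⟩ := Matrix.exists_mul_eq_of_mulVec (A (j + 2)) (q • 1 - k * A (j + 1))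
      fun i => hex j _ (by
        ext l; exact congr_fun (congr_fun h0 l) i)
    exact ⟨k, k', by rw [hk', sub_add_cancel]⟩

end Homotopy

section MatAct

open Module Function

variable {Λ : Type u} [CommRing Λ] {E : Type u} [AddCommGroup E] [Module Λ E]
  {m n : Type} [Fintype n]

lemma matAct_add_matrix (A B : Matrix m n Λ) (v : n → E) :
    matAct (A + B) E v = matAct A E v + matAct B E v := by
  ext i; simp [matAct_apply, add_smul, Finset.sum_add_distrib]

lemma matAct_smul_one [DecidableEq n] (q : Λ) (v : n → E) :
    matAct (q • (1 : Matrix n n Λ)) E v = q • v := by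
  ext i; simp [matAct_apply, Matrix.one_apply, ite_smul]

/-- Matrices over different rings with the same action on `E`. -/
lemma matAct_congr {T : Type u} [CommRing T] [Module T E] (A : Matrix m n Λ) (B : Matrix m n T)
    (h : ∀ i k (e : E), A i k • e = B i k • e) (v : n → E) : matAct A E v = matAct B E v := by
  ext i; simp [matAct_apply, h]

variable {ι : ℕ → Type} [∀ j, Fintype (ι j)] {A : ∀ j, Matrix (ι j) (ι (j + 1)) Λ}

lemma exists_matAct_eq_smul [∀ j, DecidableEq (ι j)] {q : Λ} {j : ℕ}
    (h : ∃ (h : Matrix (ι (j + 1)) (ι j) Λ) (k : Matrix (ι (j + 2)) (ι (j + 1)) Λ),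
      A (j + 1) * k + h * A j = q • 1) (x : ι (j + 1) → E) (hx : matAct (A j) E x = 0) :
    ∃ y, matAct (A (j + 1)) E y = q • x := by
  obtain ⟨h, k, hk⟩ := h
  refine ⟨matAct k E x, ?_⟩
  rw [← matAct_smul_one, ← hk, matAct_add_matrix, matAct_comp, ← matAct_comp h, hx]
  simp

lemma mem_annihilator_matHomology {q : Λ} {j : ℕ}
    (h : ∀ x : ι (j + 1) → E, matAct (A j) E x = 0 → ∃ y, matAct (A (j + 1)) E y = q • x) :
    q ∈ annihilator Λ (matHomology A E j) := by
  refine mem_annihilator.2 fun a => ?_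
  obtain ⟨y, rfl⟩ := pairHomology.mk_surjective _ _ a
  rw [← map_smul, pairHomology.mk_eq_zero]
  exact h _ y.2

end MatAct

section FiniteResolution

open Module Function Matrix

variable {T : Type u} [CommRing T] {ι κ : ℕ → Type} [∀ j, Fintype (ι j)] [∀ j, Fintype (κ j)]
  {A : ∀ j, Matrix (ι j) (ι (j + 1)) T} {C : ∀ j, Matrix (κ j) (κ (j + 1)) T}

lemma subsingleton_matHomology_pi
    (hex : ∀ j (v : ι (j + 2) → T), A (j + 1) *ᵥ v = 0 → ∃ w, A (j + 2) *ᵥ w = v)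
    (n : Type) (j : ℕ) : Subsingleton (matHomology A (n → T) (j + 1)) := by
  refine pairHomology.subsingleton fun y hy => ?_
  have h : ∀ i, ∃ w, A (j + 2) *ᵥ w = fun k => y k i := fun i => hex j _ (by
    ext k; simpa [matAct_apply, mulVec, dotProduct] using congr_fun (congr_fun hy k) i)
  choose w hw using h
  refine ⟨fun k i => w i k, ?_⟩
  ext k i
  simpa [matAct_apply, mulVec, dotProduct] using congr_fun (hw i) k

/-- Higher homology with coefficients in a module with a finite free resolution vanishes. -/
theorem exists_subsingleton_matHomology (hA : ∀ j, A j * A (j + 1) = 0)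
    (hex : ∀ j (v : ι (j + 2) → T), A (j + 1) *ᵥ v = 0 → ∃ w, A (j + 2) *ᵥ w = v)
    (hexC : ∀ j (v : κ (j + 2) → T), C (j + 1) *ᵥ v = 0 → ∃ w, C (j + 2) *ᵥ w = v)
    (hC : ∀ j, C j * C (j + 1) = 0)
    {n : ℕ} (hn : IsEmpty (κ (n + 1))) {E : Type u} [AddCommGroup E] [Module T E]
    (π : (κ 1 → T) →ₗ[T] E) (hπ : Surjective π) (hπ' : Exact (C 1).mulVecLin π) (j : ℕ)
    (hj : n + 2 ≤ j) : Subsingleton (matHomology A E j) := by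
  -- one step of dimension shifting
  have hstep : ∀ (X Y : Type u) [AddCommGroup X] [Module T X] [AddCommGroup Y] [Module T Y]
      (l : Type) (f : X →ₗ[T] (l → T)) (g : (l → T) →ₗ[T] Y), Injective f → Surjective g →
      Exact f g → ∀ j, Subsingleton (matHomology A X j) →
      Subsingleton (matHomology A Y (j + 1)) := by
    intro X Y _ _ _ _ l f g hf hg hfg j hX
    obtain ⟨δ, h1, -, -⟩ := exists_exact_matHomology hA f g hf hg hfg j
    have := subsingleton_matHomology_pi hex l j
    refine subsingleton_of_forall_eq 0 fun a => ?_
    obtain ⟨b, rfl⟩ := (h1 a).1 (Subsingleton.elim _ _)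
    rw [Subsingleton.elim b 0, map_zero]
  have hrange : ∀ k i, k + i = n → ∀ j, k ≤ j →
      Subsingleton (matHomology A (LinearMap.range (C (i + 1)).mulVecLin) (j + 1)) := by
    intro k
    induction k with
    | zero =>
      intro i hi j _
      obtain rfl : i = n := by omega
      have h0 : annihilator T (LinearMap.range (C (i + 1)).mulVecLin) = ⊤ :=
        annihilator_eq_top_iff.2 inferInstance
      have h1 := annihilator_le_matHomology (A := A) (E := LinearMap.range (C (i + 1)).mulVecLin)
        (j + 1)
      rw [h0, top_le_iff, annihilator_eq_top_iff] at h1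
      exact h1
    | succ k ih =>
      intro i hi j hj
      obtain ⟨j, rfl⟩ : ∃ j', j = j' + 1 := ⟨j - 1, by omega⟩
      refine hstep _ _ _ (LinearMap.range (C (i + 2)).mulVecLin).subtype
        (C (i + 1)).mulVecLin.rangeRestrict Subtype.val_injective
        (LinearMap.surjective_rangeRestrict _) ?_ (j + 1) (ih (i + 1) (by omega) j (by omega))
      rw [LinearMap.exact_iff, LinearMap.ker_rangeRestrict, Submodule.range_subtype]
      refine le_antisymm (fun v hv => ?_) ?_
      · exact hexC i v hv
      · rintro _ ⟨w, rfl⟩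
        simp [mulVec_mulVec, hC]
  obtain ⟨j, rfl⟩ : ∃ j', j = j' + 1 + 1 := ⟨j - 2, by omega⟩
  refine hstep (LinearMap.range (C 1).mulVecLin) _ _ (Submodule.subtype _) π Subtype.val_injective
    hπ ?_ (j + 1) (hrange n 0 (by omega) j (by omega))
  rw [LinearMap.exact_iff, Submodule.range_subtype, hπ'.linearMap_ker_eq]

end FiniteResolution

section Cone

open Module Function Matrix

/-- The family of index types `ι` shifted by one. -/
def shiftIdx (ι : ℕ → Type) : ℕ → Type
  | 0 => Empty
  | j + 1 => ι j

instance {ι : ℕ → Type} [∀ j, Fintype (ι j)] : ∀ j, Fintype (shiftIdx ι j)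
  | 0 => inferInstanceAs (Fintype Empty)
  | j + 1 => inferInstanceAs (Fintype (ι j))

instance {ι : ℕ → Type} [∀ j, DecidableEq (ι j)] : ∀ j, DecidableEq (shiftIdx ι j)
  | 0 => inferInstanceAs (DecidableEq Empty)
  | j + 1 => inferInstanceAs (DecidableEq (ι j))

instance {ι : ℕ → Type} : IsEmpty (shiftIdx ι 0) := inferInstanceAs (IsEmpty Empty)

variable {S : Type u} [CommRing S] {ι : ℕ → Type}

/-- The family of matrices `φ` shifted by one. -/
def shiftMat (φ : ∀ j, Matrix (ι j) (ι (j + 1)) S) : ∀ j, Matrix (shiftIdx ι j) (ι j) S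
  | 0 => fun i => i.elim
  | j + 1 => φ j

/-- The family of matrices `ψ` of degree two shifted by one. -/
def shiftMat₂ (ψ : ∀ j, Matrix (ι j) (ι (j + 2)) S) : ∀ j, Matrix (shiftIdx ι j) (ι (j + 1)) S
  | 0 => fun i => i.elim
  | j + 1 => ψ j

variable [∀ j, Fintype (ι j)] [∀ j, DecidableEq (ι j)]

/-- The differentials of the resolution over `S` obtained from a resolution over `S ⧸ (f)`
with lifted differentials `φ` such that `φ * φ = f • ψ`. -/
def coneMat (f : S) (φ : ∀ j, Matrix (ι j) (ι (j + 1)) S) (ψ : ∀ j, Matrix (ι j) (ι (j + 2)) S)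
    (j : ℕ) : Matrix (ι j ⊕ shiftIdx ι j) (ι (j + 1) ⊕ shiftIdx ι (j + 1)) S :=
  fromBlocks (φ j) (f • (1 : Matrix (ι j) (ι j) S)) (-shiftMat₂ ψ j) (-shiftMat φ j)

variable {f : S} {φ : ∀ j, Matrix (ι j) (ι (j + 1)) S} {ψ : ∀ j, Matrix (ι j) (ι (j + 2)) S}

lemma coneMat_mul (hf : ∀ x, f * x = 0 → x = 0) (hψ : ∀ j, φ j * φ (j + 1) = f • ψ j) (j : ℕ) :
    coneMat f φ ψ j * coneMat f φ ψ (j + 1) = 0 := by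
  have h1 : ∀ j, φ j * φ (j + 1) + (f • (1 : Matrix (ι j) (ι j) S)) * (-ψ j) = 0 := fun j => by
    rw [hψ]; simp
  have h2 : ∀ j, φ j * (f • (1 : Matrix (ι (j + 1)) (ι (j + 1)) S)) +
      (f • (1 : Matrix (ι j) (ι j) S)) * (-φ j) = 0 := fun j => by simp
  have h3 : ∀ j, (-shiftMat₂ ψ j) * φ (j + 1) + (-shiftMat φ j) * (-ψ j) = 0 := by
    rintro (_ | j)
    · ext i; exact i.elim
    · have : f • ((-ψ j) * φ (j + 2) + (-φ j) * (-ψ (j + 1))) = 0 := by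
        rw [smul_add, ← Matrix.smul_mul, smul_neg, ← hψ, ← Matrix.mul_smul, smul_neg, ← hψ]
        simp [Matrix.mul_assoc]
      ext a b
      exact hf _ (congr_fun (congr_fun this a) b)
  have h4 : ∀ j, (-shiftMat₂ ψ j) * (f • (1 : Matrix (ι (j + 1)) (ι (j + 1)) S)) +
      (-shiftMat φ j) * (-φ j) = 0 := by
    rintro (_ | j)
    · ext i; exact i.elim
    · have : (-ψ j) * (f • (1 : Matrix (ι (j + 2)) (ι (j + 2)) S)) + (-φ j) * (-φ (j + 1)) = 0 := by
        rw [Matrix.neg_mul, Matrix.neg_mul, Matrix.mul_neg, hψ]; simp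
      exact this
  refine (fromBlocks_multiply _ _ _ _ _ _ _ _).trans ?_
  rw [← fromBlocks_zero]
  congr 1
  · exact h1 j
  · exact h2 j
  · exact h3 j
  · exact h4 j

lemma coneMat_mulVec (j : ℕ) (x : ι (j + 1) → S) (y : ι j → S) :
    coneMat f φ ψ j *ᵥ (Sum.elim x y : ι (j + 1) ⊕ shiftIdx ι (j + 1) → S) =
      Sum.elim (φ j *ᵥ x + f • y) (-(shiftMat₂ ψ j *ᵥ x) - shiftMat φ j *ᵥ y) := by
  refine (fromBlocks_mulVec _ _ _ _ _).trans ?_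
  congr 1
  · change φ j *ᵥ x + (f • 1) *ᵥ y = _
    rw [smul_mulVec, one_mulVec]
  · change (-shiftMat₂ ψ j) *ᵥ x + (-shiftMat φ j) *ᵥ y = _
    rw [neg_mulVec, neg_mulVec, sub_eq_add_neg]

variable {T : Type u} [CommRing T] {π : S →+* T}

omit [∀ j, DecidableEq (ι j)] in
lemma exists_eq_mulVec_add_smul (hπ : Surjective π) (hker : ∀ x, π x = 0 → ∃ y, x = f * y)
    (j : ℕ) {x : ι j → S} (h : ∃ w, (φ j).map π *ᵥ w = π ∘ x) :
    ∃ w u, φ j *ᵥ w + f • u = x := by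
  obtain ⟨w, hw⟩ := h
  choose w' hw' using fun i => hπ (w i)
  obtain rfl : π ∘ w' = w := funext hw'
  have h1 : ∀ i, ∃ y, x i - (φ j *ᵥ w') i = f * y := fun i => hker _ (by
    rw [map_sub, sub_eq_zero, RingHom.map_mulVec]
    exact (congr_fun hw i).symm)
  choose u hu using h1
  refine ⟨w', u, ?_⟩
  ext i
  simp [← hu i]

/-- The cone complex is exact in positive degrees. -/
lemma coneMat_exact (hπ : Surjective π) (hker : ∀ x, π x = 0 → ∃ y, x = f * y) (hπf : π f = 0)
    (hf : ∀ x, f * x = 0 → x = 0) (hψ : ∀ j, φ j * φ (j + 1) = f • ψ j)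
    (hex : ∀ j (v : ι (j + 2) → T), (φ (j + 1)).map π *ᵥ v = 0 →
      ∃ w, (φ (j + 2)).map π *ᵥ w = v)
    (j : ℕ) (v : ι (j + 2) ⊕ shiftIdx ι (j + 2) → S) (hv : coneMat f φ ψ (j + 1) *ᵥ v = 0) :
    ∃ w, coneMat f φ ψ (j + 2) *ᵥ w = v := by
  obtain ⟨x, y, rfl⟩ : ∃ (x : ι (j + 2) → S) (y : ι (j + 1) → S), v = Sum.elim x y :=
    ⟨v ∘ Sum.inl, v ∘ Sum.inr, (Sum.elim_comp_inl_inr v).symm⟩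
  have hv1 := (coneMat_mulVec (j + 1) x y).symm.trans hv
  have h1 : φ (j + 1) *ᵥ x + f • y = 0 := funext fun i => congr_fun hv1 (Sum.inl i)
  obtain ⟨w, u, h2⟩ := exists_eq_mulVec_add_smul (φ := φ) hπ hker (j + 2) (hex j (π ∘ x) (by
    ext i
    rw [← RingHom.map_mulVec, eq_neg_of_add_eq_zero_left h1]
    simp [hπf]))
  refine ⟨Sum.elim w u, (coneMat_mulVec (j + 2) w u).trans ?_⟩
  rw [h2]
  set y' : ι (j + 1) → S := -(shiftMat₂ ψ (j + 2) *ᵥ w) - shiftMat φ (j + 2) *ᵥ u with hy'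
  have h3 : coneMat f φ ψ (j + 1) *ᵥ (Sum.elim x y' : ι (j + 2) ⊕ shiftIdx ι (j + 2) → S) = 0 := by
    rw [← h2, hy']
    refine (congr_arg (coneMat f φ ψ (j + 1) *ᵥ ·) (coneMat_mulVec (j + 2) w u).symm).trans ?_
    simp only [mulVec_mulVec, coneMat_mul hf hψ, zero_mulVec]
  replace h3 := (coneMat_mulVec (j + 1) x y').symm.trans h3
  have h4 : φ (j + 1) *ᵥ x + f • y' = 0 := funext fun i => congr_fun h3 (Sum.inl i)
  congr 1
  ext i
  have h5 := congr_fun (h4.trans h1.symm) i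
  simp only [Pi.add_apply, Pi.smul_apply, smul_eq_mul, add_right_inj] at h5
  exact sub_eq_zero.1 (hf _ (by rw [mul_sub, h5, sub_self]))

lemma coneMat_one_smul [IsEmpty (ι 0)] (hπ : Surjective π)
    (hker : ∀ x, π x = 0 → ∃ y, x = f * y) {q : S}
    (hq : ∀ v : ι 1 → T, ∃ w, (φ 1).map π *ᵥ w = π q • v) (v : ι 1 ⊕ shiftIdx ι 1 → S) :
    ∃ w, coneMat f φ ψ 1 *ᵥ w = q • v := by
  obtain ⟨w, u, h⟩ := exists_eq_mulVec_add_smul (φ := φ) hπ hker 1 (x := q • (v ∘ Sum.inl))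
    ((hq (π ∘ v ∘ Sum.inl)).imp fun w hw => by rw [hw]; ext i; simp)
  refine ⟨Sum.elim w u, (coneMat_mulVec 1 w u).trans ?_⟩
  rw [h]
  ext (i | i)
  · rfl
  · exact isEmptyElim (show ι 0 from i)

end Cone

section ConeEuler

set_option linter.unusedSectionVars false

open Module Function Matrix IsLocalRing

variable {S : Type u} [CommRing S] {ι : ℕ → Type} [∀ j, Fintype (ι j)] [∀ j, DecidableEq (ι j)]
  {f : S} {φ : ∀ j, Matrix (ι j) (ι (j + 1)) S} {ψ : ∀ j, Matrix (ι j) (ι (j + 2)) S}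
  {Λ : Type u} [CommRing Λ] {g : S →+* Λ} {P : Type u} [AddCommGroup P] [Module Λ P]

lemma matAct_coneMat (hP : ∀ x : P, g f • x = 0) (j : ℕ)
    (v : ι (j + 1) ⊕ shiftIdx ι (j + 1) → P) :
    matAct ((coneMat f φ ψ j).map g) P v = Sum.elim (matAct ((φ j).map g) P (v ∘ Sum.inl))
      (matAct ((-shiftMat₂ ψ j).map g) P (v ∘ Sum.inl) +
        matAct ((-shiftMat φ j).map g) P (fun i => v (Sum.inr i))) := by
  ext (i | i)
  · simp only [matAct_apply, Fintype.sum_sum_type, Sum.elim_inl]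
    refine add_eq_left.2 ?_
    refine Finset.sum_eq_zero fun k _ => ?_
    change g (f * (1 : Matrix (ι j) (ι j) S) i k) • _ = _
    rw [mul_comm, map_mul, mul_smul, hP, smul_zero]
  · simp only [matAct_apply, Fintype.sum_sum_type, Sum.elim_inr, Pi.add_apply]
    rfl

/-- The differentials of the shifted complex. -/
def shiftDiff (φ : ∀ j, Matrix (ι j) (ι (j + 1)) S) (g : S →+* Λ) (P : Type u) [AddCommGroup P]
    [Module Λ P] (j : ℕ) : (shiftIdx ι (j + 1) → P) →ₗ[Λ] (shiftIdx ι j → P) :=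
  matAct (n := ι j) ((-shiftMat φ j).map g) P

lemma shiftDiff_succ (j : ℕ) :
    shiftDiff φ g P (j + 1) = -(matAct ((φ j).map g) P : (ι (j + 1) → P) →ₗ[Λ] (ι j → P)) := by
  have h : ∀ v : ι (j + 1) → P,
      matAct ((-φ j).map g) P v = -(matAct ((φ j).map g) P v) := fun v => by
    ext i; simp [matAct_apply]
  exact LinearMap.ext h

lemma pairHomology.nonempty_equiv_neg {X Y W : Type u} [AddCommGroup X] [Module Λ X]
    [AddCommGroup Y] [Module Λ Y] [AddCommGroup W] [Module Λ W] {a a' : X →ₗ[Λ] Y} {b b' : Y →ₗ[Λ] W}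
    (ha : a' = -a) (hb : b' = -b) : Nonempty (pairHomology a' b' ≃ₗ[Λ] pairHomology a b) := by
  subst ha hb
  have h : ∀ K R K' R' : Submodule Λ Y, K = K' → R = R' →
      Nonempty (K.map R.mkQ ≃ₗ[Λ] K'.map R'.mkQ) := by
    rintro K R _ _ rfl rfl
    exact ⟨LinearEquiv.refl _ _⟩
  exact h _ _ _ _ (LinearMap.ker_neg b) (LinearMap.range_neg a)

lemma matAct_map_comp_eq_zero (hψ : ∀ j, φ j * φ (j + 1) = f • ψ j) (hP : ∀ x : P, g f • x = 0)
    (j : ℕ) : matAct ((φ j).map g) P ∘ₗ matAct ((φ (j + 1)).map g) P = 0 := by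
  refine LinearMap.ext fun v => ?_
  rw [LinearMap.comp_apply, matAct_comp, ← Matrix.map_mul, hψ]
  ext i
  simp [matAct_apply, mul_smul, hP]

lemma shiftDiff_comp (hψ : ∀ j, φ j * φ (j + 1) = f • ψ j) (hP : ∀ x : P, g f • x = 0)
    (j : ℕ) : shiftDiff φ g P j ∘ₗ shiftDiff φ g P (j + 1) = 0 := by
  rcases j with _ | j
  · exact LinearMap.ext fun v => funext fun i => i.elim
  · have h : (-(matAct ((φ j).map g) P)) ∘ₗ (-(matAct ((φ (j + 1)).map g) P)) = 0 := by
      rw [LinearMap.neg_comp, LinearMap.comp_neg, neg_neg]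
      exact matAct_map_comp_eq_zero hψ hP j
    rw [shiftDiff_succ, shiftDiff_succ]
    exact h

variable [IsNoetherianRing Λ] [IsLocalRing Λ] [Module.Finite Λ P]

/-- The Euler characteristic of the cone complex vanishes on modules killed by `f`. -/
theorem sum_length_coneMat (hf : ∀ x, f * x = 0 → x = 0) (hψ : ∀ j, φ j * φ (j + 1) = f • ψ j)
    [IsEmpty (ι 0)] (hP : ∀ x : P, g f • x = 0) {I : Ideal Λ} (hI : maximalIdeal Λ ≤ I.radical)
    (h1 : ∀ j, I ≤ annihilator Λ (matHomology (fun j => (φ j).map g) P j))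
    (h2 : ∀ j, I ≤ annihilator Λ (matHomology (fun j => (coneMat f φ ψ j).map g) P j)) {J : ℕ}
    (hJ : ∀ j ≥ J, Subsingleton (matHomology (fun j => (φ j).map g) P j)) :
    (∀ j ≥ J + 1, Subsingleton (matHomology (fun j => (coneMat f φ ψ j).map g) P j)) ∧
    ∑ j ∈ Finset.range (J + 2), (-1) ^ j *
      ((length Λ (matHomology (fun j => (coneMat f φ ψ j).map g) P j)).toNat : ℤ) = 0 := by
  let X : ℕ → Type u := fun j => shiftIdx ι j → P
  let Y : ℕ → Type u := fun j => ι j ⊕ shiftIdx ι j → P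
  let W : ℕ → Type u := fun j => ι j → P
  let dX : ∀ j, X (j + 1) →ₗ[Λ] X j := shiftDiff φ g P
  let dY : ∀ j, Y (j + 1) →ₗ[Λ] Y j := fun j => matAct ((coneMat f φ ψ j).map g) P
  let dW : ∀ j, W (j + 1) →ₗ[Λ] W j := fun j => matAct ((φ j).map g) P
  let a : ∀ j, X j →ₗ[Λ] Y j := fun j =>
    { toFun := fun x => Sum.elim 0 x
      map_add' := fun x y => funext fun i => by
        rcases i with i | i
        · exact (add_zero (0 : P)).symm
        · rfl
      map_smul' := fun r x => funext fun i => by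
        rcases i with i | i
        · exact (smul_zero r : r • (0 : P) = 0).symm
        · rfl }
  let b : ∀ j, Y j →ₗ[Λ] W j := fun j => LinearMap.funLeft Λ P Sum.inl
  have ha : ∀ j, a j ∘ₗ dX j = dY j ∘ₗ a (j + 1) := fun j => by
    refine LinearMap.ext fun x => Eq.trans ?_ (matAct_coneMat hP j _).symm
    have h0 : (a (j + 1) x) ∘ Sum.inl = (0 : ι (j + 1) → P) := rfl
    rw [h0, map_zero, map_zero, zero_add]
    rfl
  have hb : ∀ j, b j ∘ₗ dY j = dW j ∘ₗ b (j + 1) := fun j => by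
    refine LinearMap.ext fun x => ?_
    change (matAct ((coneMat f φ ψ j).map g) P x) ∘ Sum.inl = _
    rw [matAct_coneMat hP j x]
    rfl
  have hdX : ∀ j, dX j ∘ₗ dX (j + 1) = 0 := shiftDiff_comp hψ hP
  have hdW : ∀ j, dW j ∘ₗ dW (j + 1) = 0 := matAct_map_comp_eq_zero hψ hP
  have hdY : ∀ j, dY j ∘ₗ dY (j + 1) = 0 := fun j => by
    refine LinearMap.ext fun v => ?_
    refine (matAct_comp _ _ _).trans ?_
    rw [← Matrix.map_mul, coneMat_mul hf hψ]
    refine funext fun i => (matAct_apply _ _ _).trans ?_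
    simp only [Matrix.map_apply, Matrix.zero_apply, map_zero, zero_smul, Finset.sum_const_zero]
    rfl
  have hai : ∀ j, Injective (a j) := fun j x y h =>
    funext fun i => congr_fun h (Sum.inr i)
  have hbs : ∀ j, Surjective (b j) := fun j w => ⟨Sum.elim w 0, rfl⟩
  have hab : ∀ j, Exact (a j) (b j) := fun j y => by
    constructor
    · intro h
      refine ⟨y ∘ Sum.inr, ?_⟩
      refine funext fun i => ?_
      rcases i with i | i
      · exact (congr_fun h i).symm
      · rfl
    · rintro ⟨x, rfl⟩; rfl
  choose δ e1 e2 e3 using exists_long_exact dX dY dW a b hdX hdY hdW ha hb hai hbs hab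
  have hχ : AdditiveOn I (koszulChar ([] : List Λ)) := additiveOn_koszulChar ([] : List Λ) I (by simpa using hI)
  have hX0 : Subsingleton (seqHomology dX 0) := by
    refine pairHomology.subsingleton fun y _ => ⟨0, ?_⟩
    exact funext fun i => isEmptyElim (show ι 0 from i)
  have eX : ∀ j, Nonempty (seqHomology dX (j + 1) ≃ₗ[Λ] seqHomology dW j) := by
    intro j
    exact pairHomology.nonempty_equiv_neg (X := ι (j + 2) → P) (Y := ι (j + 1) → P)
      (W := ι j → P) (shiftDiff_succ (j + 1)) (shiftDiff_succ j)
  have hX : ∀ j, I ≤ annihilator Λ (seqHomology dX j) := by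
    rintro (_ | j)
    · rw [annihilator_eq_top_iff.2 hX0]; exact le_top
    · rw [(eX j).some.annihilator_eq]; exact h1 j
  have hXfin : ∀ j, Module.Finite Λ (seqHomology dX j) := by
    rintro (_ | j)
    · infer_instance
    · exact Module.Finite.equiv (eX j).some.symm
  have hXsub : ∀ j ≥ J + 1, Subsingleton (seqHomology dX j) := by
    rintro (_ | j) hj
    · omega
    · have := hJ j (by omega)
      exact (eX j).some.toEquiv.subsingleton
  refine ⟨fun j hj => ?_, ?_⟩
  · have := hXsub j hj
    have := hJ j (by omega)
    refine subsingleton_of_forall_eq 0 fun y => ?_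
    obtain ⟨x, hx⟩ := (e3 j y).1 (Subsingleton.elim (α := matHomology _ P j) _ _)
    rw [← hx, Subsingleton.elim x 0, map_zero]
  have hy : ∀ j, koszulChar ([] : List Λ) (seqHomology dY j) =
      koszulChar ([] : List Λ) (LinearMap.range (seqHomologyMap dX dY a ha j)) +
      koszulChar ([] : List Λ) (LinearMap.range (seqHomologyMap dY dW b hb j)) := fun j =>
    hχ.eq_range_add_range (h2 j) _ _ (e3 j)
  have hx : ∀ j, koszulChar ([] : List Λ) (seqHomology dX j) = koszulChar ([] : List Λ) (LinearMap.range (δ j)) +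
      koszulChar ([] : List Λ) (LinearMap.range (seqHomologyMap dX dY a ha j)) := fun j =>
    hχ.eq_range_add_range (hX j) _ _ (e2 j)
  have hw : ∀ j, koszulChar ([] : List Λ) (seqHomology dW (j + 1)) =
      koszulChar ([] : List Λ) (LinearMap.range (seqHomologyMap dY dW b hb (j + 1))) +
      koszulChar ([] : List Λ) (LinearMap.range (δ j)) := fun j =>
    hχ.eq_range_add_range (h1 (j + 1)) _ _ (e1 j)
  have hw0 : koszulChar ([] : List Λ) (seqHomology dW 0) =
      koszulChar ([] : List Λ) (LinearMap.range (seqHomologyMap dY dW b hb 0)) := by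
    refine hχ.eq_range_of_surjective (h1 0) _ fun w => ?_
    obtain ⟨w, rfl⟩ := pairHomology.mk_surjective _ _ w
    refine ⟨pairHomology.mk _ _ ⟨Sum.elim w.1 0, LinearMap.mem_ker.2 (funext fun i => ?_)⟩, ?_⟩
    · rcases i with i | i
      · exact isEmptyElim i
      · exact i.elim
    · exact pairHomology.map_mk _ _ _ _ _ _ w rfl
  have hxw : ∀ j, koszulChar ([] : List Λ) (seqHomology dX (j + 1)) = koszulChar ([] : List Λ) (seqHomology dW j) :=
    fun j => hχ.congr (hX (j + 1)) (eX j).some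
  have hx0 : koszulChar ([] : List Λ) (seqHomology dX 0) = 0 := hχ.eq_zero
  have hD0 : koszulChar ([] : List Λ) (LinearMap.range (δ 0)) = 0 := hχ.eq_zero
  have hsum : ∀ N, ∑ j ∈ Finset.range (N + 1), (-1) ^ j * koszulChar ([] : List Λ) (seqHomology dY j) =
      (-1) ^ N * (koszulChar ([] : List Λ) (seqHomology dW N) - koszulChar ([] : List Λ) (LinearMap.range (δ N))) := by
    intro N
    induction N with
    | zero =>
      have := hx 0; have := hy 0
      simp only [zero_add, Finset.range_one, Finset.sum_singleton, pow_zero, one_mul]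
      lia
    | succ N ih =>
      rw [Finset.sum_range_succ, ih, hy, hw, pow_succ]
      have := hx (N + 1)
      rw [hxw] at this
      rw [this]
      ring
  have h3 := hsum (J + 1)
  have := hJ (J + 1) (by omega)
  have := hXsub (J + 1) (by omega)
  rw [hχ.eq_zero (X := LinearMap.range (δ (J + 1))), hχ.eq_zero (X := seqHomology dW (J + 1)),
    sub_zero, mul_zero] at h3
  exact h3

end ConeEuler

section Vanishing

open Module Function Matrix IsLocalRing

variable {S T Λ B : Type u} [CommRing S] [CommRing T] [CommRing Λ] [CommRing B]
  [Algebra Λ B] [Algebra T B]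

lemma Matrix.exists_map_eq {m n : Type} {π : S →+* T} (hπ : Surjective π) (C : Matrix m n T) :
    ∃ D : Matrix m n S, D.map π = C := by
  choose D hD using fun i j => hπ (C i j)
  exact ⟨Matrix.of D, by ext i j; exact hD i j⟩

/-- Homology in positive degrees with coefficients in `Λ` is killed by any `s` such that
multiplication by `s` on `Λ` factors through a free `S`-module. -/
lemma mem_annihilator_matHomology_of_factor {ι : ℕ → Type} [∀ j, Fintype (ι j)]
    {A : ∀ j, Matrix (ι j) (ι (j + 1)) S} {g : S →+* Λ}
    (hex : ∀ j (v : ι (j + 2) → S), A (j + 1) *ᵥ v = 0 → ∃ w, A (j + 2) *ᵥ w = v)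
    {k : Type} [Fintype k] {s : S} (b : k → Λ) (θ : k → Λ →+ S)
    (hθ : ∀ i r x, θ i (g r * x) = r * θ i x) (hs : ∀ x, ∑ i, g (θ i x) * b i = g s * x) (j : ℕ) :
    g s ∈ annihilator Λ (matHomology (fun j => (A j).map g) Λ (j + 1)) := by
  refine mem_annihilator_matHomology fun x hx => ?_
  have h1 : ∀ i, ∃ w, A (j + 2) *ᵥ w = fun l => θ i (x l) := fun i => hex j _ (by
    ext l
    have := congr_arg (θ i) (congr_fun hx l)
    simpa [matAct_apply, hθ, mulVec, dotProduct] using this)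
  choose w hw using h1
  refine ⟨fun l => ∑ i, g (w i l) * b i, ?_⟩
  ext l
  simp only [matAct_apply, Matrix.map_apply, smul_eq_mul, Pi.smul_apply, ← hs, ← congr_fun (hw _) l]
  simp only [mulVec, dotProduct, map_sum, map_mul, Finset.mul_sum, Finset.sum_mul, ← mul_assoc]
  exact Finset.sum_comm

lemma map_comap_le_annihilator_matHomology {ι : ℕ → Type} [∀ j, Fintype (ι j)]
    [∀ j, DecidableEq (ι j)] {A : ∀ j, Matrix (ι j) (ι (j + 1)) S} (g : S →+* Λ)
    (hA : ∀ j, A j * A (j + 1) = 0) [IsEmpty (ι 0)]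
    (hex : ∀ j (v : ι (j + 2) → S), A (j + 1) *ᵥ v = 0 → ∃ w, A (j + 2) *ᵥ w = v) {N : Ideal S}
    (hq : ∀ q ∈ N, ∀ v : ι 1 → S, ∃ w, A 1 *ᵥ w = q • v) (E : Type u) [AddCommGroup E]
    [Module Λ E] (j : ℕ) :
    N.map g ≤ annihilator Λ (matHomology (fun j => (A j).map g) E j) := by
  refine Ideal.map_le_iff_le_comap.2 fun q hqN => ?_
  obtain ⟨h, k, hk⟩ := exists_matrix_homotopy hA hex (hq q hqN) j
  refine Ideal.mem_comap.2 <| mem_annihilator_matHomology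
    (exists_matAct_eq_smul (A := fun j => (A j).map g)
    ⟨h.map g, k.map g, ?_⟩)
  rw [← Matrix.map_mul, ← Matrix.map_mul, ← Matrix.map_add _ (map_add g), hk]
  ext a c
  simp [Matrix.one_apply, apply_ite g]

variable [IsNoetherianRing Λ] [IsLocalRing Λ]

theorem not_le_ringKrullDim_quotient_of_sum_length_eq_zero {N : Ideal S}
    {g : S →+* Λ} (hB : Surjective (algebraMap Λ B)) {zs : List Λ}
    (hzs : RingHom.ker (algebraMap Λ B) = Ideal.ofList zs) (hzm : ∀ z ∈ zs, z ∈ maximalIdeal Λ)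
    (hreg : RingTheory.Sequence.IsWeaklyRegular Λ zs)
    {ι : ℕ → Type} [∀ j, Fintype (ι j)] [∀ j, DecidableEq (ι j)] [IsEmpty (ι 0)]
    {A : ∀ j, Matrix (ι j) (ι (j + 1)) S} (hA : ∀ j, A j * A (j + 1) = 0)
    (hex : ∀ j (v : ι (j + 2) → S), A (j + 1) *ᵥ v = 0 → ∃ w, A (j + 2) *ᵥ w = v)
    (hq : ∀ q ∈ N, ∀ v : ι 1 → S, ∃ w, A 1 *ᵥ w = q • v) (i₀ : ι 1) (hN : ∀ l, A 1 i₀ l ∈ N)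
    (hprim : maximalIdeal Λ ≤ (N.map g ⊔ Ideal.ofList zs).radical) {J : ℕ}
    (hJ : ∀ j ≥ J, Subsingleton (matHomology (fun j => (A j).map g) B j))
    (hsum : ∑ j ∈ Finset.range (J + 1), (-1) ^ j *
      ((length Λ (matHomology (fun j => (A j).map g) B j)).toNat : ℤ) = 0)
    {k : Type} [Fintype k] {s : S} (b : k → Λ) (θ : k → Λ →+ S)
    (hθ : ∀ i r x, θ i (g r * x) = r * θ i x) (hs : ∀ x, ∑ i, g (θ i x) * b i = g s * x)
    (hdim : ∀ Q : Ideal Λ, Q.IsPrime → N.map g ≤ Q → g s ∈ Q →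
      ¬ (zs.length : WithBot ℕ∞) ≤ ringKrullDim (Λ ⧸ Q)) (Q : Ideal Λ) (hQ : Q.IsPrime)
    (hNQ : N.map g ≤ Q) : ¬ (zs.length : WithBot ℕ∞) ≤ ringKrullDim (Λ ⧸ Q) := by
  have hIA := fun (E : Type u) [AddCommGroup E] [Module Λ E] (j : ℕ) =>
    map_comap_le_annihilator_matHomology g hA hex hq E j
  have hmulΛ : ∀ j, (A j).map g * (A (j + 1)).map g = 0 := fun j => by
    rw [← Matrix.map_mul, hA]; ext a c; simp
  have hprim' : maximalIdeal Λ ≤ (N.map g ⊔ ⊥ ⊔ Ideal.ofList zs).radical := by rwa [sup_bot_eq]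
  have e : (Λ ⧸ (Ideal.ofList zs • ⊤ : Submodule Λ Λ)) ≃ₗ[Λ] B :=
    (Submodule.quotEquivOfEq _ _ (by
      ext x; simp [← hzs, RingHom.mem_ker, LinearMap.mem_ker])).trans
        ((Algebra.linearMap Λ B).quotKerEquivOfSurjective hB)
  obtain ⟨-, h4⟩ := sum_koszulChar_matHomology
    (A := fun j => (A j).map g) hmulΛ J hIA zs ⊥ hprim' hzm Λ B bot_le hreg e hJ
  rw [hsum] at h4
  have h5 : ∀ j, koszulChar zs (matHomology (fun j => (A j).map g) Λ (j + 1)) = 0 := by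
    intro j
    obtain ⟨h6, h7⟩ := koszulChar_nonneg_and_pos_iff zs (N.map g) hprim hzm
      (matHomology (fun j => (A j).map g) Λ (j + 1)) (hIA _ _)
    refine le_antisymm (not_lt.1 fun h => ?_) h6
    obtain ⟨p, hp, hp'⟩ := h7.1 h
    rw [Module.mem_support_iff_of_finite] at hp
    exact hdim _ p.2 ((hIA _ _).trans hp)
      (hp (mem_annihilator_matHomology_of_factor hex b θ hθ hs j)) hp'
  rw [Finset.sum_range_succ', Finset.sum_eq_zero (fun j _ => by rw [h5, mul_zero]), zero_add,
    pow_zero, one_mul] at h4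
  intro hQd
  have h6 := (koszulChar_nonneg_and_pos_iff zs (N.map g) hprim hzm
    (matHomology (fun j => (A j).map g) Λ 0) (hIA _ _)).2
  rw [← h4] at h6
  refine lt_irrefl _ (h6.2 ⟨⟨Q, hQ⟩, ?_, hQd⟩)
  rw [Module.mem_support_iff_of_finite]
  intro r hr
  have h8 := mem_annihilator.1 hr (pairHomology.mk _ _ ⟨fun _ => 1,
    LinearMap.mem_ker.2 (Subsingleton.elim _ _)⟩)
  rw [← map_smul, pairHomology.mk_eq_zero] at h8
  obtain ⟨w, hw⟩ := h8
  have h9 : ∑ l, g (A 1 i₀ l) * w l = r := by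
    simpa [matAct_apply] using congr_fun hw i₀
  rw [← h9]
  exact hNQ (Ideal.sum_mem _ fun l _ => Ideal.mul_mem_right _ _ (Ideal.mem_map_of_mem _ (hN l)))

theorem not_le_ringKrullDim_quotient_of_cone {π : S →+* T} (hπ : Surjective π) {f : S}
    (hker : ∀ x, π x = 0 → ∃ y, x = f * y) (hπf : π f = 0) (hf : ∀ x, f * x = 0 → x = 0)
    {g : S →+* Λ} (hcomm : ∀ s, algebraMap Λ B (g s) = algebraMap T B (π s))
    (hB : Surjective (algebraMap Λ B)) {zs : List Λ}
    (hzs : RingHom.ker (algebraMap Λ B) = Ideal.ofList zs) (hzm : ∀ z ∈ zs, z ∈ maximalIdeal Λ)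
    (hreg : RingTheory.Sequence.IsWeaklyRegular Λ zs)
    {ι : ℕ → Type} [∀ j, Fintype (ι j)] [∀ j, DecidableEq (ι j)] [IsEmpty (ι 0)] [Unique (ι 1)]
    {C : ∀ j, Matrix (ι j) (ι (j + 1)) T} (hC : ∀ j, C j * C (j + 1) = 0)
    (hex : ∀ j (v : ι (j + 2) → T), C (j + 1) *ᵥ v = 0 → ∃ w, C (j + 2) *ᵥ w = v)
    {N : Ideal T} (hN : ∀ x, x ∈ N ↔ ∃ w, (C 1 *ᵥ w) default = x)
    (hprim : maximalIdeal Λ ≤ ((N.comap π).map g ⊔ Ideal.ofList zs).radical) {J : ℕ}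
    (hJ : ∀ j ≥ J, Subsingleton (matHomology C B j))
    {k : Type} [Fintype k] {s : S} (b : k → Λ) (θ : k → Λ →+ S)
    (hθ : ∀ i r x, θ i (g r * x) = r * θ i x) (hs : ∀ x, ∑ i, g (θ i x) * b i = g s * x)
    (hdim : ∀ Q : Ideal Λ, Q.IsPrime → (N.comap π).map g ≤ Q → g s ∈ Q →
      ¬ (zs.length : WithBot ℕ∞) ≤ ringKrullDim (Λ ⧸ Q)) (Q : Ideal Λ) (hQ : Q.IsPrime)
    (hNQ : (N.comap π).map g ≤ Q) : ¬ (zs.length : WithBot ℕ∞) ≤ ringKrullDim (Λ ⧸ Q) := by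
  choose φ hφ using fun j => Matrix.exists_map_eq hπ (C j)
  have h1 : ∀ j, ∃ ψ, φ j * φ (j + 1) = f • ψ := fun j => by
    have h : ∀ i l, ∃ y, (φ j * φ (j + 1)) i l = f * y := fun i l => hker _ (by
      have : (φ j * φ (j + 1)).map π = 0 := by rw [Matrix.map_mul, hφ, hφ, hC]
      exact congr_fun (congr_fun this i) l)
    choose y hy using h
    exact ⟨Matrix.of y, by ext i l; exact hy i l⟩
  choose ψ hψ using h1
  have hex' : ∀ j (v : ι (j + 2) → T), (φ (j + 1)).map π *ᵥ v = 0 →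
      ∃ w, (φ (j + 2)).map π *ᵥ w = v := by
    intro j; rw [hφ, hφ]; exact hex j
  have hq : ∀ q ∈ N, ∀ v : ι 1 → T, ∃ w, C 1 *ᵥ w = q • v := by
    intro q hq v
    obtain ⟨w, hw⟩ := (hN _).1 (N.mul_mem_right (v default) hq)
    exact ⟨w, funext fun i => by rw [Unique.eq_default i, hw]; rfl⟩
  have hqA : ∀ q ∈ N.comap π, ∀ v : ι 1 ⊕ shiftIdx ι 1 → S,
      ∃ w, coneMat f φ ψ 1 *ᵥ w = q • v := fun q hqN =>
    coneMat_one_smul hπ hker (by rw [hφ]; exact hq _ hqN)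
  have hBann : Ideal.ofList zs ≤ annihilator Λ B := by
    rw [← hzs]
    intro z hz
    exact mem_annihilator.2 fun x => by rw [Algebra.smul_def, RingHom.mem_ker.1 hz, zero_mul]
  have hact : ∀ j v, matAct ((φ j).map g) B v = matAct (C j) B v := fun j v =>
    matAct_congr _ _ (fun i l e => by
      rw [← hφ j, Matrix.map_apply, Matrix.map_apply, Algebra.smul_def, Algebra.smul_def, hcomm]) v
  have hIB : ∀ j, (N.comap π).map g ⊔ Ideal.ofList zs ≤
      annihilator Λ (matHomology (fun j => (φ j).map g) B j) := fun j => by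
    refine sup_le (Ideal.map_le_iff_le_comap.2 fun q hqN => ?_)
      (hBann.trans (annihilator_le_matHomology j))
    refine Ideal.mem_comap.2 <| mem_annihilator_matHomology fun x hx => ?_
    obtain ⟨y, hy⟩ := exists_matAct_eq_smul (A := C) (E := B)
      (exists_matrix_homotopy hC hex (hq _ hqN) j) x (by rwa [← hact])
    refine ⟨y, ?_⟩
    rw [hact, hy]
    ext i
    simp [Algebra.smul_def, hcomm]
  have hJ' : ∀ j ≥ J, Subsingleton (matHomology (fun j => (φ j).map g) B j) := fun j hj => by
    refine pairHomology.subsingleton fun y hy => ?_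
    obtain ⟨x, hx⟩ := pairHomology.exists_of_subsingleton (hJ j hj) y (by rwa [← hact])
    exact ⟨x, by rw [hact, hx]⟩
  have : Module.Finite Λ B := Module.Finite.of_surjective (Algebra.linearMap Λ B) hB
  have hfB : ∀ x : B, g f • x = 0 := fun x => by
    rw [Algebra.smul_def, hcomm, hπf, map_zero, zero_mul]
  obtain ⟨h2, h3⟩ := sum_length_coneMat (g := g) (P := B) hf hψ hfB hprim hIB
    (fun j => sup_le (map_comap_le_annihilator_matHomology g (coneMat_mul hf hψ)
      (coneMat_exact hπ hker hπf hf hψ hex') hqA B j)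
      (hBann.trans (annihilator_le_matHomology j))) hJ'
  refine not_le_ringKrullDim_quotient_of_sum_length_eq_zero hB hzs hzm hreg (coneMat_mul hf hψ)
    (coneMat_exact hπ hker hπf hf hψ hex') hqA (Sum.inl default) ?_ hprim h2 h3 b θ hθ hs hdim Q hQ
    hNQ
  rintro (l | l)
  · refine Ideal.mem_comap.2 ((hN _).2 ⟨Pi.single l 1, ?_⟩)
    rw [mulVec_single_one, ← hφ 1]
    rfl
  · have : coneMat f φ ψ 1 (Sum.inl default) (Sum.inr l) =
        f * (1 : Matrix (ι 1) (ι 1) S) default l := rfl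
    rw [this, Ideal.mem_comap, map_mul, hπf, zero_mul]
    exact N.zero_mem

end Vanishing

section AdicEvaluation

open PowerSeries

variable {A D T E : Type*} [CommRing A] [CommRing D] [CommRing T] [CommRing E]

/-- Evaluation of power series at a nilpotent element. -/
noncomputable def PowerSeries.evalNilpotent (φ : A →+* D) (v : D) (n : ℕ) (hv : v ^ n = 0) :
    A⟦X⟧ →+* D where
  toFun f := (trunc n f).eval₂ φ v
  map_zero' := by simp
  map_add' f g := by simp [Polynomial.eval₂_add]
  map_one' := by
    rcases n with _ | n
    · have : (1 : D) = 0 := by simpa using hv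
      simp [this]
    · simp
  map_mul' f g := by
    rw [← Polynomial.eval₂_mul, ← sub_eq_zero, ← Polynomial.eval₂_sub]
    have : Polynomial.X ^ n ∣ trunc n (f * g) - trunc n f * trunc n g := by
      rw [Polynomial.X_pow_dvd_iff]
      intro d hd
      rw [Polynomial.coeff_sub, coeff_trunc, if_pos hd,
        coeff_mul_eq_coeff_trunc_mul_trunc _ _ hd, ← Polynomial.coe_mul, Polynomial.coeff_coe,
        sub_self]
    obtain ⟨q, hq⟩ := this
    rw [hq, Polynomial.eval₂_mul, Polynomial.eval₂_X_pow, hv, zero_mul]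

lemma PowerSeries.evalNilpotent_apply (φ : A →+* D) (v : D) (n : ℕ) (hv : v ^ n = 0) (f : A⟦X⟧) :
    evalNilpotent φ v n hv f = ∑ i ∈ Finset.range n, φ (coeff i f) * v ^ i :=
  eval₂_trunc_eq_sum_range _ _ _ _

variable (I : Ideal T)

lemma PowerSeries.quotient_mk_pow_eq_zero {v : T} (hv : v ∈ I) (n : ℕ) :
    Ideal.Quotient.mk (I ^ n) v ^ n = 0 := by
  rw [← map_pow, Ideal.Quotient.eq_zero_iff_mem]; exact Ideal.pow_mem_pow hv n

lemma PowerSeries.factorPow_comp_evalNilpotent (φ : A →+* T) {v : T} (hv : v ∈ I) {m n : ℕ}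
    (h : m ≤ n) :
    (Ideal.Quotient.factorPow I h).comp (evalNilpotent ((Ideal.Quotient.mk (I ^ n)).comp φ)
      (Ideal.Quotient.mk (I ^ n) v) n (quotient_mk_pow_eq_zero I hv n)) =
    evalNilpotent ((Ideal.Quotient.mk (I ^ m)).comp φ)
      (Ideal.Quotient.mk (I ^ m) v) m (quotient_mk_pow_eq_zero I hv m) := by
  ext f
  simp only [RingHom.comp_apply, evalNilpotent_apply, map_sum, map_mul, map_pow,
    Ideal.Quotient.factorPow, Ideal.Quotient.factor_mk]
  symm
  refine Finset.sum_subset (Finset.range_mono h) fun i _ hi => ?_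
  rw [Finset.mem_range, not_lt] at hi
  rw [← map_pow, Ideal.Quotient.eq_zero_iff_mem.2
    (Ideal.pow_le_pow_right hi (Ideal.pow_mem_pow hv i)), mul_zero]

variable [IsAdicComplete I T]

/-- Evaluation of power series at an element of an ideal of definition of a complete ring. -/
noncomputable def PowerSeries.adicEval (φ : A →+* T) (v : T) (hv : v ∈ I) : A⟦X⟧ →+* T :=
  IsAdicComplete.liftRingHom I _ (factorPow_comp_evalNilpotent I φ hv)

variable {I}

lemma PowerSeries.adicEval_sub_sum_mem (φ : A →+* T) {v : T} (hv : v ∈ I) (f : A⟦X⟧) (n : ℕ) :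
    adicEval I φ v hv f - ∑ i ∈ Finset.range n, φ (coeff i f) * v ^ i ∈ I ^ n := by
  have h := IsAdicComplete.mk_liftRingHom I _ (factorPow_comp_evalNilpotent I φ hv) n f
  rw [evalNilpotent_apply] at h
  rw [← Ideal.Quotient.eq_zero_iff_mem, map_sub, adicEval, h]
  simp

lemma eq_of_forall_sub_mem_pow {x y : T} (h : ∀ n, x - y ∈ I ^ n) : x = y :=
  sub_eq_zero.1 <| IsHausdorff.haus' (I := I) _ fun n => by simpa [SModEq.zero] using h n

lemma PowerSeries.adicEval_eq (φ : A →+* T) {v : T} (hv : v ∈ I) (f : A⟦X⟧) {t : T}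
    (h : ∀ n, t - ∑ i ∈ Finset.range n, φ (coeff i f) * v ^ i ∈ I ^ n) :
    adicEval I φ v hv f = t :=
  eq_of_forall_sub_mem_pow fun n => by
    simpa using sub_mem (adicEval_sub_sum_mem φ hv f n) (h n)

@[simp]
lemma PowerSeries.adicEval_C (φ : A →+* T) {v : T} (hv : v ∈ I) (a : A) :
    adicEval I φ v hv (C a) = φ a := by
  refine adicEval_eq _ _ _ fun n => ?_
  rcases n with _ | n
  · simp
  · simp [Finset.sum_range_succ', coeff_C]

@[simp]
lemma PowerSeries.adicEval_X (φ : A →+* T) {v : T} (hv : v ∈ I) :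
    adicEval I φ v hv X = v := by
  refine adicEval_eq _ _ _ fun n => ?_
  rcases n with _ | _ | n
  · simp
  · simpa using hv
  · simp [coeff_X]

lemma PowerSeries.eq_X_mul_mk_add_C (f : A⟦X⟧) :
    f = X * PowerSeries.mk (fun i => coeff (i + 1) f) + C (coeff 0 f) := by
  simpa using eq_X_mul_shift_add_const f

lemma PowerSeries.adicEval_eq_shift (φ : A →+* T) {v : T} (hv : v ∈ I) (f : A⟦X⟧) :
    adicEval I φ v hv f =
      v * adicEval I φ v hv (PowerSeries.mk fun i => coeff (i + 1) f) + φ (coeff 0 f) := by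
  conv_lhs => rw [eq_X_mul_mk_add_C f]
  rw [map_add, map_mul, adicEval_X, adicEval_C]

lemma PowerSeries.adicEval_map {A' : Type*} [CommRing A'] (φ : A →+* T) (χ : A' →+* A) {v : T}
    (hv : v ∈ I) (f : A'⟦X⟧) :
    adicEval I φ v hv (PowerSeries.map χ f) = adicEval I (φ.comp χ) v hv f := by
  refine adicEval_eq _ _ _ fun n => ?_
  simpa using adicEval_sub_sum_mem (φ.comp χ) hv f n

lemma PowerSeries.map_adicEval {J : Ideal E} [IsAdicComplete J E] (q : T →+* E)
    (hq : I ≤ J.comap q) (φ : A →+* T) {v : T} (hv : v ∈ I) (f : A⟦X⟧) :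
    q (adicEval I φ v hv f) = adicEval J (q.comp φ) (q v) (hq hv) f := by
  symm
  refine adicEval_eq _ _ _ fun n => ?_
  have := Ideal.pow_right_mono (Ideal.map_le_iff_le_comap.2 hq) n
    (Ideal.map_pow q I n ▸ Ideal.mem_map_of_mem q (adicEval_sub_sum_mem φ hv f n))
  simpa using this

/-- The kernel of evaluation at `v` is generated by `X - v`. -/
lemma PowerSeries.ker_adicEval_id {v : T} (hv : v ∈ I) :
    RingHom.ker (adicEval I (RingHom.id T) v hv) = Ideal.span {X - C v} := by
  apply le_antisymm
  · intro f hf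
    rw [RingHom.mem_ker] at hf
    rw [Ideal.mem_span_singleton]
    let e : ℕ → T := fun n => adicEval I (RingHom.id T) v hv (PowerSeries.mk fun i => coeff (i + n) f)
    have he : ∀ n, e n = v * e (n + 1) + coeff n f := fun n => by
      simp only [e]
      rw [adicEval_eq_shift]
      simp [add_assoc, add_comm 1]
    have h0 : e 0 = 0 := by
      simp only [e, add_zero]
      rw [← hf]; congr 1; ext; simp
    refine ⟨PowerSeries.mk fun n => e (n + 1), ?_⟩
    ext n
    rcases n with _ | n
    · have := he 0
      rw [h0] at this
      simp only [sub_mul, map_sub, coeff_zero_X_mul, coeff_C_mul, coeff_mk]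
      linear_combination -this
    · simp only [sub_mul, map_sub, coeff_succ_X_mul, coeff_C_mul, coeff_mk]
      linear_combination -he (n + 1)
  · rw [Ideal.span_singleton_le_iff_mem, RingHom.mem_ker]
    simp

/-- `X - v` is a nonzerodivisor on power series over a Hausdorff ring. -/
lemma PowerSeries.X_sub_C_mul_eq_zero {v : T} (hv : v ∈ I) {f : T⟦X⟧} (h : (X - C v) * f = 0) :
    f = 0 := by
  have h1 : ∀ n, coeff n f = v * coeff (n + 1) f := fun n => by
    have := congrArg (coeff (n + 1)) h
    simp only [sub_mul, map_sub, coeff_succ_X_mul, coeff_C_mul, map_zero] at this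
    exact sub_eq_zero.1 this
  have h2 : ∀ k n, coeff n f ∈ I ^ k := by
    intro k
    induction k with
    | zero => simp
    | succ k ih =>
      intro n
      rw [h1, pow_succ']
      exact Ideal.mul_mem_mul hv (ih _)
  ext n
  exact eq_of_forall_sub_mem_pow (I := I) fun k => by simpa using h2 k n

/-- Complete Nakayama: generation modulo `v` lifts to generation by power series in `v`. -/
lemma PowerSeries.exists_sum_adicEval {κ : Type*} [Fintype κ] (φ : A →+* T) {v : T} (hv : v ∈ I)
    (b : κ → T) (J : Ideal T) (hJ : J.FG)
    (h : ∀ t, ∃ a : κ → A, t - ∑ i, φ (a i) * b i ∈ J ⊔ Ideal.span {v}) (t : T) :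
    ∃ a : κ → A⟦X⟧, t - ∑ i, adicEval I φ v hv (a i) * b i ∈ J := by
  have h' : ∀ t, ∃ (a : κ → A) (y : T), t - ∑ i, φ (a i) * b i - v * y ∈ J := fun t => by
    obtain ⟨a, ha⟩ := h t
    obtain ⟨j, hj, w, hw, e⟩ := Submodule.mem_sup.1 ha
    obtain ⟨y, rfl⟩ := Ideal.mem_span_singleton.1 hw
    exact ⟨a, y, by rwa [← e, add_sub_cancel_right]⟩
  choose a y hy using h'
  let x : ℕ → T := fun n => y^[n] t
  have hx : ∀ n, x (n + 1) = y (x n) := fun n => Function.iterate_succ_apply' _ _ _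
  obtain ⟨s, hs⟩ := hJ
  have h2 : ∀ n, ∃ c : s → T, x n - ∑ i, φ (a (x n) i) * b i - v * x (n + 1) = ∑ j, c j * j.1 := by
    intro n
    have := hy (x n)
    rw [← hs, Ideal.span, Submodule.mem_span_finset'] at this
    obtain ⟨c, hc⟩ := this
    exact ⟨c, by rw [hx, ← hc]; simp⟩
  choose c hc using h2
  refine ⟨fun i => PowerSeries.mk fun n => a (x n) i, ?_⟩
  have key : adicEval I (RingHom.id T) v hv (PowerSeries.mk x - ∑ i,
      PowerSeries.map φ (PowerSeries.mk fun n => a (x n) i) * C (b i) -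
      C v * PowerSeries.mk fun n => x (n + 1)) =
      adicEval I (RingHom.id T) v hv (∑ j, (PowerSeries.mk fun n => c n j) * C j.1) := by
    congr 1
    ext n
    simp only [map_sub, map_sum, coeff_mk, coeff_mul_C, coeff_map, coeff_C_mul]
    exact hc n
  have h3 := adicEval_eq_shift (RingHom.id T) hv (PowerSeries.mk x)
  simp only [coeff_mk, RingHom.id_apply] at h3
  simp only [map_sub, map_sum, map_mul, adicEval_C, adicEval_map, RingHom.id_apply,
    RingHom.id_comp] at key
  have h4 : t - ∑ i, adicEval I φ v hv (PowerSeries.mk fun n => a (x n) i) * b i =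
      ∑ j, adicEval I (RingHom.id T) v hv (PowerSeries.mk fun n => c n j) * j.1 := by
    have : x 0 = t := rfl
    rw [this] at h3
    linear_combination key - h3
  rw [h4]
  exact sum_mem fun j _ => J.mul_mem_left _ (hs ▸ Ideal.subset_span j.2)

end AdicEvaluation

section PowerSeriesStep

open PowerSeries IsLocalRing Function

variable {A B Λ E : Type*} [CommRing A] [CommRing B] [CommRing Λ] [CommRing E]

lemma PowerSeries.mem_map_C_iff {I : Ideal A} (hI : I.FG) {f : A⟦X⟧} :
    f ∈ I.map (C (R := A)) ↔ ∀ n, coeff n f ∈ I := by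
  constructor
  · intro hf n
    refine Submodule.span_induction (p := fun f _ => coeff n f ∈ I) ?_ ?_ ?_ ?_ hf
    · rintro _ ⟨a, ha, rfl⟩
      rw [coeff_C]; split_ifs <;> simp_all
    · simp
    · intro x y _ _ hx hy
      rw [map_add]; exact add_mem hx hy
    · intro a x hx _
      have : I.map (C (R := A)) ≤ RingHom.ker (PowerSeries.map (Ideal.Quotient.mk I)) := by
        rw [Ideal.map_le_iff_le_comap]
        intro a ha
        simp [RingHom.mem_ker, Ideal.Quotient.eq_zero_iff_mem.2 ha]
      have h1 := this (Ideal.mul_mem_left _ a hx)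
      rw [RingHom.mem_ker] at h1
      have := congrArg (coeff n) h1
      rwa [coeff_map, map_zero, Ideal.Quotient.eq_zero_iff_mem] at this
  · intro hf
    obtain ⟨s, hs⟩ := hI
    have : ∀ n, ∃ c : s → A, coeff n f = ∑ j, c j * j.1 := fun n => by
      have := hf n
      rw [← hs, Ideal.span, Submodule.mem_span_finset'] at this
      obtain ⟨c, hc⟩ := this
      exact ⟨c, by rw [← hc]; simp⟩
    choose c hc using this
    have : f = ∑ j, (PowerSeries.mk fun n => c n j) * C j.1 := by
      ext n; simp [hc]
    rw [this]
    exact sum_mem fun j _ => Ideal.mul_mem_left _ _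
      (Ideal.mem_map_of_mem _ (hs ▸ Ideal.subset_span j.2))

lemma PowerSeries.ker_map {χ : A →+* B} (hχ : (RingHom.ker χ).FG) :
    RingHom.ker (PowerSeries.map χ) = (RingHom.ker χ).map (C (R := A)) := by
  ext f
  rw [mem_map_C_iff hχ, RingHom.mem_ker, PowerSeries.ext_iff]
  simp [RingHom.mem_ker]

lemma isWeaklyRegular_self_iff {zs : List A} :
    RingTheory.Sequence.IsWeaklyRegular A zs ↔ ∀ i (h : i < zs.length) (x : A),
      zs[i] * x ∈ Ideal.ofList (zs.take i) → x ∈ Ideal.ofList (zs.take i) := by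
  rw [RingTheory.Sequence.isWeaklyRegular_iff]
  simp only [isSMulRegular_quotient_iff_mem_of_smul_mem, smul_eq_mul, Ideal.mul_top]

lemma PowerSeries.isWeaklyRegular_map_C {zs : List A}
    (h : RingTheory.Sequence.IsWeaklyRegular A zs) :
    RingTheory.Sequence.IsWeaklyRegular A⟦X⟧ (zs.map (C (R := A))) := by
  rw [isWeaklyRegular_self_iff] at h ⊢
  intro i hi x hx
  have hfg : (Ideal.ofList (zs.take i)).FG :=
    (Submodule.fg_def.2 ⟨_, List.finite_toSet _, rfl⟩)
  rw [← List.map_take, ← Ideal.map_ofList, mem_map_C_iff hfg] at hx ⊢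
  intro n
  refine h i (by simpa using hi) _ ?_
  simpa using hx n

lemma PowerSeries.exists_isWeaklyRegular_ker_adicEval {J : Ideal E} [IsAdicComplete J E]
    {ρ : Λ →+* E} (hρ : Surjective ρ) {zs : List Λ} (hk : RingHom.ker ρ = Ideal.ofList zs)
    (hreg : RingTheory.Sequence.IsWeaklyRegular Λ zs) {b : E} (hb : b ∈ J) :
    ∃ zs' : List Λ⟦X⟧, zs'.length = zs.length + 1 ∧
      RingHom.ker (adicEval J ρ b hb) = Ideal.ofList zs' ∧
      RingTheory.Sequence.IsWeaklyRegular Λ⟦X⟧ zs' := by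
  obtain ⟨b', rfl⟩ := hρ b
  have hfg : (RingHom.ker ρ).FG := hk ▸ Submodule.fg_def.2 ⟨_, List.finite_toSet _, rfl⟩
  have hker : RingHom.ker (PowerSeries.map ρ) = Ideal.ofList (zs.map (C (R := Λ))) := by
    rw [PowerSeries.ker_map hfg, hk, Ideal.map_ofList]
  have hev : ∀ f, adicEval J ρ (ρ b') hb f =
      adicEval J (RingHom.id E) (ρ b') hb (PowerSeries.map ρ f) := fun f => by
    rw [adicEval_map, RingHom.id_comp]
  refine ⟨zs.map (C (R := Λ)) ++ [X - C b'], by simp, ?_, ?_⟩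
  · rw [Ideal.ofList_append, ← hker, Ideal.ofList_singleton]
    apply le_antisymm
    · intro f hf
      rw [RingHom.mem_ker, hev, ← RingHom.mem_ker, ker_adicEval_id,
        Ideal.mem_span_singleton] at hf
      obtain ⟨h, hh⟩ := hf
      obtain ⟨h', rfl⟩ := PowerSeries.map_surjective ρ hρ h
      have : f = (f - (X - C b') * h') + (X - C b') * h' := by ring
      rw [this]
      refine Submodule.add_mem_sup ?_ (Ideal.mem_span_singleton.2 ⟨_, rfl⟩)
      rw [RingHom.mem_ker, map_sub, hh]
      simp
    · refine sup_le (fun f hf => ?_) ?_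
      · rw [RingHom.mem_ker, hev, RingHom.mem_ker.1 hf, map_zero]
      · rw [Ideal.span_singleton_le_iff_mem, RingHom.mem_ker]
        simp
  · rw [RingTheory.Sequence.isWeaklyRegular_append_iff]
    refine ⟨isWeaklyRegular_map_C hreg, ?_⟩
    rw [RingTheory.Sequence.isWeaklyRegular_singleton_iff,
      isSMulRegular_quotient_iff_mem_of_smul_mem]
    intro x hx
    rw [smul_eq_mul, Ideal.mul_top, ← hker, RingHom.mem_ker] at hx ⊢
    refine X_sub_C_mul_eq_zero hb (v := ρ b') ?_
    simpa using hx

/-- The maximal ideal of a power series ring. -/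
lemma PowerSeries.maximalIdeal_eq [IsLocalRing A] :
    maximalIdeal A⟦X⟧ = (maximalIdeal A).map (C (R := A)) ⊔ Ideal.span {X} := by
  have h : ∀ f : A⟦X⟧, f ∈ maximalIdeal A⟦X⟧ ↔ constantCoeff f ∈ maximalIdeal A := fun f => by
    rw [mem_maximalIdeal, mem_maximalIdeal, mem_nonunits_iff, mem_nonunits_iff,
      isUnit_iff_constantCoeff]
  apply le_antisymm
  · intro f hf
    rw [eq_X_mul_mk_add_C f, sup_comm]
    exact Submodule.add_mem_sup (Ideal.mem_span_singleton.2 ⟨_, rfl⟩)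
      (Ideal.mem_map_of_mem _ (by simpa using (h f).1 hf))
  · refine sup_le (Ideal.map_le_iff_le_comap.2 fun a ha => ?_) ?_
    · rw [Ideal.mem_comap, h]; simpa using ha
    · rw [Ideal.span_singleton_le_iff_mem, h]; simp

/-- Coefficientwise extension of an additive map. -/
noncomputable def PowerSeries.mapAddHom (θ : B →+ A) : B⟦X⟧ →+ A⟦X⟧ where
  toFun f := PowerSeries.mk fun n => θ (coeff n f)
  map_zero' := by ext; simp
  map_add' f g := by ext; simp

lemma PowerSeries.mapAddHom_map_mul {g : A →+* B} {θ : B →+ A} (h : ∀ r x, θ (g r * x) = r * θ x)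
    (r : A⟦X⟧) (x : B⟦X⟧) :
    mapAddHom θ (PowerSeries.map g r * x) = r * mapAddHom θ x := by
  ext n
  simp [mapAddHom, coeff_mul, map_sum, h]

lemma PowerSeries.sum_map_mapAddHom {κ : Type*} [Fintype κ] {g : A →+* B} {b : κ → B}
    {θ : κ → B →+ A} {s : A} (h : ∀ x, ∑ i, g (θ i x) * b i = g s * x) (x : B⟦X⟧) :
    ∑ i, PowerSeries.map g (mapAddHom (θ i) x) * C (b i) = PowerSeries.map g (C s) * x := by
  ext n
  simp [mapAddHom, h]

lemma PowerSeries.exists_sum_map {κ : Type*} [Fintype κ] {g : A →+* B} {b : κ → B}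
    (h : ∀ x, ∃ a : κ → A, ∑ i, g (a i) * b i = x) (x : B⟦X⟧) :
    ∃ a : κ → A⟦X⟧, ∑ i, PowerSeries.map g (a i) * C (b i) = x := by
  choose a ha using h
  exact ⟨fun i => PowerSeries.mk fun n => a (coeff n x) i, by ext n; simp [ha]⟩

end PowerSeriesStep

section IteratedPowerSeries

open PowerSeries IsLocalRing Function

/-- Iterated formal power series: `n` variables are adjoined to `A`. -/
def IterPS (A : Type u) : ℕ → Type u
  | 0 => A
  | n + 1 => PowerSeries (IterPS A n)

namespace IterPS

noncomputable instance instCommRing (A : Type u) [CommRing A] : ∀ n, CommRing (IterPS A n)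
  | 0 => inferInstanceAs (CommRing A)
  | n + 1 => letI := instCommRing A n; inferInstanceAs (CommRing (PowerSeries (IterPS A n)))

variable (A : Type u) [CommRing A]

instance instIsDomain [IsDomain A] : ∀ n, IsDomain (IterPS A n)
  | 0 => inferInstanceAs (IsDomain A)
  | n + 1 => letI := instIsDomain n; inferInstanceAs (IsDomain (PowerSeries (IterPS A n)))

instance instIsNoetherianRing [IsNoetherianRing A] : ∀ n, IsNoetherianRing (IterPS A n)
  | 0 => inferInstanceAs (IsNoetherianRing A)
  | n + 1 => letI := instIsNoetherianRing n
             inferInstanceAs (IsNoetherianRing (PowerSeries (IterPS A n)))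

instance instIsLocalRing [IsLocalRing A] : ∀ n, IsLocalRing (IterPS A n)
  | 0 => inferInstanceAs (IsLocalRing A)
  | n + 1 => letI := instIsLocalRing n; inferInstanceAs (IsLocalRing (PowerSeries (IterPS A n)))

/-- Constants. -/
noncomputable def const : ∀ n, A →+* IterPS A n
  | 0 => RingHom.id A
  | n + 1 => (PowerSeries.C (R := IterPS A n)).comp (const n)

/-- The variables; `var A n i` is the `i`-th variable when `i < n`. -/
noncomputable def var : ∀ n, ℕ → IterPS A n
  | 0, _ => 0
  | n + 1, i => if i = n then (PowerSeries.X : PowerSeries (IterPS A n))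
      else PowerSeries.C (R := IterPS A n) (var n i)

variable {A} {B : Type u} [CommRing B] {T E : Type u} [CommRing T] [CommRing E]

/-- Functoriality in the coefficients. -/
noncomputable def map (χ : A →+* B) : ∀ n, IterPS A n →+* IterPS B n
  | 0 => χ
  | n + 1 => PowerSeries.map (map χ n)

/-- Evaluation of the variables at elements of an ideal of definition. -/
noncomputable def eval (I : Ideal T) [IsAdicComplete I T] (φ : A →+* T) (v : ℕ → T)
    (hv : ∀ i, v i ∈ I) : ∀ n, IterPS A n →+* T
  | 0 => φ
  | n + 1 => PowerSeries.adicEval I (eval I φ v hv n) (v n) (hv n)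

section

variable {I : Ideal T} [IsAdicComplete I T] (φ : A →+* T) {v : ℕ → T} (hv : ∀ i, v i ∈ I)

@[simp]
lemma eval_const (n : ℕ) (a : A) : eval I φ v hv n (const A n a) = φ a := by
  induction n with
  | zero => rfl
  | succ n ih => exact (PowerSeries.adicEval_C _ (hv n) _).trans ih

lemma eval_var {n i : ℕ} (hi : i < n) : eval I φ v hv n (var A n i) = v i := by
  induction n with
  | zero => omega
  | succ n ih =>
    rcases eq_or_ne i n with rfl | h
    · have : var A (i + 1) i = (PowerSeries.X : PowerSeries (IterPS A i)) := if_pos rfl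
      rw [this]
      exact PowerSeries.adicEval_X _ (hv i)
    · have : var A (n + 1) i = PowerSeries.C (R := IterPS A n) (var A n i) := if_neg h
      rw [this]
      exact (PowerSeries.adicEval_C _ (hv n) _).trans (ih (by omega))

lemma eval_map {A' : Type u} [CommRing A'] (χ : A' →+* A) (n : ℕ) (f : IterPS A' n) :
    eval I φ v hv n (map χ n f) = eval I (φ.comp χ) v hv n f := by
  suffices h : (eval I φ v hv n).comp (map χ n) = eval I (φ.comp χ) v hv n from
    RingHom.congr_fun h f
  clear f
  induction n with
  | zero => rfl
  | succ n ih =>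
    ext f
    refine (PowerSeries.adicEval_map (eval I φ v hv n) (map χ n) (hv n) f).trans ?_
    exact congrArg (fun ψ => PowerSeries.adicEval I ψ (v n) (hv n) f) ih

lemma map_eval {J : Ideal E} [IsAdicComplete J E] (q : T →+* E) (hq : I ≤ J.comap q) (n : ℕ)
    (f : IterPS A n) :
    q (eval I φ v hv n f) = eval J (q.comp φ) (fun i => q (v i)) (fun i => hq (hv i)) n f := by
  suffices h : q.comp (eval I φ v hv n) =
      eval J (q.comp φ) (fun i => q (v i)) (fun i => hq (hv i)) n from RingHom.congr_fun h f
  clear f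
  induction n with
  | zero => rfl
  | succ n ih =>
    ext f
    refine (PowerSeries.map_adicEval q hq (eval I φ v hv n) (hv n) f).trans ?_
    exact congrArg (fun ψ => PowerSeries.adicEval J ψ (q (v n)) (hq (hv n)) f) ih

lemma exists_sum_eval {κ : Type*} [Fintype κ] (b : κ → T) (n : ℕ)
    (J : Ideal T) (hJ : J.FG)
    (h : ∀ t, ∃ a : κ → A, t - ∑ i, φ (a i) * b i ∈ J ⊔ Ideal.span (v '' Set.Iio n)) (t : T) :
    ∃ a : κ → IterPS A n, t - ∑ i, eval I φ v hv n (a i) * b i ∈ J := by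
  induction n generalizing J t with
  | zero =>
    obtain ⟨a, ha⟩ := h t
    rw [Set.Iio_eq_empty_iff.2 (by simp), Set.image_empty, Ideal.span_empty, sup_bot_eq] at ha
    exact ⟨a, ha⟩
  | succ n ih =>
    refine PowerSeries.exists_sum_adicEval (eval I φ v hv n) (hv n) b J
      hJ (fun t => ih (J ⊔ Ideal.span {v n})
        (Submodule.FG.sup hJ (Submodule.fg_span_singleton _)) (fun t => ?_) t) t
    obtain ⟨a, ha⟩ := h t
    refine ⟨a, ?_⟩
    rwa [sup_assoc, ← Ideal.span_union, Set.singleton_union, ← Set.image_insert_eq,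
      show insert n (Set.Iio n) = Set.Iio (n + 1) by ext; simp]

/-- The kernel of the evaluation over the target is generated by a regular sequence. -/
lemma exists_isWeaklyRegular_ker_eval (n : ℕ) :
    ∃ zs : List (IterPS T n), zs.length = n ∧
      RingHom.ker (eval I (RingHom.id T) v hv n) = Ideal.ofList zs ∧
      RingTheory.Sequence.IsWeaklyRegular (IterPS T n) zs := by
  induction n with
  | zero =>
    refine ⟨[], rfl, ?_, RingTheory.Sequence.IsWeaklyRegular.nil _ _⟩
    rw [Ideal.ofList_nil]
    exact (RingHom.injective_iff_ker_eq_bot _).1 (RingHom.injective_iff_ker_eq_bot _ |>.2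
      (RingHom.ker_coe_equiv (RingEquiv.refl T)))
  | succ n ih =>
    obtain ⟨zs, hl, hk, hr⟩ := ih
    obtain ⟨zs', h1, h2, h3⟩ := PowerSeries.exists_isWeaklyRegular_ker_adicEval
      (fun x => ⟨const T n x, eval_const _ hv n x⟩) hk hr (hv n)
    exact ⟨zs', h1.trans (congrArg (· + 1) hl), h2, h3⟩

end

lemma map_surjective {χ : A →+* B} (hχ : Surjective χ) (n : ℕ) : Surjective (map χ n) := by
  induction n with
  | zero => exact hχ
  | succ n ih => exact PowerSeries.map_surjective _ ih

lemma map_injective {χ : A →+* B} (hχ : Injective χ) (n : ℕ) : Injective (map χ n) := by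
  induction n with
  | zero => exact hχ
  | succ n ih => exact PowerSeries.map_injective _ ih

lemma ker_map [IsNoetherianRing A] (χ : A →+* B) (n : ℕ) :
    RingHom.ker (map χ n) = (RingHom.ker χ).map (const A n) := by
  induction n with
  | zero => exact (Ideal.map_id _).symm
  | succ n ih =>
    refine (PowerSeries.ker_map (χ := map χ n) (IsNoetherian.noetherian _)).trans ?_
    rw [ih, Ideal.map_map]
    rfl

lemma maximalIdeal_eq [IsLocalRing A] (n : ℕ) :
    maximalIdeal (IterPS A n) =
      (maximalIdeal A).map (const A n) ⊔ Ideal.span (var A n '' Set.Iio n) := by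
  induction n with
  | zero =>
    rw [Set.Iio_eq_empty_iff.2 (by simp), Set.image_empty, Ideal.span_empty, sup_bot_eq]
    exact (Ideal.map_id (maximalIdeal A)).symm
  | succ n ih =>
    refine (PowerSeries.maximalIdeal_eq (A := IterPS A n)).trans ?_
    have h : var A (n + 1) '' Set.Iio (n + 1) =
        PowerSeries.C (R := IterPS A n) '' (var A n '' Set.Iio n) ∪
          {(PowerSeries.X : PowerSeries (IterPS A n))} := by
      rw [show Set.Iio (n + 1) = Set.Iio n ∪ {n} by ext; simp, Set.image_union,
        Set.image_singleton, Set.image_image]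
      congr 1
      · refine Set.image_congr fun i hi => ?_
        exact if_neg (Set.mem_Iio.1 hi).ne
      · exact congrArg _ (if_pos rfl)
    rw [h, ih, Ideal.map_sup, Ideal.map_map, Ideal.map_span, sup_assoc, ← Ideal.span_union]
    rfl

lemma exists_dual {κ : Type*} [Fintype κ] {g : A →+* B} {b : κ → B}
    {θ : κ → B →+ A} {s : A} (hθ : ∀ i r x, θ i (g r * x) = r * θ i x)
    (h : ∀ x, ∑ i, g (θ i x) * b i = g s * x) (n : ℕ) :
    ∃ θ' : κ → IterPS B n →+ IterPS A n, (∀ i r x, θ' i (map g n r * x) = r * θ' i x) ∧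
      ∀ x, ∑ i, map g n (θ' i x) * const B n (b i) = map g n (const A n s) * x := by
  induction n with
  | zero => exact ⟨θ, hθ, h⟩
  | succ n ih =>
    obtain ⟨θ', h1, h2⟩ := ih
    exact ⟨fun i => PowerSeries.mapAddHom (θ' i),
      fun i => PowerSeries.mapAddHom_map_mul (h1 i), PowerSeries.sum_map_mapAddHom h2⟩

lemma exists_sum_map {κ : Type*} [Fintype κ] {g : A →+* B} {b : κ → B}
    (h : ∀ x, ∃ a : κ → A, ∑ i, g (a i) * b i = x) (n : ℕ) (x : IterPS B n) :
    ∃ a : κ → IterPS A n, ∑ i, map g n (a i) * const B n (b i) = x := by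
  induction n with
  | zero => exact h x
  | succ n ih => exact PowerSeries.exists_sum_map ih x

end IterPS

end IteratedPowerSeries

section IntegralDimension

variable {R S : Type*} [CommRing R] [CommRing S]

lemma RingHom.IsIntegral.exists_ltSeries {f : R →+* S} (hf : f.IsIntegral)
    (hinj : Function.Injective f) (n : ℕ) (l : LTSeries (PrimeSpectrum R)) (hl : l.length = n) :
    ∃ l' : LTSeries (PrimeSpectrum S), l'.length = n ∧ PrimeSpectrum.comap f l'.last = l.last := by
  let := f.toAlgebra
  have : Algebra.IsIntegral R S := ⟨hf⟩
  induction n generalizing l with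
  | zero =>
    obtain ⟨Q, -, hQ, hQ'⟩ := Ideal.exists_ideal_over_prime_of_isIntegral l.last.asIdeal (⊥ : Ideal S)
      (by
        rw [← RingHom.ker_eq_comap_bot, (RingHom.injective_iff_ker_eq_bot _).1
          (show Function.Injective (algebraMap R S) from hinj)]
        exact bot_le)
    exact ⟨RelSeries.singleton _ ⟨Q, hQ⟩, rfl, PrimeSpectrum.ext hQ'⟩
  | succ n ih =>
    obtain ⟨l', h1, h2⟩ := ih l.eraseLast (by simp [hl])
    have hlt : l.eraseLast.last < l.last := l.eraseLast_last_rel_last (by omega)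
    obtain ⟨Q, hQl, hQ, hQ'⟩ := Ideal.exists_ideal_over_prime_of_isIntegral l.last.asIdeal
      l'.last.asIdeal (by
        have : (PrimeSpectrum.comap f l'.last).asIdeal ≤ l.last.asIdeal := by
          rw [h2]; exact hlt.le
        exact this)
    have hcomap : PrimeSpectrum.comap f ⟨Q, hQ⟩ = l.last := PrimeSpectrum.ext hQ'
    refine ⟨l'.snoc ⟨Q, hQ⟩ (lt_of_le_of_ne hQl ?_), by simp [h1], by simpa using hcomap⟩
    intro he
    subst he
    exact hlt.ne (h2.symm.trans hcomap)

lemma RingHom.IsIntegral.ringKrullDim_eq {f : R →+* S} (hf : f.IsIntegral)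
    (hinj : Function.Injective f) : ringKrullDim S = ringKrullDim R := by
  apply le_antisymm
  · let := f.toAlgebra
    have : Algebra.IsIntegral R S := ⟨hf⟩
    refine Order.krullDim_le_of_strictMono (PrimeSpectrum.comap f) fun P Q h => ?_
    have := Ideal.IsIntegral.comap_lt_comap (R := R) (I := P.asIdeal) (J := Q.asIdeal) h
    exact this
  · refine iSup_le fun l => ?_
    obtain ⟨l', h, -⟩ := hf.exists_ltSeries hinj _ l rfl
    rw [← h]
    exact le_iSup (fun p : LTSeries (PrimeSpectrum S) => (p.length : WithBot ℕ∞)) l'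

lemma RingHom.IsIntegral.ringKrullDim_quotient {f : R →+* S} (hf : f.IsIntegral) (I : Ideal S) :
    ringKrullDim (S ⧸ I) = ringKrullDim (R ⧸ I.comap f) := by
  refine RingHom.IsIntegral.ringKrullDim_eq (f := Ideal.quotientMap I f le_rfl) ?_
    Ideal.quotientMap_injective
  refine RingHom.IsIntegral.tower_top (Ideal.Quotient.mk _) _ ?_
  rw [Ideal.quotientMap_comp_mk]
  exact hf.trans _ _ (RingHom.isIntegral_of_surjective _ Ideal.Quotient.mk_surjective)

lemma ringKrullDim_quotient_comap_of_surjective {f : R →+* S} (hf : Function.Surjective f)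
    (I : Ideal S) : ringKrullDim (R ⧸ I.comap f) = ringKrullDim (S ⧸ I) :=
  ((RingHom.isIntegral_of_surjective f hf).ringKrullDim_quotient I).symm

lemma RingHom.isIntegral_of_exists_sum {κ : Type*} [Fintype κ] {f : R →+* S} {b : κ → S}
    (h : ∀ x, ∃ a : κ → R, ∑ i, f (a i) * b i = x) : f.IsIntegral := by
  let := f.toAlgebra
  have : Module.Finite R S := by
    refine Module.Finite.of_surjective (Fintype.linearCombination R b) fun x => ?_
    obtain ⟨a, ha⟩ := h x
    exact ⟨a, by simp only [Fintype.linearCombination_apply, Algebra.smul_def]; exact ha⟩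
  exact algebraMap_isIntegral_iff.2 inferInstance

/-- Over a domain, a finite module agrees with a free module up to `s`-torsion. -/
lemma exists_dual_of_exists_sum [IsDomain R] {m : ℕ} {f : R →+* S} {b : Fin m → S}
    (h : ∀ x, ∃ a : Fin m → R, ∑ i, f (a i) * b i = x) :
    ∃ (k : ℕ) (c : Fin k → S) (θ : Fin k → S →+ R) (s : R), s ≠ 0 ∧
      (∀ i r x, θ i (f r * x) = r * θ i x) ∧ ∀ x, ∑ i, f (θ i x) * c i = f s * x := by
  classical
  let := f.toAlgebra
  obtain ⟨J, hJ, hJ'⟩ := exists_maximal_linearIndepOn R b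
  have : ∀ i, ∃ a : R, a ≠ 0 ∧ a • b i ∈ Submodule.span R (b '' J) := fun i => by
    by_cases hi : i ∈ J
    · exact ⟨1, one_ne_zero, by
        rw [one_smul]; exact Submodule.subset_span (Set.mem_image_of_mem _ hi)⟩
    · exact hJ' i hi
  choose a ha0 ha using this
  let s := ∏ i, a i
  have hs : ∀ x : S, s • x ∈ Submodule.span R (b '' J) := fun x => by
    obtain ⟨r, rfl⟩ := h x
    rw [Finset.smul_sum]
    refine sum_mem fun i _ => ?_
    obtain ⟨t, ht⟩ := Finset.dvd_prod_of_mem a (Finset.mem_univ i)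
    have : s • (f (r i) * b i) = (t * r i) • (a i • b i) := by
      change (∏ i, a i) • _ = _
      rw [ht]
      simp only [Algebra.smul_def, map_mul, RingHom.algebraMap_toAlgebra]
      ring
    rw [this]
    exact Submodule.smul_mem _ _ (ha i)
  let e : Fin (Fintype.card J) ≃ J := (Fintype.equivFin J).symm
  let c : Fin (Fintype.card J) → S := fun i => b (e i)
  have hc : LinearIndependent R c := (linearIndependent_equiv e).2 hJ
  have hr : Set.range c = b '' J := by
    ext x; constructor
    · rintro ⟨i, rfl⟩; exact ⟨_, (e i).2, rfl⟩
    · rintro ⟨j, hj, rfl⟩; exact ⟨e.symm ⟨j, hj⟩, by simp [c]⟩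
  let μ : S →ₗ[R] Submodule.span R (Set.range c) :=
    (LinearMap.lsmul R S s).codRestrict _ fun x => by rw [hr]; exact hs x
  refine ⟨_, c, fun i => ((Finsupp.lapply i ∘ₗ hc.repr ∘ₗ μ : S →ₗ[R] R) : S →+ R), s,
    Finset.prod_ne_zero_iff.2 fun i _ => ha0 i, fun i r x => ?_, fun x => ?_⟩
  · have := (Finsupp.lapply i ∘ₗ hc.repr ∘ₗ μ : S →ₗ[R] R).map_smul r x
    rwa [Algebra.smul_def] at this
  · have := hc.linearCombination_repr (μ x)
    rw [Finsupp.linearCombination_apply, Finsupp.sum_fintype _ _ (by simp)] at this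
    simp only [Algebra.smul_def] at this
    refine this.trans ?_
    exact Algebra.smul_def s x

end IntegralDimension

section ReductionToDiagonal

set_option linter.unusedSectionVars false

open IsLocalRing Function Matrix

lemma comap_maximalIdeal_of_surjective {T B : Type*} [CommRing T] [CommRing B]
    [IsLocalRing T] [IsLocalRing B] {q : T →+* B} (hq : Surjective q) :
    (maximalIdeal B).comap q = maximalIdeal T :=
  ((local_hom_TFAE q).out 0 4).1 (IsLocalHom.of_surjective _ hq)

lemma algebraMap_mem_maximalIdeal_of_surjective {T B : Type*} [CommRing T] [CommRing B]
    [IsLocalRing T] [IsLocalRing B] [Algebra T B] (hq : Surjective (algebraMap T B)) :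
    ∀ x ∈ maximalIdeal T, algebraMap T B x ∈ maximalIdeal B := fun _ hx =>
  Ideal.mem_comap.1 ((comap_maximalIdeal_of_surjective hq).symm ▸ hx)

variable {A T B : Type u} [CommRing A] [CommRing T] [CommRing B]
  [IsLocalRing T] [IsAdicComplete (maximalIdeal T) T]
  [IsLocalRing B] [IsNoetherianRing B] [IsAdicComplete (maximalIdeal B) B] [Algebra T B]

variable (φ : A →+* T) {v : ℕ → T} (hv : ∀ i, v i ∈ maximalIdeal T)

/-- Evaluation of power series over `B` at the images of `v`. -/
noncomputable abbrev diagEval (hq : Surjective (algebraMap T B)) (c : ℕ) : IterPS B c →+* B :=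
  IterPS.eval (maximalIdeal B) (RingHom.id B) (fun i => algebraMap T B (v i))
    (fun i => algebraMap_mem_maximalIdeal_of_surjective hq _ (hv i)) c

lemma diagEval_surjective (hq : Surjective (algebraMap T B)) (c : ℕ) : Surjective (diagEval hv hq c) :=
  fun x => ⟨IterPS.const B c x, IterPS.eval_const _ _ c x⟩

lemma diagEval_map (hq : Surjective (algebraMap T B)) (c : ℕ) (s : IterPS A c) :
    diagEval hv hq c (IterPS.map ((algebraMap T B).comp φ) c s) =
      algebraMap T B (IterPS.eval (maximalIdeal T) φ v hv c s) := by
  refine (IterPS.eval_map _ _ _ c s).trans ?_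
  rw [RingHom.id_comp]
  exact (IterPS.map_eval φ hv (algebraMap T B)
    (fun x hx => Ideal.mem_comap.2 (algebraMap_mem_maximalIdeal_of_surjective hq x hx)) c s).symm

variable {φ hv}

lemma maximalIdeal_le_radical_map_sup_ker (hq : Surjective (algebraMap T B)) {c : ℕ}
    (hπ : Surjective (IterPS.eval (maximalIdeal T) φ v hv c)) {N : Ideal T}
    (hprim : maximalIdeal T ≤ (RingHom.ker (algebraMap T B) ⊔ N).radical) :
    maximalIdeal (IterPS B c) ≤ ((N.comap (IterPS.eval (maximalIdeal T) φ v hv c)).map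
      (IterPS.map ((algebraMap T B).comp φ) c) ⊔ RingHom.ker (diagEval hv hq c)).radical := by
  intro x hx
  obtain ⟨t, ht⟩ := hq (diagEval hv hq c x)
  have htm : t ∈ maximalIdeal T := by
    rw [← comap_maximalIdeal_of_surjective hq, Ideal.mem_comap, ht, ← Ideal.mem_comap,
      comap_maximalIdeal_of_surjective (diagEval_surjective hv hq c)]
    exact hx
  obtain ⟨k, hk⟩ := hprim htm
  obtain ⟨y, hy, z, hz, hyz⟩ := Submodule.mem_sup.1 hk
  obtain ⟨s, rfl⟩ := hπ z
  refine ⟨k, ?_⟩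
  rw [← add_sub_cancel (IterPS.map ((algebraMap T B).comp φ) c s) (x ^ k)]
  refine Submodule.add_mem_sup (Ideal.mem_map_of_mem _ hz) ?_
  rw [RingHom.mem_ker, map_sub, map_pow, ← ht, diagEval_map, ← map_pow, ← hyz, map_add,
    RingHom.mem_ker.1 hy, zero_add, sub_self]

lemma exists_isPrime_map_le {c : ℕ} (hπ : Surjective (IterPS.eval (maximalIdeal T) φ v hv c))
    {m : ℕ} {b : Fin m → B} (hfin : ∀ x, ∃ a : Fin m → A, ∑ i, algebraMap T B (φ (a i)) * b i = x)
    (hinj : Injective ((algebraMap T B).comp φ)) {N : Ideal T} {k : ℕ}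
    (hk : (k : WithBot ℕ∞) ≤ ringKrullDim (T ⧸ N)) :
    ∃ Q : Ideal (IterPS B c), Q.IsPrime ∧ (N.comap (IterPS.eval (maximalIdeal T) φ v hv c)).map
      (IterPS.map ((algebraMap T B).comp φ) c) ≤ Q ∧
      (k : WithBot ℕ∞) ≤ ringKrullDim (IterPS B c ⧸ Q) := by
  have hintegral : (IterPS.map ((algebraMap T B).comp φ) c).IsIntegral :=
    RingHom.isIntegral_of_exists_sum (IterPS.exists_sum_map hfin c)
  rw [← ringKrullDim_quotient_comap_of_surjective hπ] at hk
  obtain ⟨p, hp, hNp, hkp⟩ := exists_isPrime_le_ringKrullDim_quotient hk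
  let := (IterPS.map ((algebraMap T B).comp φ) c).toAlgebra
  have : Algebra.IsIntegral (IterPS A c) (IterPS B c) := ⟨hintegral⟩
  obtain ⟨Q, -, hQ, hQ'⟩ := Ideal.exists_ideal_over_prime_of_isIntegral p
    (⊥ : Ideal (IterPS B c)) (by
      rw [← RingHom.ker_eq_comap_bot, (RingHom.injective_iff_ker_eq_bot _).1
        (show Injective (algebraMap (IterPS A c) (IterPS B c)) from IterPS.map_injective hinj c)]
      exact bot_le)
  have hQ'' : Q.comap (IterPS.map ((algebraMap T B).comp φ) c) = p := hQ'
  refine ⟨Q, hQ, Ideal.map_le_iff_le_comap.2 (hQ'' ▸ hNp), ?_⟩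
  rwa [hintegral.ringKrullDim_quotient, hQ'']

/-- Reduction to the diagonal, weak form. -/
theorem ringKrullDim_quotient_le_of_surjective_eval (hq : Surjective (algebraMap T B))
    {c : ℕ}
    (hπ : Surjective (IterPS.eval (maximalIdeal T) φ v hv c))
    {m : ℕ} {b : Fin m → B} (hfin : ∀ x, ∃ a : Fin m → A, ∑ i, algebraMap T B (φ (a i)) * b i = x)
    (hinj : Injective ((algebraMap T B).comp φ)) {N : Ideal T}
    (hprim : maximalIdeal T ≤ (RingHom.ker (algebraMap T B) ⊔ N).radical) {k : ℕ}
    (hk : (k : WithBot ℕ∞) ≤ ringKrullDim (T ⧸ N)) : k ≤ c := by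
  obtain ⟨Q, hQ, hNQ, hkQ⟩ := exists_isPrime_map_le (B := B) hπ hfin hinj hk
  obtain ⟨zs, hl, hker, -⟩ := IterPS.exists_isWeaklyRegular_ker_eval (I := maximalIdeal B)
    (fun i => algebraMap_mem_maximalIdeal_of_surjective hq _ (hv i)) c
  have hzm : ∀ z ∈ zs, z ∈ maximalIdeal (IterPS B c) := fun z hz => by
    refine le_maximalIdeal (RingHom.ker_ne_top (diagEval hv hq c)) ?_
    rw [hker]; exact Ideal.subset_span hz
  have h1 := ringKrullDim_quotient_le_sup_ofList zs Q hzm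
  have h2 : ringKrullDim (IterPS B c ⧸ Q ⊔ Ideal.ofList zs) ≤ 0 := by
    refine ringKrullDim_quotient_le_zero
      ((maximalIdeal_le_radical_map_sup_ker hq hπ hprim).trans (Ideal.radical_mono ?_))
    rw [hker]
    exact sup_le_sup_right hNQ _
  have h3 : (k : WithBot ℕ∞) ≤ (c : ℕ) := by
    refine (hkQ.trans h1).trans ?_
    rw [hl]
    calc _ ≤ (0 : WithBot ℕ∞) + c := by gcongr
      _ = c := zero_add _
  exact_mod_cast h3

/-- Reduction to the diagonal over a hypersurface. -/
theorem not_le_ringKrullDim_quotient_of_surjective_eval [IsDomain A]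
    (hq : Surjective (algebraMap T B)) {c : ℕ}
    (hπ : Surjective (IterPS.eval (maximalIdeal T) φ v hv c))
    {m : ℕ} {b : Fin m → B} (hfin : ∀ x, ∃ a : Fin m → A, ∑ i, algebraMap T B (φ (a i)) * b i = x)
    (hinj : Injective ((algebraMap T B).comp φ)) {f : IterPS A c} (hf : f ≠ 0)
    (hker : RingHom.ker (IterPS.eval (maximalIdeal T) φ v hv c) = Ideal.span {f})
    {ι : ℕ → Type} [∀ j, Fintype (ι j)] [∀ j, DecidableEq (ι j)] [IsEmpty (ι 0)] [Unique (ι 1)]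
    {C : ∀ j, Matrix (ι j) (ι (j + 1)) T} (hC : ∀ j, C j * C (j + 1) = 0)
    (hex : ∀ j (w : ι (j + 2) → T), C (j + 1) *ᵥ w = 0 → ∃ w', C (j + 2) *ᵥ w' = w)
    {N : Ideal T} (hN : ∀ x, x ∈ N ↔ ∃ w, (C 1 *ᵥ w) default = x)
    (hprim : maximalIdeal T ≤ (RingHom.ker (algebraMap T B) ⊔ N).radical) {J : ℕ}
    (hJ : ∀ j ≥ J, Subsingleton (matHomology C B j))
    (hdim : ∀ p : Ideal T, p.IsPrime → N ≤ p → (c : WithBot ℕ∞) ≤ ringKrullDim (T ⧸ p) →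
      ∀ a, φ a ∈ p → a = 0) :
    ¬ (c : WithBot ℕ∞) ≤ ringKrullDim (T ⧸ N) := by
  intro hc
  obtain ⟨Q, hQ, hNQ, hcQ⟩ := exists_isPrime_map_le (B := B) hπ hfin hinj hc
  obtain ⟨zs, hl, hkerz, hreg⟩ := IterPS.exists_isWeaklyRegular_ker_eval (I := maximalIdeal B)
    (fun i => algebraMap_mem_maximalIdeal_of_surjective hq _ (hv i)) c
  have hzm : ∀ z ∈ zs, z ∈ maximalIdeal (IterPS B c) := fun z hz => by
    refine le_maximalIdeal (RingHom.ker_ne_top (diagEval hv hq c)) ?_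
    rw [hkerz]; exact Ideal.subset_span hz
  obtain ⟨k, d, θ₀, s, hs0, hθ₀, hs₀⟩ := exists_dual_of_exists_sum (f := (algebraMap T B).comp φ) hfin
  obtain ⟨θ, hθ, hs⟩ := IterPS.exists_dual hθ₀ hs₀ c
  have hintegral : (IterPS.map ((algebraMap T B).comp φ) c).IsIntegral :=
    RingHom.isIntegral_of_exists_sum (IterPS.exists_sum_map hfin c)
  let := (diagEval hv hq c).toAlgebra
  have hprimΛ := maximalIdeal_le_radical_map_sup_ker hq hπ hprim
  rw [hkerz] at hprimΛ
  refine not_le_ringKrullDim_quotient_of_cone (B := B) (zs := zs) hπ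
    (fun x hx => Ideal.mem_span_singleton.1 (hker ▸ hx)) (f := f)
    (RingHom.mem_ker.1 (hker ▸ Ideal.mem_span_singleton_self f))
    (fun x hx => (mul_eq_zero.1 hx).resolve_left hf) (diagEval_map φ hv hq c)
    (diagEval_surjective hv hq c) hkerz hzm hreg hC hex hN hprimΛ hJ
    (fun i => IterPS.const B c (d i)) θ hθ hs (fun P hP hNP hsP hcP => hs0 ?_) Q hQ hNQ (by rw [hl]; exact hcQ)
  rw [hl, hintegral.ringKrullDim_quotient] at hcP
  set p' := P.comap (IterPS.map ((algebraMap T B).comp φ) c) with hp'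
  have hNp' : N.comap (IterPS.eval (maximalIdeal T) φ v hv c) ≤ p' := Ideal.map_le_iff_le_comap.1 hNP
  have hp'' : (p'.map (IterPS.eval (maximalIdeal T) φ v hv c)).comap (IterPS.eval (maximalIdeal T) φ v hv c) =
      p' := by
    rw [Ideal.comap_map_of_surjective' _ hπ, sup_eq_left, RingHom.ker_eq_comap_bot]
    exact (Ideal.comap_mono bot_le).trans hNp'
  have hprime : (p'.map (IterPS.eval (maximalIdeal T) φ v hv c)).IsPrime := by
    refine Ideal.map_isPrime_of_surjective hπ ?_
    rw [RingHom.ker_eq_comap_bot]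
    exact (Ideal.comap_mono bot_le).trans hNp'
  refine hdim _ hprime ?_ ?_ s ?_
  · rw [← Ideal.map_comap_of_surjective _ hπ N]
    exact Ideal.map_mono hNp'
  · rwa [← ringKrullDim_quotient_comap_of_surjective hπ, hp'']
  · rw [← IterPS.eval_const φ hv c s]
    exact Ideal.mem_map_of_mem _ hsP

end ReductionToDiagonal

section Coordinates

lemma ringKrullDim_quotient_radical {R : Type*} [CommRing R] (I : Ideal R) :
    ringKrullDim (R ⧸ I.radical) = ringKrullDim (R ⧸ I) := by
  rw [ringKrullDim_quotient, ringKrullDim_quotient, PrimeSpectrum.zeroLocus_radical]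

open IsLocalRing

set_option linter.unusedSectionVars false

variable {T : Type*} [CommRing T] [IsNoetherianRing T] [IsLocalRing T]

lemma ringKrullDim_quotient_sup_span_singleton_le {J : Ideal T} {w : T}
    (hw : ∀ p ∈ J.minimalPrimes, p ≠ maximalIdeal T → w ∉ p) {k : ℕ}
    (hJ : ringKrullDim (T ⧸ J) ≤ (k + 1 : ℕ)) : ringKrullDim (T ⧸ J ⊔ Ideal.span {w}) ≤ k := by
  by_contra! h
  have h' : ((k + 1 : ℕ) : WithBot ℕ∞) ≤ ringKrullDim (T ⧸ J ⊔ Ideal.span {w}) := by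
    rw [Nat.cast_add_one]
    exact ENat.WithBot.add_one_le_iff.2 h
  obtain ⟨q, hq, hJq, hkq⟩ := exists_isPrime_le_ringKrullDim_quotient h'
  obtain ⟨p, hp, hpq⟩ := Ideal.exists_minimalPrimes_le (le_sup_left.trans hJq)
  have := hp.1.1
  by_cases hpm : p = maximalIdeal T
  · have hm : maximalIdeal T ≤ q.radical := hpm ▸ hpq.trans Ideal.le_radical
    have := hkq.trans (ringKrullDim_quotient_le_zero hm)
    norm_cast at this
  · have h1 := ringKrullDim_quotient_sup_span_singleton_add_one_le (hw p hp hpm)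
    have h2 : ringKrullDim (T ⧸ q) ≤ ringKrullDim (T ⧸ p ⊔ Ideal.span {w}) :=
      ringKrullDim_quotient_anti (sup_le hpq (le_sup_right.trans hJq))
    have h3 : ((k + 1 : ℕ) : WithBot ℕ∞) + 1 ≤ (k + 1 : ℕ) :=
      calc _ ≤ ringKrullDim (T ⧸ p ⊔ Ideal.span {w}) + 1 := by gcongr; exact hkq.trans h2
        _ ≤ _ := h1
        _ ≤ _ := (ringKrullDim_quotient_anti hp.1.2).trans hJ
    norm_cast at h3
    omega

/-- Prime avoidance: an element of the maximal ideal outside `I` that is a parameter for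
`J₁` and `J₂`. -/
lemma exists_parameter (I J₁ J₂ : Ideal T) (hI : ¬ maximalIdeal T ≤ I) :
    ∃ w ∈ maximalIdeal T, w ∉ I ∧ (∀ p ∈ J₁.minimalPrimes, p ≠ maximalIdeal T → w ∉ p) ∧
      ∀ p ∈ J₂.minimalPrimes, p ≠ maximalIdeal T → w ∉ p := by
  classical
  have h1 := J₁.finite_minimalPrimes_of_isNoetherianRing
  have h2 := J₂.finite_minimalPrimes_of_isNoetherianRing
  let s : Finset (Ideal T) := insert I ((h1.toFinset ∪ h2.toFinset).erase (maximalIdeal T))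
  have hs : ∀ i ∈ s, i ≠ I → i ≠ I → Ideal.IsPrime (id i) := by
    intro i hi hiI _
    obtain h | h := Finset.mem_insert.1 hi
    · exact absurd h hiI
    · rcases Finset.mem_union.1 (Finset.mem_of_mem_erase h) with h | h
      · exact (h1.mem_toFinset.1 h).1.1
      · exact (h2.mem_toFinset.1 h).1.1
  have key : ¬ ((maximalIdeal T : Ideal T) : Set T) ⊆ ⋃ i ∈ (↑s : Set (Ideal T)), ((id i : Ideal T) : Set T) := by
    rw [Ideal.subset_union_prime I I hs]
    rintro ⟨i, hi, hmi⟩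
    obtain rfl | h := Finset.mem_insert.1 hi
    · exact hI hmi
    · have hne := Finset.ne_of_mem_erase h
      have hp : i.IsPrime := by
        rcases Finset.mem_union.1 (Finset.mem_of_mem_erase h) with h | h
        · exact (h1.mem_toFinset.1 h).1.1
        · exact (h2.mem_toFinset.1 h).1.1
      exact hne ((maximalIdeal.isMaximal T).eq_of_le hp.ne_top hmi).symm
  obtain ⟨w, hwm, hw⟩ := Set.not_subset.1 key
  simp only [Set.mem_iUnion, not_exists] at hw
  refine ⟨w, hwm, hw I (Finset.mem_insert_self _ _), fun p hp hpm => hw p ?_,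
    fun p hp hpm => hw p ?_⟩
  · exact Finset.mem_insert_of_mem (Finset.mem_erase.2 ⟨hpm, by simp [hp]⟩)
  · exact Finset.mem_insert_of_mem (Finset.mem_erase.2 ⟨hpm, by simp [hp]⟩)

lemma exists_exchange {U : Ideal T} {l : ℕ} {v : Fin (l + 1) → T}
    (hm : maximalIdeal T = U ⊔ Ideal.span (Set.range v)) {w : T} (hwm : w ∈ maximalIdeal T)
    (hw : w ∉ U ⊔ maximalIdeal T ^ 2) :
    ∃ v' : Fin l → T, maximalIdeal T = Ideal.span {w} ⊔ U ⊔ Ideal.span (Set.range v') := by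
  obtain ⟨y, hy, z, hz, rfl⟩ := Submodule.mem_sup.1 (hm ▸ hwm)
  obtain ⟨c, rfl⟩ := Ideal.mem_span_range_iff_exists_fun.1 hz
  have hvm : ∀ i, v i ∈ maximalIdeal T := fun i => by
    rw [hm]; exact Ideal.mem_sup_right (Ideal.subset_span ⟨i, rfl⟩)
  have hU : U ≤ maximalIdeal T := hm ▸ le_sup_left
  obtain ⟨i, hi⟩ : ∃ i, IsUnit (c i) := by
    by_contra! h
    refine hw (Submodule.add_mem_sup hy (Ideal.sum_mem _ fun i _ => ?_))
    rw [pow_two]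
    exact Ideal.mul_mem_mul ((mem_maximalIdeal _).2 (h i)) (hvm i)
  refine ⟨fun j => v (i.succAbove j), le_antisymm ?_ (sup_le (sup_le ?_ hU) ?_)⟩
  · have hvi : v i ∈ Ideal.span {y + ∑ i, c i * v i} ⊔ U ⊔
        Ideal.span (Set.range fun j => v (i.succAbove j)) := by
      rw [← Ideal.unit_mul_mem_iff_mem _ hi]
      have : c i * v i = (y + ∑ i, c i * v i) - y -
          ∑ j, c (i.succAbove j) * v (i.succAbove j) := by
        rw [Fin.sum_univ_succAbove _ i]; ring
      rw [this]
      refine Ideal.sub_mem _ (Ideal.sub_mem _ ?_ ?_) (Ideal.sum_mem _ fun j _ => ?_)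
      · exact Ideal.mem_sup_left (Ideal.mem_sup_left (Ideal.mem_span_singleton_self _))
      · exact Ideal.mem_sup_left (Ideal.mem_sup_right hy)
      · exact Ideal.mul_mem_left _ _ (Ideal.mem_sup_right (Ideal.subset_span ⟨j, rfl⟩))
    conv_lhs => rw [hm]
    refine sup_le (le_sup_right.trans le_sup_left) (Ideal.span_le.2 ?_)
    rintro _ ⟨j, rfl⟩
    rcases Fin.eq_self_or_eq_succAbove i j with rfl | ⟨j, rfl⟩
    · exact hvi
    · exact Ideal.mem_sup_right (Ideal.subset_span ⟨j, rfl⟩)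
  · rwa [Ideal.span_singleton_le_iff_mem]
  · rw [Ideal.span_le]
    rintro _ ⟨j, rfl⟩
    exact hvm _

/-- Part of a generating system of the maximal ideal consisting of parameters for two ideals. -/
lemma exists_coordinates (J₁ J₂ : Ideal T) (k : ℕ) : ∀ (l a b : ℕ) (x : Fin (k + l) → T),
    maximalIdeal T = Ideal.span (Set.range x) → ringKrullDim (T ⧸ J₁) ≤ (a + k : ℕ) →
    ringKrullDim (T ⧸ J₂) ≤ (b + k : ℕ) → ∃ (u : Fin k → T) (v : Fin l → T),
      maximalIdeal T = Ideal.span (Set.range u) ⊔ Ideal.span (Set.range v) ∧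
      ringKrullDim (T ⧸ J₁ ⊔ Ideal.span (Set.range u)) ≤ a ∧
      ringKrullDim (T ⧸ J₂ ⊔ Ideal.span (Set.range u)) ≤ b := by
  induction k with
  | zero =>
    intro l a b x hx h1 h2
    refine ⟨Fin.elim0, fun i => x (i.cast (by omega)), ?_, ?_, ?_⟩
    · have : (fun i : Fin l => x (i.cast (by omega))) = x ∘ finCongr (by omega) := rfl
      rw [this, Set.range_comp, Equiv.range_eq_univ, Set.image_univ]
      simpa using hx
    · refine (ringKrullDim_quotient_anti le_sup_left).trans (by simpa using h1)
    · refine (ringKrullDim_quotient_anti le_sup_left).trans (by simpa using h2)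
  | succ k ih =>
    intro l a b x hx h1 h2
    obtain ⟨u, v, huv, h1', h2'⟩ := ih (l + 1) (a + 1) (b + 1)
      (fun i => x (i.cast (by omega))) (by
        have : (fun i : Fin (k + (l + 1)) => x (i.cast (by omega))) = x ∘ finCongr (by omega) := rfl
        rw [this, Set.range_comp, Equiv.range_eq_univ, Set.image_univ]
        exact hx) (by rwa [add_assoc, add_comm 1]) (by rwa [add_assoc, add_comm 1])
    by_cases hU : maximalIdeal T ≤ Ideal.span (Set.range u) ⊔ maximalIdeal T ^ 2
    · have hU' : maximalIdeal T ≤ Ideal.span (Set.range u) := by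
        refine Submodule.le_of_le_smul_of_le_jacobson_bot (I := maximalIdeal T)
          (IsNoetherian.noetherian _) (maximalIdeal_le_jacobson _) ?_
        rwa [smul_eq_mul, ← pow_two]
      have hr : ∀ J : Ideal T, maximalIdeal T ≤
          (J ⊔ Ideal.span (Set.range (Fin.cons 0 u : Fin (k + 1) → T))).radical := fun J => by
        refine hU'.trans ((Ideal.span_mono ?_).trans (le_sup_right.trans Ideal.le_radical))
        rw [Fin.range_cons]
        exact Set.subset_insert _ _
      refine ⟨Fin.cons 0 u, fun _ => 0, le_antisymm (hU'.trans ?_) (sup_le ?_ ?_), ?_, ?_⟩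
      · refine (Ideal.span_mono ?_).trans le_sup_left
        rw [Fin.range_cons]
        exact Set.subset_insert _ _
      · rw [Fin.range_cons, Ideal.span_insert, Ideal.span_singleton_zero, bot_sup_eq, huv]
        exact le_sup_left
      · rw [Ideal.span_le]
        rintro _ ⟨j, rfl⟩
        exact zero_mem _
      · exact (ringKrullDim_quotient_le_zero (hr _)).trans (by positivity)
      · exact (ringKrullDim_quotient_le_zero (hr _)).trans (by positivity)
    · obtain ⟨w, hwm, hwU, hw1, hw2⟩ := exists_parameter _ (J₁ ⊔ Ideal.span (Set.range u))
        (J₂ ⊔ Ideal.span (Set.range u)) hU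
      obtain ⟨v', hv'⟩ := exists_exchange huv hwm hwU
      have hspan : Ideal.span (Set.range (Fin.cons w u : Fin (k + 1) → T)) =
          Ideal.span {w} ⊔ Ideal.span (Set.range u) := by
        rw [Fin.range_cons, Ideal.span_insert]
      refine ⟨Fin.cons w u, v', by rw [hspan, hv'], ?_, ?_⟩
      · rw [hspan, sup_comm (Ideal.span {w}), ← sup_assoc]
        exact ringKrullDim_quotient_sup_span_singleton_le hw1 h1'
      · rw [hspan, sup_comm (Ideal.span {w}), ← sup_assoc]
        exact ringKrullDim_quotient_sup_span_singleton_le hw2 h2'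

lemma ringKrullDim_quotient_le_sup_span_range {I : Ideal T} {n : ℕ} {z : Fin n → T}
    (hz : ∀ i, z i ∈ maximalIdeal T) :
    ringKrullDim (T ⧸ I) ≤ ringKrullDim (T ⧸ I ⊔ Ideal.span (Set.range z)) + n := by
  have h := ringKrullDim_quotient_le_sup_ofList (List.ofFn z) I (by
    intro x hx
    obtain ⟨i, rfl⟩ := (List.mem_ofFn' z x).1 hx
    exact hz i)
  have h2 : Ideal.ofList (List.ofFn z) = Ideal.span (Set.range z) := by
    rw [Ideal.ofList]; congr 1; ext x; simp [List.mem_ofFn']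
  rwa [h2, List.length_ofFn] at h

lemma ringKrullDim_le_of_maximalIdeal_eq_span {n : ℕ} {z : Fin n → T}
    (hz : maximalIdeal T ≤ Ideal.span (Set.range z)) (hz' : ∀ i, z i ∈ maximalIdeal T) :
    ringKrullDim T ≤ n := by
  have h := ringKrullDim_quotient_le_sup_span_range (I := ⊥) hz'
  have h0 : ringKrullDim (T ⧸ (⊥ : Ideal T) ⊔ Ideal.span (Set.range z)) ≤ 0 :=
    ringKrullDim_quotient_le_zero (hz.trans (le_sup_right.trans Ideal.le_radical))
  rw [ringKrullDim_eq_of_ringEquiv (RingEquiv.quotientBot T)] at h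
  calc _ ≤ _ := h
    _ ≤ (0 : WithBot ℕ∞) + n := by gcongr
    _ = n := zero_add _

/-- A dimension criterion for a local homomorphism from a domain to be injective modulo `N`. -/
lemma not_le_ringKrullDim_quotient_of_map_mem {A : Type*} [CommRing A] [IsNoetherianRing A]
    [IsLocalRing A] [IsDomain A] {φ : A →+* T} (hφ : ∀ x ∈ maximalIdeal A, φ x ∈ maximalIdeal T)
    {a : ℕ} {y : Fin a → A} (hy : maximalIdeal A = Ideal.span (Set.range y)) {N : Ideal T}
    {b : ℕ} (hb : ringKrullDim (T ⧸ N ⊔ (maximalIdeal A).map φ) ≤ b) {α : A} (hα : α ≠ 0)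
    (hN : φ α ∈ N) : ¬ ((b + a : ℕ) : WithBot ℕ∞) ≤ ringKrullDim (T ⧸ N) := by
  intro h
  rcases a with _ | a
  · have hu : IsUnit α := by
      by_contra hu
      have : α ∈ maximalIdeal A := (mem_maximalIdeal _).2 hu
      rw [hy, Set.range_eq_empty, Ideal.span_empty] at this
      exact hα this
    have htop := Ideal.eq_top_of_isUnit_mem _ hN (hu.map φ)
    rw [htop, ringKrullDim_eq_bot_of_subsingleton] at h
    exact absurd h (by simp)
  · have hdim : ringKrullDim A ≤ (a + 1 : ℕ) := ringKrullDim_le_of_maximalIdeal_eq_span hy.le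
      (fun i => hy ▸ Ideal.subset_span ⟨i, rfl⟩)
    have hd' : ringKrullDim (A ⧸ Ideal.span {α}) ≤ (0 + a : ℕ) := by
      have h1 := ringKrullDim_quotient_sup_span_singleton_add_one_le (p := (⊥ : Ideal A)) (z := α)
        (by simpa using hα)
      rw [ringKrullDim_eq_of_ringEquiv (RingEquiv.quotientBot A), bot_sup_eq] at h1
      have h2 := h1.trans hdim
      rw [Nat.cast_add_one] at h2
      rw [zero_add]
      exact ENat.WithBot.add_le_add_one_right_iff.1 h2
    obtain ⟨z, y', hz, hz0, -⟩ := exists_coordinates (Ideal.span {α}) (Ideal.span {α}) a 1 0 0 y hy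
      hd' hd'
    have hzm : ∀ i, φ (z i) ∈ maximalIdeal T := fun i =>
      hφ _ (hz ▸ Ideal.mem_sup_left (Ideal.subset_span ⟨i, rfl⟩))
    have h3 := ringKrullDim_quotient_le_sup_span_range (I := N) hzm
    have h4 := maximalIdeal_le_radical_of_ringKrullDim_le_zero hz0
    have h5 : ringKrullDim (T ⧸ N ⊔ Ideal.span (Set.range fun i => φ (z i))) ≤ b := by
      refine le_trans ?_ hb
      rw [← ringKrullDim_quotient_radical (N ⊔ Ideal.span (Set.range fun i => φ (z i)))]
      refine ringKrullDim_quotient_anti (sup_le (le_sup_left.trans Ideal.le_radical) ?_)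
      rw [Ideal.map_le_iff_le_comap]
      refine h4.trans ?_
      rw [Ideal.comap_radical]
      refine Ideal.radical_mono (sup_le ?_ ?_)
      · rw [Ideal.span_singleton_le_iff_mem]
        exact Ideal.mem_comap.2 (Ideal.mem_sup_left hN)
      · rw [Ideal.span_le]
        rintro _ ⟨i, rfl⟩
        exact Ideal.mem_comap.2 (Ideal.mem_sup_right (Ideal.subset_span ⟨i, rfl⟩))
    have h6 : ((b + (a + 1) : ℕ) : WithBot ℕ∞) ≤ (b + a : ℕ) :=
      (h.trans h3).trans (by push_cast; gcongr)
    norm_cast at h6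
    omega

end Coordinates

section Regular

set_option linter.unusedSectionVars false

open IsLocalRing Matrix

variable {T : Type u} [CommRing T] [IsLocalRing T]

lemma maximalIdeal_quotient_eq_span {I : Ideal T} [IsLocalRing (T ⧸ I)]
    {n : ℕ} {x : Fin n → T}
    (hx : maximalIdeal T = I ⊔ Ideal.span (Set.range x)) :
    maximalIdeal (T ⧸ I) = Ideal.span (Set.range fun i => Ideal.Quotient.mk I (x i)) := by
  rw [← Ideal.map_comap_of_surjective _ (Ideal.Quotient.mk_surjective (I := I)) (maximalIdeal _),
    comap_maximalIdeal_of_surjective Ideal.Quotient.mk_surjective, hx, Ideal.map_sup,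
    Ideal.map_quotient_self, bot_sup_eq, Ideal.map_span, ← Set.range_comp]
  rfl

lemma isLocalRing_quotient {I : Ideal T} (hI : I ≠ ⊤) : IsLocalRing (T ⧸ I) :=
  have := Ideal.Quotient.nontrivial_iff.2 hI
  IsLocalRing.of_surjective' _ Ideal.Quotient.mk_surjective

variable [IsNoetherianRing T]

lemma not_maximalIdeal_le_sq {d : ℕ} (hd : ((d + 1 : ℕ) : WithBot ℕ∞) ≤ ringKrullDim T) :
    ¬ maximalIdeal T ≤ ⊥ ⊔ maximalIdeal T ^ 2 := by
  intro h
  have hb : maximalIdeal T ≤ ⊥ := by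
    refine Submodule.le_of_le_smul_of_le_jacobson_bot (I := maximalIdeal T)
      (IsNoetherian.noetherian _) (maximalIdeal_le_jacobson _) ?_
    rwa [smul_eq_mul, ← pow_two]
  have h0 := ringKrullDim_quotient_le_zero (hb.trans Ideal.le_radical)
  rw [ringKrullDim_eq_of_ringEquiv (RingEquiv.quotientBot T)] at h0
  have := hd.trans h0
  norm_cast at this

/-- Cutting down a regular local ring by a minimal generator of the maximal ideal. -/
lemma exists_regular_quotient {d : ℕ} {x : Fin (d + 1) → T}
    (hx : maximalIdeal T = Ideal.span (Set.range x))
    (hd : ((d + 1 : ℕ) : WithBot ℕ∞) ≤ ringKrullDim T) {w : T} (hw : w ∈ maximalIdeal T)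
    (hw2 : w ∉ ⊥ ⊔ maximalIdeal T ^ 2) :
    ∃ _ : IsLocalRing (T ⧸ Ideal.span {w}), ∃ y : Fin d → T ⧸ Ideal.span {w},
      maximalIdeal (T ⧸ Ideal.span {w}) = Ideal.span (Set.range y) ∧
      (d : WithBot ℕ∞) ≤ ringKrullDim (T ⧸ Ideal.span {w}) := by
  have hne : Ideal.span {w} ≠ ⊤ := by
    rw [Ne, Ideal.span_singleton_eq_top]
    exact (mem_maximalIdeal _).1 hw
  have := isLocalRing_quotient hne
  obtain ⟨y, hy⟩ := exists_exchange (U := ⊥) (by rwa [bot_sup_eq]) hw hw2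
  rw [sup_bot_eq] at hy
  refine ⟨this, _, maximalIdeal_quotient_eq_span hy, ?_⟩
  have h := ringKrullDim_quotient_le_sup_span_singleton ⊥ hw
  rw [bot_sup_eq, ringKrullDim_eq_of_ringEquiv (RingEquiv.quotientBot T)] at h
  have h' := hd.trans h
  rw [Nat.cast_add_one] at h'
  exact ENat.WithBot.add_le_add_one_right_iff.1 h'

theorem isDomain_of_regular (d : ℕ) : ∀ (T : Type u) [CommRing T] [IsLocalRing T]
    [IsNoetherianRing T] (x : Fin d → T), maximalIdeal T = Ideal.span (Set.range x) →
    (d : WithBot ℕ∞) ≤ ringKrullDim T → IsDomain T := by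
  induction d with
  | zero =>
    intro T _ _ _ x hx _
    have : maximalIdeal T = ⊥ := by rw [hx, Set.range_eq_empty, Ideal.span_empty]
    exact (IsLocalRing.isField_iff_maximalIdeal_eq.2 this).isDomain
  | succ d ih =>
    intro T _ _ _ x hx hd
    obtain ⟨w, hwm, hw2, hw, -⟩ := exists_parameter _ ⊥ ⊥ (not_maximalIdeal_le_sq hd)
    obtain ⟨_, y, hy, hyd⟩ := exists_regular_quotient hx hd hwm hw2
    have := ih _ y hy hyd
    have hprime : (Ideal.span {w}).IsPrime := (Ideal.Quotient.isDomain_iff_prime _).1 this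
    obtain ⟨p, hp, hpw⟩ := Ideal.exists_minimalPrimes_le (bot_le : ⊥ ≤ Ideal.span {w})
    have hpp := hp.1.1
    have hpm : p ≠ maximalIdeal T := by
      rintro rfl
      have h1 : ringKrullDim T ≤ (0 : ℕ) := by
        have hle : ringKrullDim (T ⧸ (⊥ : Ideal T)) ≤ 0 := by
          refine ringKrullDim_quotient_le_zero ?_
          rw [Ideal.radical_eq_sInf]
          refine le_sInf fun q hq => ?_
          exact hp.2 ⟨hq.2, bot_le⟩ (le_maximalIdeal hq.2.ne_top)
        rwa [ringKrullDim_eq_of_ringEquiv (RingEquiv.quotientBot T)] at hle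
      have := hd.trans h1
      norm_cast at this
    have hwp := hw p hp hpm
    have hp0 : p ≤ ⊥ := by
      refine Submodule.le_of_le_smul_of_le_jacobson_bot (I := maximalIdeal T)
        (IsNoetherian.noetherian _) (maximalIdeal_le_jacobson _) ?_
      intro z hz
      obtain ⟨t, rfl⟩ := Ideal.mem_span_singleton.1 (hpw hz)
      rw [bot_sup_eq]
      exact Ideal.mul_mem_mul hwm ((hpp.mem_or_mem hz).resolve_left hwp)
    have : (⊥ : Ideal T).IsPrime := by rwa [← le_bot_iff.1 hp0]
    exact IsDomain.of_bot_isPrime T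

/-- Exactness is preserved by reduction modulo a nonzerodivisor. -/
lemma exists_mulVec_map_mk_eq {T : Type u} [CommRing T] {a b c e : Type} [Fintype b] [Fintype c] [Fintype e] {x : T}
    {B : Matrix a b T} {C : Matrix b c T} {D : Matrix c e T}
    (hB : ∀ w : b → T, B *ᵥ (x • w) = 0 → B *ᵥ w = 0) (hBC : B * C = 0)
    (hexB : ∀ w, B *ᵥ w = 0 → ∃ w', C *ᵥ w' = w) (hexC : ∀ w, C *ᵥ w = 0 → ∃ w', D *ᵥ w' = w)
    (v : c → T ⧸ Ideal.span {x}) (hv : C.map (Ideal.Quotient.mk (Ideal.span {x})) *ᵥ v = 0) :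
    ∃ w, D.map (Ideal.Quotient.mk (Ideal.span {x})) *ᵥ w = v := by
  set q := Ideal.Quotient.mk (Ideal.span {x})
  choose r hr using Ideal.Quotient.mk_surjective (I := Ideal.span {x})
  have hv' : (fun i => q (r (v i))) = v := funext fun i => hr (v i)
  have hmem : ∀ i, (C *ᵥ fun i => r (v i)) i ∈ Ideal.span {x} := fun i => by
    rw [← Ideal.Quotient.eq_zero_iff_mem]
    have := congrFun hv i
    rw [← hv'] at this
    exact (RingHom.map_mulVec q C (fun i => r (v i)) i).trans this
  choose w hw using fun i => Ideal.mem_span_singleton.1 (hmem i)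
  have hw' : C *ᵥ (fun i => r (v i)) = x • w := funext hw
  have hBw : B *ᵥ w = 0 := hB w (by rw [← hw', Matrix.mulVec_mulVec, hBC, Matrix.zero_mulVec])
  obtain ⟨w', rfl⟩ := hexB w hBw
  obtain ⟨w'', hw''⟩ := hexC ((fun i => r (v i)) - x • w') (by
    rw [Matrix.mulVec_sub, hw', Matrix.mulVec_smul, sub_self])
  refine ⟨fun i => q (w'' i), funext fun i => ?_⟩
  refine (RingHom.map_mulVec q D w'' i).symm.trans ?_
  rw [hw'', ← hv']
  have : q x = 0 := Ideal.Quotient.eq_zero_iff_mem.2 (Ideal.mem_span_singleton_self x)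
  simpa [this] using hr _

/-- Minimal resolutions over a regular local ring have bounded length. -/
theorem isEmpty_of_minimal_exact (d : ℕ) : ∀ (T : Type u) [CommRing T] [IsLocalRing T]
    [IsNoetherianRing T] (x : Fin d → T), maximalIdeal T = Ideal.span (Set.range x) →
    (d : WithBot ℕ∞) ≤ ringKrullDim T → ∀ {ι : ℕ → Type} [∀ j, Fintype (ι j)]
    (A : ∀ j, Matrix (ι j) (ι (j + 1)) T), (∀ j i k, A j i k ∈ maximalIdeal T) →
    (∀ j, A j * A (j + 1) = 0) → (∀ j v, A j *ᵥ v = 0 → ∃ w, A (j + 1) *ᵥ w = v) →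
    ∀ j, d + 1 ≤ j → IsEmpty (ι j) := by
  induction d with
  | zero =>
    intro T _ _ _ x hx _ ι _ A hA _ hex j hj
    have hm : maximalIdeal T = ⊥ := by rw [hx, Set.range_eq_empty, Ideal.span_empty]
    have hA0 : ∀ j, A j = 0 := fun j => by
      ext i k
      have := hA j i k
      rwa [hm] at this
    obtain ⟨j, rfl⟩ : ∃ i, j = i + 1 := ⟨j - 1, by omega⟩
    refine ⟨fun i => ?_⟩
    obtain ⟨w, hw⟩ := hex j (fun _ => 1) (by rw [hA0, Matrix.zero_mulVec])
    rw [hA0, Matrix.zero_mulVec] at hw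
    exact zero_ne_one (congrFun hw i)
  | succ d ih =>
    intro T _ _ _ x hx hd ι _ A hA hAA hex j hj
    have hdom := isDomain_of_regular _ T x hx hd
    obtain ⟨w, hwm, hw2⟩ := Set.not_subset.1 (not_maximalIdeal_le_sq hd)
    have hw0 : w ≠ 0 := fun h => hw2 (h ▸ zero_mem _)
    obtain ⟨_, y, hy, hyd⟩ := exists_regular_quotient hx hd hwm hw2
    obtain ⟨j, rfl⟩ : ∃ i, j = i + 1 := ⟨j - 1, by omega⟩
    refine ih _ y hy hyd (ι := fun j => ι (j + 1))
      (fun j => (A (j + 1)).map (Ideal.Quotient.mk (Ideal.span {w}))) ?_ ?_ ?_ j (by omega)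
    · intro j i k
      exact algebraMap_mem_maximalIdeal_of_surjective (B := T ⧸ Ideal.span {w})
        Ideal.Quotient.mk_surjective _ (hA _ _ _)
    · intro j
      rw [← Matrix.map_mul, hAA]
      ext; simp
    · intro j v hv
      refine exists_mulVec_map_mk_eq (B := A j) (fun w' h => ?_) (hAA j) (hex j) (hex (j + 1)) v hv
      rw [Matrix.mulVec_smul] at h
      exact (smul_eq_zero.1 h).resolve_left hw0

end Regular

section MinimalResolution

open IsLocalRing Matrix

variable {T : Type u} [CommRing T] [IsLocalRing T] [IsNoetherianRing T]

lemma exists_minimal_matrix {s : ℕ} (K : Submodule T (Fin s → T)) :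
    ∃ (t : ℕ) (M : Matrix (Fin s) (Fin t) T), (∀ x, x ∈ K ↔ ∃ w, M *ᵥ w = x) ∧
      ∀ v, M *ᵥ v = 0 → ∀ i, v i ∈ maximalIdeal T := by
  classical
  have hex : ∃ (t : ℕ) (M : Matrix (Fin s) (Fin t) T), ∀ x, x ∈ K ↔ ∃ w, M *ᵥ w = x := by
    obtain ⟨t, g, hg⟩ := Submodule.fg_iff_exists_fin_generating_family.1
      (IsNoetherian.noetherian K)
    refine ⟨t, Matrix.of fun i j => g j i, fun x => ?_⟩
    rw [← hg, Submodule.mem_span_range_iff_exists_fun]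
    refine exists_congr fun c => Eq.congr_left ?_
    ext i
    simp [Matrix.mulVec, dotProduct, mul_comm]
  obtain ⟨M, hM⟩ := Nat.find_spec hex
  refine ⟨Nat.find hex, M, hM, fun v hv i => ?_⟩
  by_contra hi
  have hu : IsUnit (v i) := by simpa using hi
  obtain ⟨t, ht⟩ : ∃ t, Nat.find hex = t + 1 := ⟨Nat.find hex - 1, by have := i.2; omega⟩
  have hmin := Nat.find_min hex (m := t) (by omega)
  generalize Nat.find hex = n at M v i t ht
  subst ht
  refine hmin ⟨M.submatrix id i.succAbove, fun x => (hM x).trans ⟨?_, ?_⟩⟩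
  · rintro ⟨w, rfl⟩
    obtain ⟨u, hu⟩ := hu
    refine ⟨fun j => w (i.succAbove j) - w i * ↑u⁻¹ * v (i.succAbove j), ?_⟩
    have : M *ᵥ w = M *ᵥ (w - (w i * ↑u⁻¹) • v) := by
      rw [Matrix.mulVec_sub, Matrix.mulVec_smul, hv, smul_zero, sub_zero]
    rw [this]
    ext k
    simp only [Matrix.mulVec, dotProduct]
    rw [Fin.sum_univ_succAbove _ i]
    simp [← hu]
  · rintro ⟨w, rfl⟩
    refine ⟨i.insertNth 0 w, ?_⟩
    ext k
    simp only [Matrix.mulVec, dotProduct]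
    rw [Fin.sum_univ_succAbove _ i]
    simp

variable (T) in
/-- Matrices of arbitrary size whose columns are a minimal system of generators. -/
structure MinimalMatrix where
  rows : ℕ
  cols : ℕ
  mat : Matrix (Fin rows) (Fin cols) T
  minimal : ∀ v, mat *ᵥ v = 0 → ∀ i, v i ∈ maximalIdeal T

/-- A minimal presentation of the kernel. -/
noncomputable def MinimalMatrix.next (M : MinimalMatrix T) : MinimalMatrix T where
  rows := M.cols
  cols := (exists_minimal_matrix (LinearMap.ker M.mat.mulVecLin)).choose
  mat := (exists_minimal_matrix (LinearMap.ker M.mat.mulVecLin)).choose_spec.choose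
  minimal := (exists_minimal_matrix (LinearMap.ker M.mat.mulVecLin)).choose_spec.choose_spec.2

lemma MinimalMatrix.mulVec_eq_zero_iff (M : MinimalMatrix T) (v : Fin M.cols → T) :
    M.mat *ᵥ v = 0 ↔ ∃ w, M.next.mat *ᵥ w = v :=
  ((exists_minimal_matrix (LinearMap.ker M.mat.mulVecLin)).choose_spec.choose_spec.1 v)

/-- The iterated minimal presentations. -/
noncomputable def MinimalMatrix.iter (M : MinimalMatrix T) : ℕ → MinimalMatrix T
  | 0 => M
  | j + 1 => (M.iter j).next

/-- Sizes in the free resolution built from `M`. -/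
noncomputable def MinimalMatrix.size (M : MinimalMatrix T) : ℕ → ℕ
  | 0 => 0
  | j + 1 => (M.iter j).rows

/-- Differentials in the free resolution built from `M`. -/
noncomputable def MinimalMatrix.diff (M : MinimalMatrix T) :
    ∀ j, Matrix (Fin (M.size j)) (Fin (M.size (j + 1))) T
  | 0 => 0
  | j + 1 => (M.iter j).mat

lemma MinimalMatrix.diff_mul_diff (M : MinimalMatrix T) (j : ℕ) :
    M.diff j * M.diff (j + 1) = 0 := by
  cases j with
  | zero => exact Matrix.zero_mul _
  | succ j =>
    refine Matrix.ext_of_mulVec_single fun i => ?_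
    rw [← Matrix.mulVec_mulVec, Matrix.zero_mulVec]
    exact ((M.iter j).mulVec_eq_zero_iff _).2 ⟨_, rfl⟩

/-- A free resolution of `T ⧸ N` by finite matrices, starting in degree one. -/
structure IsResolution {T : Type*} [CommRing T] (n : ℕ → ℕ)
    (C : ∀ j, Matrix (Fin (n j)) (Fin (n (j + 1))) T) (N : Ideal T) : Prop where
  size_zero : n 0 = 0
  size_one : n 1 = 1
  mul_eq_zero : ∀ j, C j * C (j + 1) = 0
  exact : ∀ j v, C (j + 1) *ᵥ v = 0 → ∃ w, C (j + 2) *ᵥ w = v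
  mem_iff : ∀ x, x ∈ N ↔ ∃ w, C 1 *ᵥ w = fun _ => x

lemma IsResolution.subsingleton {T : Type*} [CommRing T] {n : ℕ → ℕ}
    {C : ∀ j, Matrix (Fin (n j)) (Fin (n (j + 1))) T} {N : Ideal T} (hC : IsResolution n C N) :
    Subsingleton (Fin (n 1)) :=
  ⟨fun a b => Fin.ext (by have := a.2; have := b.2; have := hC.size_one; omega)⟩

/-- The quotient by the ideal `N` has a finite free resolution. -/
def HasFiniteResolution {T : Type*} [CommRing T] (N : Ideal T) : Prop :=
  ∃ (n : ℕ → ℕ) (C : ∀ j, Matrix (Fin (n j)) (Fin (n (j + 1))) T), IsResolution n C N ∧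
    ∃ L, ∀ j, L ≤ j → n j = 0

lemma exists_minimal_resolution {N : Ideal T} (hN : N ≠ ⊤) :
    ∃ (n : ℕ → ℕ) (C : ∀ j, Matrix (Fin (n j)) (Fin (n (j + 1))) T), IsResolution n C N ∧
      ∀ j i k, C (j + 1) i k ∈ maximalIdeal T := by
  obtain ⟨t, M, hM, hmin⟩ := exists_minimal_matrix
    (Submodule.comap (LinearMap.proj (R := T) (φ := fun _ : Fin 1 => T) 0) N)
  let MM : MinimalMatrix T := ⟨1, t, M, hmin⟩
  have hCN : ∀ x, x ∈ N ↔ ∃ w, MM.diff 1 *ᵥ w = fun _ => x := fun x => hM fun _ => x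
  have hexC : ∀ j v, MM.diff (j + 1) *ᵥ v = 0 → ∃ w, MM.diff (j + 2) *ᵥ w = v :=
    fun j v hv => ((MM.iter j).mulVec_eq_zero_iff v).1 hv
  refine ⟨MM.size, MM.diff, ⟨rfl, rfl, MM.diff_mul_diff, hexC, hCN⟩, ?_⟩
  intro j i k
  cases j with
  | zero =>
    refine le_maximalIdeal hN ((hCN _).2 ⟨Pi.single k 1, ?_⟩)
    ext i'
    rw [Matrix.mulVec_single_one]
    have : i' = i := Subsingleton.elim (α := Fin 1) _ _
    rw [this]; rfl
  | succ j =>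
    have h2 : (MM.diff (j + 2) *ᵥ Pi.single k 1) i ∈ maximalIdeal T :=
      (MM.iter j).minimal (MM.diff (j + 2) *ᵥ Pi.single k 1)
        (((MM.iter j).mulVec_eq_zero_iff _).2 ⟨_, rfl⟩) i
    have h1 := congrFun (Matrix.mulVec_single_one (MM.diff (j + 2)) k) i
    rw [h1] at h2
    exact h2

/-- Every proper ideal of a regular local ring has a finite free resolution. -/
theorem hasFiniteResolution_of_regular {d : ℕ} {x : Fin d → T}
    (hx : maximalIdeal T = Ideal.span (Set.range x)) (hd : (d : WithBot ℕ∞) ≤ ringKrullDim T)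
    {N : Ideal T} (hN : N ≠ ⊤) : HasFiniteResolution N := by
  obtain ⟨n, C, hC, hmin⟩ := exists_minimal_resolution hN
  refine ⟨n, C, hC, d + 2, fun j hj => ?_⟩
  obtain ⟨j, rfl⟩ : ∃ i, j = i + 1 := ⟨j - 1, by omega⟩
  have := isEmpty_of_minimal_exact d T x hx hd (ι := fun j => Fin (n (j + 1)))
    (fun j => C (j + 1)) hmin (fun j => hC.mul_eq_zero (j + 1)) hC.exact j (by omega)
  exact Nat.eq_zero_of_not_pos fun h => this.false ⟨0, h⟩

lemma HasFiniteResolution.map_mk {T : Type u} [CommRing T] {N : Ideal T}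
    (h : HasFiniteResolution N) {x : T} (hx : ∀ y, x * y = 0 → y = 0)
    (hxN : ∀ y, x * y ∈ N → y ∈ N) :
    HasFiniteResolution (N.map (Ideal.Quotient.mk (Ideal.span {x}))) := by
  obtain ⟨n, C, hC, hL⟩ := h
  refine ⟨n, fun j => (C j).map (Ideal.Quotient.mk (Ideal.span {x})),
    ⟨hC.size_zero, hC.size_one, fun j => ?_, fun j v hv => ?_, fun y => ?_⟩, hL⟩
  · rw [← Matrix.map_mul, hC.mul_eq_zero]
    ext; simp
  · cases j with
    | zero =>
      -- resolve the augmentation by generators of `N`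
      set q := Ideal.Quotient.mk (Ideal.span {x})
      choose r hr using Ideal.Quotient.mk_surjective (I := Ideal.span {x})
      have hv' : (fun i => q (r (v i))) = v := funext fun i => hr (v i)
      have i₀ : Fin (n 1) := Fin.cast hC.size_one.symm 0
      have hsub := hC.subsingleton
      have hmem : (C 1 *ᵥ fun i => r (v i)) i₀ ∈ Ideal.span {x} := by
        rw [← Ideal.Quotient.eq_zero_iff_mem]
        have := congrFun hv i₀
        rw [← hv'] at this
        exact (RingHom.map_mulVec q (C 1) (fun i => r (v i)) i₀).trans this
      obtain ⟨y, hy⟩ := Ideal.mem_span_singleton.1 hmem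
      have hyN : y ∈ N := hxN y ((hC.mem_iff _).2 ⟨fun i => r (v i), by
        ext i; rw [← hy, Subsingleton.elim i i₀]⟩)
      obtain ⟨w', hw'⟩ := (hC.mem_iff _).1 hyN
      obtain ⟨w'', hw''⟩ := hC.exact 0 ((fun i => r (v i)) - x • w') (by
        rw [Matrix.mulVec_sub, Matrix.mulVec_smul, sub_eq_zero]
        ext i
        rw [hw', Subsingleton.elim i i₀]
        exact hy)
      refine ⟨fun i => q (w'' i), funext fun i => ?_⟩
      refine (RingHom.map_mulVec q (C 2) w'' i).symm.trans ?_
      rw [hw'', ← hv']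
      have : q x = 0 := Ideal.Quotient.eq_zero_iff_mem.2 (Ideal.mem_span_singleton_self x)
      simpa [this] using hr _
    | succ j =>
      refine exists_mulVec_map_mk_eq (B := C (j + 1)) (fun w' h => ?_) (hC.mul_eq_zero (j + 1))
        (hC.exact j) (hC.exact (j + 1)) v hv
      rw [Matrix.mulVec_smul] at h
      exact funext fun i => hx _ (congrFun h i)
  · have hne : ∀ w : Fin (n 2) → T, (C 1).map (Ideal.Quotient.mk (Ideal.span {x})) *ᵥ
        (fun i => Ideal.Quotient.mk (Ideal.span {x}) (w i)) =
        fun i => Ideal.Quotient.mk (Ideal.span {x}) ((C 1 *ᵥ w) i) := fun w =>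
      funext fun i => (RingHom.map_mulVec _ (C 1) w i).symm
    have i₀ : Fin (n 1) := Fin.cast hC.size_one.symm 0
    have hsub := hC.subsingleton
    rw [Ideal.mem_map_iff_of_surjective _ Ideal.Quotient.mk_surjective]
    constructor
    · rintro ⟨y, hy, rfl⟩
      obtain ⟨w, hw⟩ := (hC.mem_iff y).1 hy
      exact ⟨_, (hne w).trans (by rw [hw])⟩
    · rintro ⟨w, hw⟩
      choose r hr using Ideal.Quotient.mk_surjective (I := Ideal.span {x})
      refine ⟨(C 1 *ᵥ fun i => r (w i)) i₀, (hC.mem_iff _).2 ⟨fun i => r (w i), ?_⟩, ?_⟩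
      · ext i; rw [Subsingleton.elim i i₀]
      · have h1 := congrFun (hne fun i => r (w i)) i₀
        simp only [hr] at h1
        rw [← h1, hw]

end MinimalResolution

section Complete

open IsLocalRing

lemma IsPrecomplete.of_surjective {T B : Type*} [CommRing T] [CommRing B] {q : T →+* B}
    (hq : Function.Surjective q) (I : Ideal T) [IsPrecomplete I T] : IsPrecomplete (I.map q) B := by
  refine ⟨fun f hf => ?_⟩
  have hg : ∀ n, ∃ g ∈ I ^ n, q g = f (n + 1) - f n := fun n => by
    have h := (SModEq.sub_mem.1 (hf n.le_succ).symm)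
    rw [smul_eq_mul, Ideal.mul_top, ← Ideal.map_pow] at h
    exact (Ideal.mem_map_iff_of_surjective q hq).1 h
  choose g hgI hg using hg
  obtain ⟨t, ht⟩ := hq (f 0)
  let F : ℕ → T := fun n => t + ∑ i ∈ Finset.range n, g i
  have hF : ∀ n, q (F n) = f n := fun n => by
    simp only [F, map_add, map_sum, hg, ht, Finset.sum_range_sub]
    ring
  obtain ⟨L, hL⟩ := IsPrecomplete.prec' (I := I) F (fun {m n} hmn => by
    rw [SModEq.comm, SModEq.sub_mem, smul_eq_mul, Ideal.mul_top]
    have : F n - F m = ∑ i ∈ Finset.Ico m n, g i := by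
      simp only [F, Finset.sum_Ico_eq_sub _ hmn]; ring
    rw [this]
    exact Ideal.sum_mem _ fun i hi => Ideal.pow_le_pow_right (Finset.mem_Ico.1 hi).1 (hgI i))
  refine ⟨q L, fun n => ?_⟩
  have h := SModEq.sub_mem.1 (hL n)
  rw [smul_eq_mul, Ideal.mul_top] at h
  rw [SModEq.sub_mem, smul_eq_mul, Ideal.mul_top, ← hF, ← map_sub, ← Ideal.map_pow]
  exact Ideal.mem_map_of_mem q h

lemma isAdicComplete_of_surjective {T B : Type*} [CommRing T] [CommRing B] [IsLocalRing T]
    [IsLocalRing B] [IsNoetherianRing B] [IsAdicComplete (maximalIdeal T) T] {q : T →+* B}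
    (hq : Function.Surjective q) : IsAdicComplete (maximalIdeal B) B := by
  have h : (maximalIdeal T).map q = maximalIdeal B := by
    rw [← comap_maximalIdeal_of_surjective hq, Ideal.map_comap_of_surjective _ hq]
  have := IsPrecomplete.of_surjective hq (maximalIdeal T)
  rw [h] at this
  exact { }

/-- A ring with residue field covered by `A₀` is finite over `A₀` modulo an ideal of
definition. -/
lemma exists_sum_sub_mem_pow {A₀ B : Type*} [CommRing A₀] [CommRing B] [IsLocalRing B]
    [IsNoetherianRing B] {φ : A₀ →+* B} (hφ : ∀ t, ∃ α, t - φ α ∈ maximalIdeal B) (n : ℕ) :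
    ∃ (m : ℕ) (b : Fin m → B), ∀ t, ∃ α : Fin m → A₀,
      t - ∑ i, φ (α i) * b i ∈ maximalIdeal B ^ n := by
  induction n with
  | zero => exact ⟨0, Fin.elim0, fun t => ⟨Fin.elim0, by simp⟩⟩
  | succ n ih =>
    obtain ⟨m, b, hb⟩ := ih
    obtain ⟨l, g, hg⟩ := Submodule.fg_iff_exists_fin_generating_family.1
      (IsNoetherian.noetherian (maximalIdeal B ^ n))
    refine ⟨m + l, Fin.append b g, fun t => ?_⟩
    obtain ⟨α, hα⟩ := hb t
    rw [← hg, Submodule.mem_span_range_iff_exists_fun] at hα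
    obtain ⟨c, hc⟩ := hα
    choose β hβ using fun j => hφ (c j)
    refine ⟨Fin.append α β, ?_⟩
    rw [Fin.sum_univ_add]
    simp only [Fin.append_left, Fin.append_right]
    rw [← sub_sub, ← hc, ← Finset.sum_sub_distrib, pow_succ']
    refine Ideal.sum_mem _ fun j _ => ?_
    rw [smul_eq_mul, ← sub_mul]
    refine Ideal.mul_mem_mul (hβ j) ?_
    rw [← hg]
    exact Submodule.subset_span ⟨j, rfl⟩

/-- Extension of a finite family by zero. -/
def finExt {T : Type*} [Zero T] {n : ℕ} (u : Fin n → T) (i : ℕ) : T :=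
  if h : i < n then u ⟨i, h⟩ else 0

lemma finExt_mem {T : Type*} [CommRing T] {I : Ideal T} {n : ℕ} {u : Fin n → T}
    (hu : ∀ i, u i ∈ I) (i : ℕ) : finExt u i ∈ I := by
  unfold finExt
  split_ifs
  · exact hu _
  · exact zero_mem _

lemma finExt_image {T : Type*} [Zero T] {n : ℕ} (u : Fin n → T) :
    finExt u '' Set.Iio n = Set.range u := by
  ext x
  constructor
  · rintro ⟨i, hi, rfl⟩
    exact ⟨⟨i, hi⟩, by rw [finExt, dif_pos (Set.mem_Iio.1 hi)]⟩
  · rintro ⟨i, rfl⟩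
    exact ⟨i, i.2, dif_pos i.2⟩

lemma map_finExt {T B : Type*} [CommRing T] [CommRing B] (q : T →+* B) {n : ℕ} (u : Fin n → T) :
    (fun i => q (finExt u i)) = finExt (fun i => q (u i)) := by
  ext i
  unfold finExt
  split_ifs <;> simp

end Complete

section Finiteness

set_option linter.unusedSectionVars false

open IsLocalRing

variable {A₀ T : Type u} [CommRing A₀] [CommRing T] [IsLocalRing A₀]
  [IsAdicComplete (maximalIdeal A₀) A₀] [IsLocalRing T] [IsNoetherianRing T]
  [IsAdicComplete (maximalIdeal T) T]

/-- Finiteness over a complete ring with principal maximal ideal, modulo `J`. -/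
lemma exists_sum_sub_mem_of_maximalIdeal_eq_span {ϖ : A₀} (hϖ : maximalIdeal A₀ = Ideal.span {ϖ})
    {φ : A₀ →+* T} (hφϖ : φ ϖ ∈ maximalIdeal T) {κ : Type*} [Fintype κ] (b : κ → T) (J : Ideal T)
    (h : ∀ t, ∃ α : κ → A₀, t - ∑ i, φ (α i) * b i ∈ J ⊔ Ideal.span {φ ϖ}) (t : T) :
    ∃ α : κ → A₀, t - ∑ i, φ (α i) * b i ∈ J := by
  have hϖm : ϖ ∈ maximalIdeal A₀ := hϖ ▸ Ideal.mem_span_singleton_self ϖ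
  have hle : ∀ x ∈ maximalIdeal A₀, φ x ∈ maximalIdeal T := fun x hx => by
    rw [hϖ] at hx
    obtain ⟨y, rfl⟩ := Ideal.mem_span_singleton.1 hx
    rw [map_mul]
    exact Ideal.mul_mem_right _ _ hφϖ
  obtain ⟨s, hs⟩ := IterPS.exists_sum_eval (I := maximalIdeal T) φ (v := fun _ => φ ϖ)
    (fun _ => hφϖ) b 1 J (IsNoetherian.noetherian J) (by
      have : (fun _ : ℕ => φ ϖ) '' Set.Iio 1 = {φ ϖ} := by ext; simp
      rwa [this]) t
  refine ⟨fun i => IterPS.eval (maximalIdeal A₀) (RingHom.id A₀) (fun _ => ϖ) (fun _ => hϖm) 1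
    (s i), ?_⟩
  have key : ∀ s, φ (IterPS.eval (maximalIdeal A₀) (RingHom.id A₀) (fun _ => ϖ) (fun _ => hϖm) 1
      s) = IterPS.eval (maximalIdeal T) φ (fun _ => φ ϖ) (fun _ => hφϖ) 1 s := fun s =>
    IterPS.map_eval (RingHom.id A₀) (v := fun _ => ϖ) (fun _ => hϖm) φ
      (fun x hx => Ideal.mem_comap.2 (hle x hx)) 1 s
  simpa only [key] using hs

/-- Finiteness over a power series ring over a complete ring with principal maximal ideal. -/
lemma exists_finite_generation {ϖ : A₀} (hϖ : maximalIdeal A₀ = Ideal.span {ϖ})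
    {φ : A₀ →+* T} (hφϖ : φ ϖ ∈ maximalIdeal T) (hφ : ∀ t, ∃ α, t - φ α ∈ maximalIdeal T)
    {a : ℕ} {u : Fin a → T} (hu : ∀ i, u i ∈ maximalIdeal T)
    (hdim : maximalIdeal T ≤ (Ideal.span {φ ϖ} ⊔ Ideal.span (Set.range u)).radical) :
    ∃ (m : ℕ) (b : Fin m → T), ∀ t, ∃ α : Fin m → IterPS A₀ a,
      ∑ i, IterPS.eval (maximalIdeal T) φ (finExt u) (finExt_mem hu) a (α i) * b i = t := by
  obtain ⟨n, hn⟩ := Ideal.exists_pow_le_of_le_radical_of_fg hdim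
    (IsNoetherian.noetherian (maximalIdeal T))
  obtain ⟨m, b, hb⟩ := exists_sum_sub_mem_pow hφ n
  refine ⟨m, b, fun t => ?_⟩
  obtain ⟨α, hα⟩ := IterPS.exists_sum_eval (I := maximalIdeal T) φ (finExt_mem hu) b a ⊥
    Submodule.fg_bot (by
    rw [finExt_image, bot_sup_eq]
    refine exists_sum_sub_mem_of_maximalIdeal_eq_span hϖ hφϖ b _ fun t => ?_
    obtain ⟨α, hα⟩ := hb t
    exact ⟨α, sup_comm (Ideal.span {φ ϖ}) _ ▸ hn hα⟩) t
  exact ⟨α, (sub_eq_zero.1 hα).symm⟩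

omit [IsLocalRing A₀] [IsAdicComplete (maximalIdeal A₀) A₀] [IsNoetherianRing T] in
lemma eval_surjective_of_span {φ : A₀ →+* T} (hφ : ∀ t, ∃ α, t - φ α ∈ maximalIdeal T)
    {a c : ℕ} {u : Fin a → T} {v : Fin c → T} (hu : ∀ i, u i ∈ maximalIdeal T)
    (hv : ∀ i, v i ∈ maximalIdeal T)
    (huv : maximalIdeal T = Ideal.span (Set.range u) ⊔ Ideal.span (Set.range v)) :
    Function.Surjective (IterPS.eval (maximalIdeal T)
      (IterPS.eval (maximalIdeal T) φ (finExt u) (finExt_mem hu) a) (finExt v)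
      (finExt_mem hv) c) := by
  intro t
  obtain ⟨s, hs⟩ := IterPS.exists_sum_eval (I := maximalIdeal T)
    (IterPS.eval (maximalIdeal T) φ (finExt u) (finExt_mem hu) a) (finExt_mem hv)
    (fun _ : Fin 1 => (1 : T)) c ⊥ Submodule.fg_bot (fun t => by
      refine IterPS.exists_sum_eval (I := maximalIdeal T) φ (finExt_mem hu)
        (fun _ : Fin 1 => (1 : T)) a _ ?_ (fun t => ?_) t
      · rw [bot_sup_eq, finExt_image]
        exact Submodule.fg_span (Set.finite_range v)
      obtain ⟨α, hα⟩ := hφ t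
      refine ⟨fun _ => α, ?_⟩
      rw [finExt_image, finExt_image, bot_sup_eq, sup_comm, ← huv]
      simpa using hα) t
  exact ⟨s 0, by simpa [sub_eq_zero] using (sub_eq_zero.1 hs).symm⟩

end Finiteness

section Abstract

lemma subsingleton_matHomology_of_isEmpty {T : Type u} [CommRing T] {ι : ℕ → Type}
    [∀ j, Fintype (ι j)] (C : ∀ j, Matrix (ι j) (ι (j + 1)) T) (E : Type u) [AddCommGroup E]
    [Module T E] (j : ℕ) [IsEmpty (ι (j + 1))] : Subsingleton (matHomology C E j) := by
  refine ⟨fun x y => ?_⟩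
  obtain ⟨x, rfl⟩ := pairHomology.mk_surjective _ _ x
  obtain ⟨y, rfl⟩ := pairHomology.mk_surjective _ _ y
  exact congrArg _ (Subtype.ext (Subsingleton.elim _ _))

open IsLocalRing Function

variable {A₀ T : Type u} [CommRing A₀] [CommRing T] [IsLocalRing A₀] [IsLocalRing T]
  [IsAdicComplete (maximalIdeal T) T]

lemma exists_maximalIdeal_iterPS_eq_span {ϖ : A₀} (hϖ : maximalIdeal A₀ = Ideal.span {ϖ})
    {a e : ℕ} (he : ϖ = 0 ∧ e = a ∨ e = a + 1) :
    ∃ y : Fin e → IterPS A₀ a, maximalIdeal (IterPS A₀ a) = Ideal.span (Set.range y) := by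
  have h := IterPS.maximalIdeal_eq (A := A₀) a
  have hr : IterPS.var A₀ a '' Set.Iio a = Set.range fun i : Fin a => IterPS.var A₀ a i := by
    ext x
    constructor
    · rintro ⟨i, hi, rfl⟩
      exact ⟨⟨i, hi⟩, rfl⟩
    · rintro ⟨i, rfl⟩
      exact ⟨i, i.2, rfl⟩
  rw [hϖ, hr, Ideal.map_span, Set.image_singleton] at h
  rcases he with ⟨rfl, rfl⟩ | rfl
  · exact ⟨_, by rw [h, map_zero, Ideal.span_singleton_zero, bot_sup_eq]⟩
  · refine ⟨Fin.cons (IterPS.const A₀ a ϖ) fun i : Fin a => IterPS.var A₀ a i, ?_⟩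
    rw [h, Fin.range_cons, Ideal.span_insert]

lemma map_maximalIdeal_iterPS {ϖ : A₀} (hϖ : maximalIdeal A₀ = Ideal.span {ϖ}) (φ : A₀ →+* T)
    {a : ℕ} {u : Fin a → T} (hu : ∀ i, u i ∈ maximalIdeal T) :
    (maximalIdeal (IterPS A₀ a)).map
      (IterPS.eval (maximalIdeal T) φ (finExt u) (finExt_mem hu) a) =
      Ideal.span {φ ϖ} ⊔ Ideal.span (Set.range u) := by
  rw [IterPS.maximalIdeal_eq, hϖ, Ideal.map_sup, Ideal.map_span, Ideal.map_span, Ideal.map_span,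
    Set.image_singleton, Set.image_singleton, IterPS.eval_const, ← finExt_image u,
    ← Set.image_comp]
  congr 2
  exact Set.image_congr fun i hi => IterPS.eval_var _ _ hi

lemma exists_finite_generation_quotient [IsNoetherianRing T]
    [IsAdicComplete (maximalIdeal A₀) A₀] {ϖ : A₀}
    (hϖ : maximalIdeal A₀ = Ideal.span {ϖ})
    {φ : A₀ →+* T} (hφϖ : φ ϖ ∈ maximalIdeal T) (hφ : ∀ t, ∃ α, t - φ α ∈ maximalIdeal T)
    {a : ℕ} {u : Fin a → T} (hu : ∀ i, u i ∈ maximalIdeal T) {𝔟 : Ideal T} (hb : 𝔟 ≠ ⊤)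
    (hdim : ringKrullDim (T ⧸ 𝔟 ⊔ (Ideal.span {φ ϖ} ⊔ Ideal.span (Set.range u))) ≤ 0) :
    ∃ (m : ℕ) (b : Fin m → T ⧸ 𝔟), ∀ x, ∃ α : Fin m → IterPS A₀ a, ∑ i, algebraMap T (T ⧸ 𝔟)
      (IterPS.eval (maximalIdeal T) φ (finExt u) (finExt_mem hu) a (α i)) * b i = x := by
  have := isLocalRing_quotient hb
  have hq : Surjective (algebraMap T (T ⧸ 𝔟)) := Ideal.Quotient.mk_surjective
  have := isAdicComplete_of_surjective hq
  have hmem := algebraMap_mem_maximalIdeal_of_surjective hq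
  obtain ⟨m, b, h⟩ := exists_finite_generation (T := T ⧸ 𝔟) hϖ
    (φ := (algebraMap T (T ⧸ 𝔟)).comp φ) (hmem _ hφϖ) (fun t => by
      obtain ⟨t, rfl⟩ := hq t
      obtain ⟨α, hα⟩ := hφ t
      exact ⟨α, by rw [RingHom.comp_apply, ← map_sub]; exact hmem _ hα⟩)
    (u := fun i => algebraMap T (T ⧸ 𝔟) (u i)) (fun i => hmem _ (hu i)) (by
      intro x hx
      obtain ⟨t, rfl⟩ := hq x
      have ht : t ∈ maximalIdeal T := by
        rw [← comap_maximalIdeal_of_surjective hq]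
        exact Ideal.mem_comap.2 hx
      obtain ⟨k, hk⟩ := maximalIdeal_le_radical_of_ringKrullDim_le_zero hdim ht
      refine ⟨k, ?_⟩
      have h1 := Ideal.mem_map_of_mem (algebraMap T (T ⧸ 𝔟)) hk
      rw [Ideal.map_sup, Ideal.map_sup, Ideal.map_span, Ideal.map_span, Set.image_singleton,
        ← Set.range_comp, map_pow] at h1
      have h2 : 𝔟.map (algebraMap T (T ⧸ 𝔟)) = ⊥ := Ideal.map_quotient_self 𝔟
      rwa [h2, bot_sup_eq] at h1)
  refine ⟨m, b, fun x => ?_⟩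
  obtain ⟨α, hα⟩ := h x
  refine ⟨α, ?_⟩
  rw [← hα]
  refine Finset.sum_congr rfl fun i _ => congrArg (· * b i) ?_
  refine (IterPS.map_eval φ (finExt_mem hu) (algebraMap T (T ⧸ 𝔟))
    (fun x hx => Ideal.mem_comap.2 (hmem x hx)) a (α i)).trans ?_
  have h3 := map_finExt (algebraMap T (T ⧸ 𝔟)) u
  congr 1
  congr 1

variable [IsNoetherianRing T] [IsNoetherianRing A₀] [IsDomain A₀]

lemma eq_zero_of_eval_mem {ϖ : A₀}
    (hϖ : maximalIdeal A₀ = Ideal.span {ϖ}) {φ : A₀ →+* T} (hφϖ : φ ϖ ∈ maximalIdeal T)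
    {a e : ℕ} (he : ϖ = 0 ∧ e = a ∨ e = a + 1) {u : Fin a → T} (hu : ∀ i, u i ∈ maximalIdeal T)
    {N : Ideal T} {b : ℕ}
    (hb : ringKrullDim (T ⧸ N ⊔ (Ideal.span {φ ϖ} ⊔ Ideal.span (Set.range u))) ≤ b)
    (hdim : ((b + e : ℕ) : WithBot ℕ∞) ≤ ringKrullDim (T ⧸ N)) {α : IterPS A₀ a}
    (hα : IterPS.eval (maximalIdeal T) φ (finExt u) (finExt_mem hu) a α ∈ N) : α = 0 := by
  obtain ⟨y, hy⟩ := exists_maximalIdeal_iterPS_eq_span hϖ he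
  by_contra hne
  refine not_le_ringKrullDim_quotient_of_map_mem
    (φ := IterPS.eval (maximalIdeal T) φ (finExt u) (finExt_mem hu) a) (fun x hx => ?_) hy
    (by rwa [map_maximalIdeal_iterPS hϖ φ hu]) hne hα hdim
  have h1 := Ideal.mem_map_of_mem
    (IterPS.eval (maximalIdeal T) φ (finExt u) (finExt_mem hu) a) hx
  rw [map_maximalIdeal_iterPS hϖ φ hu] at h1
  refine (sup_le ?_ ?_ : _ ≤ maximalIdeal T) h1
  · rwa [Ideal.span_singleton_le_iff_mem]
  · rw [Ideal.span_le]
    rintro _ ⟨i, rfl⟩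
    exact hu i

variable [IsAdicComplete (maximalIdeal A₀) A₀]

theorem le_of_coordinates {ϖ : A₀}
    (hϖ : maximalIdeal A₀ = Ideal.span {ϖ}) {φ : A₀ →+* T} (hφϖ : φ ϖ ∈ maximalIdeal T)
    (hφ : ∀ t, ∃ α, t - φ α ∈ maximalIdeal T)
    {a c e : ℕ} (he : ϖ = 0 ∧ e = a ∨ e = a + 1) {u : Fin a → T} {v : Fin c → T}
    (huv : maximalIdeal T = Ideal.span (Set.range u) ⊔ Ideal.span (Set.range v))
    {𝔟 N : Ideal T} (hprim : maximalIdeal T ≤ (𝔟 ⊔ N).radical)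
    (h𝔟 : ringKrullDim (T ⧸ 𝔟 ⊔ (Ideal.span {φ ϖ} ⊔ Ideal.span (Set.range u))) ≤ 0)
    (he𝔟 : (e : WithBot ℕ∞) ≤ ringKrullDim (T ⧸ 𝔟)) {k : ℕ}
    (hk : (k : WithBot ℕ∞) ≤ ringKrullDim (T ⧸ N)) : k ≤ c := by
  have hu : ∀ i, u i ∈ maximalIdeal T := fun i =>
    huv ▸ Ideal.mem_sup_left (Ideal.subset_span ⟨i, rfl⟩)
  have hv : ∀ i, v i ∈ maximalIdeal T := fun i =>
    huv ▸ Ideal.mem_sup_right (Ideal.subset_span ⟨i, rfl⟩)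
  have hne : 𝔟 ≠ ⊤ := by
    rintro rfl
    rw [ringKrullDim_eq_bot_of_subsingleton] at he𝔟
    exact absurd he𝔟 (by simp)
  have := isLocalRing_quotient hne
  have hq : Surjective (algebraMap T (T ⧸ 𝔟)) := Ideal.Quotient.mk_surjective
  have := isAdicComplete_of_surjective hq
  obtain ⟨m, b, hb⟩ := exists_finite_generation_quotient hϖ hφϖ hφ hu hne h𝔟
  refine ringKrullDim_quotient_le_of_surjective_eval hq
    (eval_surjective_of_span hφ hu hv huv) hb ?_ (N := N) ?_ hk
  · refine (injective_iff_map_eq_zero _).2 fun α hα => ?_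
    refine eq_zero_of_eval_mem (b := 0) hϖ hφϖ he hu (by exact_mod_cast h𝔟) (by rwa [zero_add]) ?_
    exact Ideal.Quotient.eq_zero_iff_mem.1 hα
  · have : RingHom.ker (algebraMap T (T ⧸ 𝔟)) = 𝔟 := Ideal.mk_ker
    rwa [this]

theorem not_le_ringKrullDim_of_coordinates {ϖ : A₀}
    (hϖ : maximalIdeal A₀ = Ideal.span {ϖ}) {φ : A₀ →+* T} (hφϖ : φ ϖ ∈ maximalIdeal T)
    (hφ : ∀ t, ∃ α, t - φ α ∈ maximalIdeal T)
    {a c e : ℕ} (he : ϖ = 0 ∧ e = a ∨ e = a + 1) {u : Fin a → T} {v : Fin c → T}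
    (hu : ∀ i, u i ∈ maximalIdeal T) (hv : ∀ i, v i ∈ maximalIdeal T)
    (huv : maximalIdeal T = Ideal.span (Set.range u) ⊔ Ideal.span (Set.range v))
    {𝔟 N : Ideal T} (hprim : maximalIdeal T ≤ (𝔟 ⊔ N).radical)
    (h𝔟 : ringKrullDim (T ⧸ 𝔟 ⊔ (Ideal.span {φ ϖ} ⊔ Ideal.span (Set.range u))) ≤ 0)
    (he𝔟 : (e : WithBot ℕ∞) ≤ ringKrullDim (T ⧸ 𝔟)) {b : ℕ}
    (hN : ringKrullDim (T ⧸ N ⊔ (Ideal.span {φ ϖ} ⊔ Ideal.span (Set.range u))) ≤ b)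
    (hbc : b + e ≤ c) {f : IterPS (IterPS A₀ a) c} (hf : f ≠ 0)
    (hker : RingHom.ker (IterPS.eval (maximalIdeal T)
      (IterPS.eval (maximalIdeal T) φ (finExt u) (finExt_mem hu) a) (finExt v)
      (finExt_mem hv) c) = Ideal.span {f})
    (hres : HasFiniteResolution 𝔟 ∨ HasFiniteResolution N) :
    ¬ (c : WithBot ℕ∞) ≤ ringKrullDim (T ⧸ N) := by
  intro hc
  have hne : 𝔟 ≠ ⊤ := by
    rintro rfl
    rw [ringKrullDim_eq_bot_of_subsingleton] at he𝔟
    exact absurd he𝔟 (by simp)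
  have hneN : N ≠ ⊤ := by
    rintro rfl
    rw [ringKrullDim_eq_bot_of_subsingleton] at hc
    exact absurd hc (by simp)
  have := isLocalRing_quotient hne
  have hq : Surjective (algebraMap T (T ⧸ 𝔟)) := Ideal.Quotient.mk_surjective
  have := isAdicComplete_of_surjective hq
  obtain ⟨m, b', hb'⟩ := exists_finite_generation_quotient hϖ hφϖ hφ hu hne h𝔟
  obtain ⟨n, C, hC, J, hJ⟩ : ∃ (n : ℕ → ℕ) (C : ∀ j, Matrix (Fin (n j)) (Fin (n (j + 1))) T),
      IsResolution n C N ∧ ∃ J, ∀ j ≥ J, Subsingleton (matHomology C (T ⧸ 𝔟) j) := by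
    rcases hres with ⟨n', C', hC', L, hL⟩ | ⟨n, C, hC, L, hL⟩
    · obtain ⟨n, C, hC, -⟩ := exists_minimal_resolution hneN
      refine ⟨n, C, hC, L + 2, fun j hj => ?_⟩
      have hsub := hC'.subsingleton
      let i₀ : Fin (n' 1) := Fin.cast hC'.size_one.symm 0
      refine exists_subsingleton_matHomology hC.mul_eq_zero hC.exact hC'.exact hC'.mul_eq_zero
        (n := L) (by rw [hL (L + 1) (by omega)]; infer_instance)
        ((Submodule.mkQ 𝔟).comp (LinearMap.proj i₀)) ?_ ?_ j hj
      · intro x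
        obtain ⟨t, rfl⟩ := Submodule.mkQ_surjective 𝔟 x
        exact ⟨fun _ => t, rfl⟩
      · intro w
        have hw : w = fun _ => w i₀ := funext fun i => by rw [Subsingleton.elim i i₀]
        have h1 := hC'.mem_iff (w i₀)
        rw [← hw] at h1
        rw [LinearMap.comp_apply, LinearMap.proj_apply, Submodule.mkQ_apply,
          Submodule.Quotient.mk_eq_zero, h1]
        rfl
    · refine ⟨n, C, hC, L, fun j hj => ?_⟩
      have : IsEmpty (Fin (n (j + 1))) := by rw [hL (j + 1) (by omega)]; infer_instance
      exact subsingleton_matHomology_of_isEmpty C (T ⧸ 𝔟) j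
  have hsub := hC.subsingleton
  have : IsEmpty (Fin (n 0)) := by rw [hC.size_zero]; infer_instance
  let i₀ : Fin (n 1) := Fin.cast hC.size_one.symm 0
  let _ : Unique (Fin (n 1)) := ⟨⟨i₀⟩, fun i => Subsingleton.elim i i₀⟩
  refine not_le_ringKrullDim_quotient_of_surjective_eval hq
    (eval_surjective_of_span hφ hu hv huv) hb' ?_ hf hker hC.mul_eq_zero hC.exact (N := N) ?_ ?_ hJ
    ?_ hc
  · refine (injective_iff_map_eq_zero _).2 fun α hα => ?_
    refine eq_zero_of_eval_mem (b := 0) hϖ hφϖ he hu (by exact_mod_cast h𝔟) (by rwa [zero_add]) ?_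
    exact Ideal.Quotient.eq_zero_iff_mem.1 hα
  · intro x
    rw [hC.mem_iff]
    refine exists_congr fun w => ⟨fun h => congrFun h _, fun h => ?_⟩
    ext i
    rw [← h, Subsingleton.elim i default]
  · have : RingHom.ker (algebraMap T (T ⧸ 𝔟)) = 𝔟 := Ideal.mk_ker
    rwa [this]
  · intro p hp hNp hcp α hα
    refine eq_zero_of_eval_mem (b := b) hϖ hφϖ he hu (N := p) ?_ ?_ hα
    · exact (ringKrullDim_quotient_anti (sup_le_sup_right hNp _)).trans hN
    · exact le_trans (by exact_mod_cast hbc) hcp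

end Abstract

section Cases

open IsLocalRing Function

variable {T : Type u} [CommRing T] [IsLocalRing T]

lemma exists_ringKrullDim_quotient_eq_nat [IsNoetherianRing T] {d : ℕ} {x : Fin d → T}
    (hx : maximalIdeal T = Ideal.span (Set.range x)) {I : Ideal T} (hI : I ≠ ⊤) :
    ∃ a ≤ d, ringKrullDim (T ⧸ I) = (a : ℕ) := by
  have h1 := ringKrullDim_quotient_le_sup_span_range (I := I) (z := x)
    (fun i => hx ▸ Ideal.subset_span ⟨i, rfl⟩)
  have h2 : ringKrullDim (T ⧸ I ⊔ Ideal.span (Set.range x)) ≤ 0 :=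
    ringKrullDim_quotient_le_zero (hx ▸ le_sup_right.trans Ideal.le_radical)
  have h3 : ringKrullDim (T ⧸ I) ≤ (d : ℕ) :=
    h1.trans ((add_le_add_left h2 _).trans (by rw [zero_add]))
  have := Ideal.Quotient.nontrivial_iff.2 hI
  have h4 : 0 ≤ ringKrullDim (T ⧸ I) := ringKrullDim_nonneg_of_nontrivial
  generalize ringKrullDim (T ⧸ I) = n at h3 h4
  induction n with
  | bot => simp at h4
  | coe n =>
    induction n with
    | top => exact absurd (WithBot.coe_le_coe.1 h3) (by simp)
    | coe n => exact ⟨n, by exact_mod_cast h3, rfl⟩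

variable [IsAdicComplete (maximalIdeal T) T]

/-- Evaluation of power series in two groups of variables. -/
noncomputable abbrev coordEval {A₀ : Type u} [CommRing A₀] (φ : A₀ →+* T) {a c : ℕ}
    {u : Fin a → T} {v : Fin c → T} (hu : ∀ i, u i ∈ maximalIdeal T)
    (hv : ∀ i, v i ∈ maximalIdeal T) : IterPS (IterPS A₀ a) c →+* T :=
  IterPS.eval (maximalIdeal T) (IterPS.eval (maximalIdeal T) φ (finExt u) (finExt_mem hu) a)
    (finExt v) (finExt_mem hv) c

section

variable {V : Type u} [CommRing V] [IsLocalRing V]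

/-- All the variables of an iterated power series ring. -/
noncomputable def pairVar (V : Type u) [CommRing V] (a c : ℕ) :
    Fin (a + c) → IterPS (IterPS V a) c :=
  Fin.append (fun i : Fin a => IterPS.const (IterPS V a) c (IterPS.var V a i))
    fun i : Fin c => IterPS.var (IterPS V a) c i

lemma span_range_append {B : Type*} [CommRing B] {a c : ℕ} (u : Fin a → B) (v : Fin c → B) :
    Ideal.span (Set.range (Fin.append u v)) =
      Ideal.span (Set.range u) ⊔ Ideal.span (Set.range v) := by
  rw [← Ideal.span_union]
  congr 1
  ext y
  constructor
  · rintro ⟨i, rfl⟩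
    induction i using Fin.addCases with
    | left i => exact Or.inl ⟨i, by simp⟩
    | right i => exact Or.inr ⟨i, by simp⟩
  · rintro (⟨i, rfl⟩ | ⟨i, rfl⟩)
    · exact ⟨Fin.castAdd c i, by simp⟩
    · exact ⟨Fin.natAdd a i, by simp⟩

lemma maximalIdeal_iterPS_iterPS {ϖ : V} (hϖ : maximalIdeal V = Ideal.span {ϖ}) (a c : ℕ) :
    maximalIdeal (IterPS (IterPS V a) c) =
      Ideal.span {IterPS.const (IterPS V a) c (IterPS.const V a ϖ)} ⊔
        Ideal.span (Set.range (pairVar V a c)) := by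
  have hr (A : Type u) [CommRing A] (n : ℕ) :
      IterPS.var A n '' Set.Iio n = Set.range fun i : Fin n => IterPS.var A n i := by
    ext x
    constructor
    · rintro ⟨i, hi, rfl⟩
      exact ⟨⟨i, hi⟩, rfl⟩
    · rintro ⟨i, rfl⟩
      exact ⟨i, i.2, rfl⟩
  rw [IterPS.maximalIdeal_eq, IterPS.maximalIdeal_eq, hϖ, pairVar, span_range_append, hr, hr,
    Ideal.map_span, Set.image_singleton, Ideal.map_sup, Ideal.map_span, Ideal.map_span,
    Set.image_singleton, ← Set.range_comp, sup_assoc]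
  rfl

omit [IsLocalRing V] in
lemma coordEval_pairVar (φ : V →+* T) {a c : ℕ} {u : Fin a → T} {v : Fin c → T}
    (hu : ∀ i, u i ∈ maximalIdeal T) (hv : ∀ i, v i ∈ maximalIdeal T) (i : Fin (a + c)) :
    coordEval φ hu hv (pairVar V a c i) = Fin.append u v i := by
  unfold pairVar
  induction i using Fin.addCases with
  | left i =>
    rw [Fin.append_left, Fin.append_left, IterPS.eval_const, IterPS.eval_var _ _ i.2]
    simp [finExt]
  | right i =>
    rw [Fin.append_right, Fin.append_right, IterPS.eval_var _ _ i.2]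
    simp [finExt]

theorem exists_ker_coordEval_eq_span [IsNoetherianRing T]
    [IsNoetherianRing V] [IsAdicComplete (maximalIdeal V) V] {ϖ : V}
    (hϖ : maximalIdeal V = Ideal.span {ϖ}) {φ : V →+* T} (hφϖ : φ ϖ ∈ maximalIdeal T)
    (hφ0 : φ ϖ ≠ 0) (hφ : ∀ t, ∃ α, t - φ α ∈ maximalIdeal T)
    {a c : ℕ} {u : Fin a → T} {v : Fin c → T}
    (hu : ∀ i, u i ∈ maximalIdeal T) (hv : ∀ i, v i ∈ maximalIdeal T)
    (huv : maximalIdeal T = Ideal.span (Set.range u) ⊔ Ideal.span (Set.range v))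
    (hd : ((a + c : ℕ) : WithBot ℕ∞) ≤ ringKrullDim T) :
    ∃ f, f ≠ 0 ∧ RingHom.ker (coordEval φ hu hv) = Ideal.span {f} := by
  have hsurj : Surjective (coordEval φ hu hv) := eval_surjective_of_span hφ hu hv huv
  have hmap : (Ideal.span (Set.range (pairVar V a c))).map (coordEval φ hu hv) =
      maximalIdeal T := by
    rw [huv, ← span_range_append, Ideal.map_span, ← Set.range_comp]
    congr 2
    exact funext fun i => coordEval_pairVar φ hu hv i
  obtain ⟨g, hg, hgϖ⟩ := (Ideal.mem_map_iff_of_surjective _ hsurj).1 (hmap.symm ▸ hφϖ)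
  have h0 : ∀ (n : ℕ) (i : Fin n), (fun _ => 0 : Fin n → V) i ∈ maximalIdeal V :=
    fun _ _ => zero_mem _
  have hg0 : coordEval (RingHom.id V) (h0 a) (h0 c) g = 0 := by
    refine (Ideal.span_le.2 ?_ : _ ≤ RingHom.ker (coordEval (RingHom.id V) (h0 a) (h0 c))) hg
    rintro _ ⟨i, rfl⟩
    refine (coordEval_pairVar (RingHom.id V) (h0 a) (h0 c) i).trans ?_
    induction i using Fin.addCases <;> simp
  set w := IterPS.const (IterPS V a) c (IterPS.const V a ϖ) with hw
  have hf0 : w - g ≠ 0 := by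
    intro h
    have := congrArg (coordEval (RingHom.id V) (h0 a) (h0 c)) h
    rw [map_sub, hg0, hw, IterPS.eval_const, IterPS.eval_const, map_zero, sub_zero,
      RingHom.id_apply] at this
    exact hφ0 (by rw [this, map_zero])
  refine ⟨w - g, hf0, ?_⟩
  have hfm : w - g ∈ maximalIdeal (IterPS (IterPS V a) c) := by
    rw [maximalIdeal_iterPS_iterPS hϖ]
    exact sub_mem (Ideal.mem_sup_left (Ideal.mem_span_singleton_self _)) (Ideal.mem_sup_right hg)
  have hm : maximalIdeal (IterPS (IterPS V a) c) = Ideal.span {w - g} ⊔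
      Ideal.span (Set.range (pairVar V a c)) := by
    apply le_antisymm
    · rw [maximalIdeal_iterPS_iterPS hϖ]
      refine sup_le ?_ le_sup_right
      rw [Ideal.span_singleton_le_iff_mem, ← hw]
      have := add_mem (Ideal.mem_sup_left (Ideal.mem_span_singleton_self (w - g)))
        (Ideal.mem_sup_right (S := Ideal.span {w - g}) hg)
      rwa [sub_add_cancel] at this
    · refine sup_le (by rwa [Ideal.span_singleton_le_iff_mem]) ?_
      rw [maximalIdeal_iterPS_iterPS hϖ]
      exact le_sup_right
  have hfker : Ideal.span {w - g} ≤ RingHom.ker (coordEval φ hu hv) := by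
    rw [Ideal.span_singleton_le_iff_mem, RingHom.mem_ker, map_sub, hgϖ, hw, IterPS.eval_const,
      IterPS.eval_const, sub_self]
  have hne : Ideal.span {w - g} ≠ ⊤ := fun h => RingHom.ker_ne_top (coordEval φ hu hv)
    (top_le_iff.1 (h ▸ hfker))
  have hT : ringKrullDim (IterPS (IterPS V a) c ⧸ RingHom.ker (coordEval φ hu hv)) =
      ringKrullDim T := ringKrullDim_eq_of_ringEquiv (RingHom.quotientKerEquivOfSurjective hsurj)
  have hl := isLocalRing_quotient hne
  have hmq := maximalIdeal_quotient_eq_span hm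
  have hdom := isDomain_of_regular _ _ _ hmq
    (hd.trans (hT ▸ ringKrullDim_quotient_anti hfker))
  have hprime : (Ideal.span {w - g}).IsPrime := (Ideal.Quotient.isDomain_iff_prime _).1 hdom
  refine le_antisymm (fun z hz => ?_) hfker
  by_contra hzf
  have h1 := ringKrullDim_quotient_sup_span_singleton_add_one_le hzf
  obtain ⟨n, hn, hn'⟩ := exists_ringKrullDim_quotient_eq_nat hmq (I := ⊥) bot_ne_top
  rw [ringKrullDim_eq_of_ringEquiv (RingEquiv.quotientBot _)] at hn'
  have h2 := hd.trans (hT ▸ ringKrullDim_quotient_anti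
    (sup_le hfker ((Ideal.span_singleton_le_iff_mem _).2 hz)))
  have h3 := (add_le_add_left h2 1).trans (h1.trans hn'.le)
  have : a + c + 1 ≤ n := by exact_mod_cast h3
  omega

end

end Cases

section Cases

open IsLocalRing Function

variable {T : Type u} [CommRing T] [IsLocalRing T] [IsAdicComplete (maximalIdeal T) T]
  [IsNoetherianRing T]

/-- The dimension inequality over a complete local ring containing a coefficient field. -/
theorem add_le_of_coefficientField {K : Type u} [Field K] {φ : K →+* T}
    (hφ : ∀ t, ∃ α, t - φ α ∈ maximalIdeal T) {d : ℕ} {x : Fin d → T}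
    (hx : maximalIdeal T = Ideal.span (Set.range x)) {P Q : Ideal T}
    (hprim : maximalIdeal T ≤ (P ⊔ Q).radical) {a b : ℕ}
    (ha : ringKrullDim (T ⧸ P) = (a : ℕ)) (hb : (b : WithBot ℕ∞) ≤ ringKrullDim (T ⧸ Q)) :
    a + b ≤ d := by
  have hP : P ≠ ⊤ := by
    rintro rfl
    rw [ringKrullDim_eq_bot_of_subsingleton] at ha
    simp at ha
  obtain ⟨a', had, ha'⟩ := exists_ringKrullDim_quotient_eq_nat hx hP
  obtain rfl : a = a' := by exact_mod_cast ha.symm.trans ha'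
  obtain ⟨c, rfl⟩ := Nat.exists_eq_add_of_le had
  obtain ⟨u, v, huv, h1, -⟩ := exists_coordinates P P a c 0 0 x hx (by rw [ha, zero_add])
    (by rw [ha, zero_add])
  have hK : maximalIdeal K = ⊥ := maximalIdeal_eq_bot
  have : IsAdicComplete (maximalIdeal K) K := hK ▸ inferInstance
  have := le_of_coordinates (ϖ := (0 : K)) (by rw [hK, Ideal.span_singleton_zero])
    (by rw [map_zero]; exact zero_mem _) hφ (Or.inl ⟨rfl, rfl⟩) huv hprim
    (by rw [map_zero, Ideal.span_singleton_zero, bot_sup_eq]; exact_mod_cast h1) ha.ge hb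
  omega

variable {V : Type u} [CommRing V] [IsLocalRing V] [IsDomain V] [IsNoetherianRing V]
  [IsAdicComplete (maximalIdeal V) V]

lemma exists_residueField_quotient {T V : Type u} [CommRing T] [IsLocalRing T] [CommRing V]
    [IsLocalRing V] {ϖ : V} (hϖ : maximalIdeal V = Ideal.span {ϖ}) {φ : V →+* T}
    (hφ : ∀ t, ∃ α, t - φ α ∈ maximalIdeal T) [IsLocalRing (T ⧸ Ideal.span {φ ϖ})] :
    ∃ ψ : ResidueField V →+* T ⧸ Ideal.span {φ ϖ},
      ψ.comp (residue V) = (Ideal.Quotient.mk (Ideal.span {φ ϖ})).comp φ ∧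
      ∀ t, ∃ α, t - ψ α ∈ maximalIdeal (T ⧸ Ideal.span {φ ϖ}) := by
  obtain ⟨ψ, hψ⟩ : ∃ ψ : ResidueField V →+* T ⧸ Ideal.span {φ ϖ},
      ψ.comp (residue V) = (Ideal.Quotient.mk (Ideal.span {φ ϖ})).comp φ :=
    ⟨_, RingHom.liftOfSurjective_comp (residue V) residue_surjective ⟨(Ideal.Quotient.mk (Ideal.span {φ ϖ})).comp φ, by
      rw [ker_residue, hϖ, Ideal.span_singleton_le_iff_mem, RingHom.mem_ker]
      exact Ideal.Quotient.eq_zero_iff_mem.2 (Ideal.mem_span_singleton_self _)⟩⟩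
  refine ⟨ψ, hψ, fun t => ?_⟩
  obtain ⟨t, rfl⟩ := Ideal.Quotient.mk_surjective t
  obtain ⟨α, hα⟩ := hφ t
  refine ⟨residue V α, ?_⟩
  have h := RingHom.congr_fun hψ α
  rw [RingHom.comp_apply, RingHom.comp_apply] at h
  rw [h, ← map_sub]
  exact algebraMap_mem_maximalIdeal_of_surjective (B := T ⧸ Ideal.span {φ ϖ})
    Ideal.Quotient.mk_surjective _ hα

/-- The dimension inequality for primes avoiding the uniformizer of a coefficient ring. -/
theorem add_le_of_notMem {ϖ : V} (hϖ : maximalIdeal V = Ideal.span {ϖ}) {φ : V →+* T}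
    (hφϖ : φ ϖ ∈ maximalIdeal T) (hφ : ∀ t, ∃ α, t - φ α ∈ maximalIdeal T)
    {d : ℕ} {x : Fin d → T} (hx : maximalIdeal T = Ideal.span (Set.range x))
    (hd : (d : WithBot ℕ∞) ≤ ringKrullDim T) {P Q : Ideal T} [P.IsPrime] [Q.IsPrime]
    (hprim : maximalIdeal T ≤ (P ⊔ Q).radical) (hP : φ ϖ ∉ P) (hQ : φ ϖ ∉ Q) {a b : ℕ}
    (ha : ringKrullDim (T ⧸ P) = (a : ℕ)) (hb : ringKrullDim (T ⧸ Q) = (b : ℕ)) (hab : a ≤ b) :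
    a + b ≤ d := by
  obtain ⟨a', had, ha'⟩ := exists_ringKrullDim_quotient_eq_nat hx (Ideal.IsPrime.ne_top ‹P.IsPrime›)
  obtain rfl : a = a' := by exact_mod_cast ha.symm.trans ha'
  have hJ (I : Ideal T) [I.IsPrime] (hI : φ ϖ ∉ I) (n : ℕ) (hn : ringKrullDim (T ⧸ I) = (n : ℕ)) :
      1 ≤ n ∧ ringKrullDim (T ⧸ I ⊔ Ideal.span {φ ϖ}) ≤ ((n - 1 : ℕ) : WithBot ℕ∞) := by
    have hne : I ⊔ Ideal.span {φ ϖ} ≠ ⊤ := fun h => (maximalIdeal.isMaximal T).ne_top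
      (top_le_iff.1 (h ▸ sup_le (le_maximalIdeal (Ideal.IsPrime.ne_top ‹I.IsPrime›))
        ((Ideal.span_singleton_le_iff_mem _).2 hφϖ)))
    obtain ⟨j, -, hj⟩ := exists_ringKrullDim_quotient_eq_nat hx hne
    have h1 := ringKrullDim_quotient_sup_span_singleton_add_one_le hI
    rw [hn, hj] at h1
    have : j + 1 ≤ n := by exact_mod_cast h1
    rw [hj]
    exact ⟨by omega, by exact_mod_cast (by omega : j ≤ n - 1)⟩
  obtain ⟨ha1, haJ⟩ := hJ P hP a ha
  obtain ⟨hb1, hbJ⟩ := hJ Q hQ b hb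
  obtain ⟨k, rfl⟩ : ∃ k, a = k + 1 := ⟨a - 1, by omega⟩
  obtain ⟨c, rfl⟩ : ∃ c, d = k + c := ⟨d - k, by omega⟩
  obtain ⟨u, v, huv, h1, h2⟩ := exists_coordinates (P ⊔ Ideal.span {φ ϖ}) (Q ⊔ Ideal.span {φ ϖ})
    k c 0 (b - (k + 1)) x hx (by rwa [zero_add])
    (by rwa [(by omega : b - (k + 1) + k = b - 1)])
  rw [sup_assoc] at h1 h2
  have hu : ∀ i, u i ∈ maximalIdeal T := fun i =>
    huv ▸ Ideal.mem_sup_left (Ideal.subset_span ⟨i, rfl⟩)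
  have hv : ∀ i, v i ∈ maximalIdeal T := fun i =>
    huv ▸ Ideal.mem_sup_right (Ideal.subset_span ⟨i, rfl⟩)
  have hle := le_of_coordinates hϖ hφϖ hφ (Or.inr rfl) huv hprim (by exact_mod_cast h1) ha.ge hb.ge
  by_contra hlt
  obtain rfl : b = c := by omega
  obtain ⟨f, hf, hker⟩ := exists_ker_coordEval_eq_span hϖ hφϖ
    (fun h => hP (h ▸ zero_mem _)) hφ hu hv huv hd
  exact not_le_ringKrullDim_of_coordinates hϖ hφϖ hφ (Or.inr rfl) hu hv huv hprim
    (by exact_mod_cast h1) ha.ge h2 (by omega) hf hker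
    (Or.inl (hasFiniteResolution_of_regular hx hd (Ideal.IsPrime.ne_top ‹P.IsPrime›))) hb.ge

/-- A strict dimension inequality for ideals containing the uniformizer of a coefficient ring, one
of which is of finite projective dimension modulo the uniformizer. -/
theorem add_lt_of_mem [IsDomain T] {ϖ : V} (hϖ : maximalIdeal V = Ideal.span {ϖ}) {φ : V →+* T}
    (hφϖ : φ ϖ ∈ maximalIdeal T) (hφ0 : φ ϖ ≠ 0) (hφ : ∀ t, ∃ α, t - φ α ∈ maximalIdeal T)
    {d : ℕ} {x : Fin d → T} (hx : maximalIdeal T = Ideal.span (Set.range x))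
    (hd : (d : WithBot ℕ∞) ≤ ringKrullDim T) {P Q : Ideal T}
    (hprim : maximalIdeal T ≤ (P ⊔ Q).radical) (hP : φ ϖ ∈ P) (hQ : φ ϖ ∈ Q) {a b : ℕ}
    (ha : ringKrullDim (T ⧸ P) = (a : ℕ)) (hb : ringKrullDim (T ⧸ Q) = (b : ℕ)) (hab : a ≤ b)
    (hres : HasFiniteResolution (P.map (Ideal.Quotient.mk (Ideal.span {φ ϖ}))) ∨
      HasFiniteResolution (Q.map (Ideal.Quotient.mk (Ideal.span {φ ϖ})))) :
    a + b < d := by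
  have hne : P ≠ ⊤ := by
    rintro rfl
    rw [ringKrullDim_eq_bot_of_subsingleton] at ha
    simp at ha
  obtain ⟨a', had, ha'⟩ := exists_ringKrullDim_quotient_eq_nat hx hne
  obtain rfl : a = a' := by exact_mod_cast ha.symm.trans ha'
  obtain ⟨c, rfl⟩ := Nat.exists_eq_add_of_le had
  obtain ⟨u, v, huv, h1, h2⟩ := exists_coordinates P Q a c 0 (b - a) x hx (by rw [ha, zero_add])
    (by rw [hb, Nat.sub_add_cancel hab])
  have hu : ∀ i, u i ∈ maximalIdeal T := fun i =>
    huv ▸ Ideal.mem_sup_left (Ideal.subset_span ⟨i, rfl⟩)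
  have hv : ∀ i, v i ∈ maximalIdeal T := fun i =>
    huv ▸ Ideal.mem_sup_right (Ideal.subset_span ⟨i, rfl⟩)
  obtain ⟨f, hf, hker⟩ := exists_ker_coordEval_eq_span hϖ hφϖ hφ0 hφ hu hv huv hd
  set I : Ideal T := Ideal.span {φ ϖ} with hI
  set q : T →+* T ⧸ I := Ideal.Quotient.mk I with hq'
  have hItop : I ≠ ⊤ := fun h => (maximalIdeal.isMaximal T).ne_top
      (top_le_iff.1 (h ▸ (Ideal.span_singleton_le_iff_mem _).2 hφϖ))
  have := isLocalRing_quotient hItop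
  have hq : Surjective q := Ideal.Quotient.mk_surjective
  have := isAdicComplete_of_surjective hq
  have hmem : ∀ t ∈ maximalIdeal T, q t ∈ maximalIdeal (T ⧸ I) :=
    algebraMap_mem_maximalIdeal_of_surjective (B := T ⧸ I) hq
  have hmT : (maximalIdeal T).map q = maximalIdeal (T ⧸ I) := by
    rw [← comap_maximalIdeal_of_surjective hq, Ideal.map_comap_of_surjective _ hq]
  have hϖm : ϖ ∈ maximalIdeal V := hϖ ▸ Ideal.mem_span_singleton_self ϖ
  -- the coefficient field of the quotient
  let χ : V →+* ResidueField V := residue V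
  have hχ : Surjective χ := residue_surjective
  have hχker : RingHom.ker χ = Ideal.span {ϖ} := ker_residue.trans hϖ
  have hχϖ : χ ϖ = 0 := (residue_eq_zero_iff ϖ).2 hϖm
  obtain ⟨ψ, hψ, hψ'⟩ := exists_residueField_quotient hϖ hφ
  have hK : maximalIdeal (ResidueField V) = ⊥ := maximalIdeal_eq_bot
  have : IsAdicComplete (maximalIdeal (ResidueField V)) (ResidueField V) := hK ▸ inferInstance
  have hqu : ∀ i, q (u i) ∈ maximalIdeal (T ⧸ I) := fun i => hmem _ (hu i)
  have hqv : ∀ i, q (v i) ∈ maximalIdeal (T ⧸ I) := fun i => hmem _ (hv i)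
  have hquv : maximalIdeal (T ⧸ I) = Ideal.span (Set.range fun i => q (u i)) ⊔
      Ideal.span (Set.range fun i => q (v i)) := by
    rw [← hmT, huv, Ideal.map_sup, Ideal.map_span, Ideal.map_span, ← Set.range_comp,
      ← Set.range_comp]
    rfl
  have hquot (J : Ideal T) (hJ : I ≤ J) :
      ringKrullDim ((T ⧸ I) ⧸ J.map q) = ringKrullDim (T ⧸ J) := by
    rw [← ringKrullDim_quotient_comap_of_surjective hq, Ideal.comap_map_of_surjective' q hq,
      Ideal.mk_ker, sup_eq_left.2 hJ]
  have hIP : I ≤ P := (Ideal.span_singleton_le_iff_mem _).2 hP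
  have hIQ : I ≤ Q := (Ideal.span_singleton_le_iff_mem _).2 hQ
  have hsup (J : Ideal T) : J.map q ⊔ (Ideal.span {ψ 0} ⊔ Ideal.span (Set.range fun i => q (u i)))
      = (J ⊔ Ideal.span (Set.range u)).map q := by
    rw [map_zero, Ideal.span_singleton_zero, bot_sup_eq, Ideal.map_sup, Ideal.map_span _ (Set.range u),
      ← Set.range_comp]
    rfl
  have h1' : ringKrullDim ((T ⧸ I) ⧸ P.map q ⊔ (Ideal.span {ψ 0} ⊔
      Ideal.span (Set.range fun i => q (u i)))) ≤ 0 := by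
    rw [hsup, hquot _ (hIP.trans le_sup_left)]
    exact_mod_cast h1
  have h2' : ringKrullDim ((T ⧸ I) ⧸ Q.map q ⊔ (Ideal.span {ψ 0} ⊔
      Ideal.span (Set.range fun i => q (u i)))) ≤ (b - a : ℕ) := by
    rw [hsup, hquot _ (hIQ.trans le_sup_left)]
    exact_mod_cast h2
  have hprim' : maximalIdeal (T ⧸ I) ≤ (P.map q ⊔ Q.map q).radical := by
    rw [← hmT, ← Ideal.map_sup]
    exact (Ideal.map_mono hprim).trans (Ideal.map_radical_le q)
  have hP' := (hquot P hIP).trans ha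
  have hQ' := (hquot Q hIQ).trans hb
  have h0 : maximalIdeal (ResidueField V) = Ideal.span {0} := by
    rw [hK, Ideal.span_singleton_zero]
  have hψ0 : ψ 0 ∈ maximalIdeal (T ⧸ I) := by rw [map_zero]; exact zero_mem _
  have hle := le_of_coordinates h0 hψ0 hψ' (Or.inl ⟨rfl, rfl⟩) hquv hprim' h1' hP'.ge hQ'.ge
  by_contra hlt
  obtain rfl : b = c := by omega
  -- the presentation of the quotient
  let χ₂ := IterPS.map (IterPS.map χ a) b
  have hχ₂ : Surjective χ₂ := IterPS.map_surjective (IterPS.map_surjective hχ a) b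
  let w := IterPS.const (IterPS V a) b (IterPS.const V a ϖ)
  have hχ₂ker : RingHom.ker χ₂ = Ideal.span {w} := by
    rw [IterPS.ker_map, IterPS.ker_map, hχker, Ideal.map_span, Set.image_singleton, Ideal.map_span,
      Set.image_singleton]
  have hcomm (s : IterPS (IterPS V a) b) :
      coordEval ψ hqu hqv (χ₂ s) = q (coordEval φ hu hv s) := by
    have e1 : (IterPS.eval (maximalIdeal (T ⧸ I)) ψ (finExt fun i => q (u i)) (finExt_mem hqu) a).comp
        (IterPS.map χ a) =
        q.comp (IterPS.eval (maximalIdeal T) φ (finExt u) (finExt_mem hu) a) := by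
      ext s
      rw [RingHom.comp_apply, RingHom.comp_apply, IterPS.eval_map, hψ,
        IterPS.map_eval φ _ q (fun x hx => Ideal.mem_comap.2 (hmem x hx))]
      congr 1
      simp_rw [map_finExt]
      rfl
    rw [IterPS.eval_map, e1, IterPS.map_eval _ _ q (fun x hx => Ideal.mem_comap.2 (hmem x hx))]
    congr 1
    simp_rw [map_finExt]
    rfl
  have hw : coordEval φ hu hv w = φ ϖ := by
    rw [IterPS.eval_const, IterPS.eval_const]
  have hπ : Surjective (coordEval φ hu hv) := eval_surjective_of_span hφ hu hv huv
  have hker' : RingHom.ker (coordEval ψ hqu hqv) = Ideal.span {χ₂ f} := by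
    ext s
    obtain ⟨s, rfl⟩ := hχ₂ s
    rw [RingHom.mem_ker, hcomm]
    constructor
    · intro hs
      obtain ⟨t, ht⟩ := Ideal.mem_span_singleton'.1 (Ideal.Quotient.eq_zero_iff_mem.1 hs)
      obtain ⟨h, rfl⟩ := hπ t
      have h3 : s - h * w ∈ RingHom.ker (coordEval φ hu hv) := by
        rw [RingHom.mem_ker, map_sub, map_mul, hw, ht, sub_self]
      rw [hker] at h3
      have h4 := Ideal.mem_map_of_mem χ₂ h3
      have hw0 : χ₂ w = 0 := by
        rw [← RingHom.mem_ker, hχ₂ker]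
        exact Ideal.mem_span_singleton_self w
      rwa [Ideal.map_span, Set.image_singleton, map_sub, map_mul, hw0, mul_zero, sub_zero] at h4
    · intro hs
      obtain ⟨t, ht⟩ := Ideal.mem_span_singleton'.1 hs
      have h5 : coordEval φ hu hv f = 0 := by
        rw [← RingHom.mem_ker, hker]
        exact Ideal.mem_span_singleton_self f
      rw [← hcomm, ← ht, map_mul, hcomm, h5, map_zero, mul_zero]
  have hf' : χ₂ f ≠ 0 := by
    intro h
    rw [← RingHom.mem_ker, hχ₂ker] at h
    obtain ⟨g, hg⟩ := Ideal.mem_span_singleton'.1 h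
    have h5 : coordEval φ hu hv f = 0 := by
      rw [← RingHom.mem_ker, hker]
      exact Ideal.mem_span_singleton_self f
    have h6 : g ∈ RingHom.ker (coordEval φ hu hv) := by
      rw [← hg, map_mul, hw] at h5
      exact (mul_eq_zero.1 h5).resolve_right hφ0
    rw [hker] at h6
    obtain ⟨k, hk⟩ := Ideal.mem_span_singleton'.1 h6
    have h7 : k * w = 1 := mul_right_cancel₀ hf (by rw [one_mul, mul_right_comm, hk, hg])
    have h8 := congrArg (coordEval φ hu hv) h7
    rw [map_mul, hw, map_one] at h8
    exact (maximalIdeal.isMaximal T).ne_top ((Ideal.eq_top_iff_one _).2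
      (h8 ▸ Ideal.mul_mem_left _ _ hφϖ))
  exact not_le_ringKrullDim_of_coordinates h0 hψ0 hψ' (Or.inl ⟨rfl, rfl⟩) hqu hqv hquv hprim'
    h1' hP'.ge h2' (by omega) hf' hker' hres hQ'.ge

/-- The dimension inequality over a complete regular local ring with a coefficient ring. -/
theorem add_le_of_coefficientRing {ϖ : V} (hϖ : maximalIdeal V = Ideal.span {ϖ}) {φ : V →+* T}
    (hφϖ : φ ϖ ∈ maximalIdeal T) (hφ : ∀ t, ∃ α, t - φ α ∈ maximalIdeal T)
    {d : ℕ} {x : Fin d → T} (hx : maximalIdeal T = Ideal.span (Set.range x))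
    (hd : (d : WithBot ℕ∞) ≤ ringKrullDim T) {P Q : Ideal T} [P.IsPrime] [Q.IsPrime]
    (hprim : maximalIdeal T ≤ (P ⊔ Q).radical) {a b : ℕ}
    (ha : ringKrullDim (T ⧸ P) = (a : ℕ)) (hb : ringKrullDim (T ⧸ Q) = (b : ℕ)) :
    a + b ≤ d := by
  have hdom := isDomain_of_regular d T x hx hd
  have hItop : Ideal.span {φ ϖ} ≠ ⊤ := fun h => (maximalIdeal.isMaximal T).ne_top
      (top_le_iff.1 (h ▸ (Ideal.span_singleton_le_iff_mem _).2 hφϖ))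
  -- one of the primes contains the uniformizer
  have hmixed (P Q : Ideal T) [P.IsPrime] [Q.IsPrime]
      (hprim : maximalIdeal T ≤ (P ⊔ Q).radical) (a b : ℕ)
      (ha : ringKrullDim (T ⧸ P) = (a : ℕ)) (hb : ringKrullDim (T ⧸ Q) = (b : ℕ))
      (hP : φ ϖ ∈ P) (hQ : φ ϖ ∉ Q) : a + b ≤ d := by
    have hJ : Q ⊔ Ideal.span {φ ϖ} ≠ ⊤ := fun h => (maximalIdeal.isMaximal T).ne_top
      (top_le_iff.1 (h ▸ sup_le (le_maximalIdeal (Ideal.IsPrime.ne_top ‹Q.IsPrime›))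
        ((Ideal.span_singleton_le_iff_mem _).2 hφϖ)))
    obtain ⟨b', -, hb'⟩ := exists_ringKrullDim_quotient_eq_nat hx hJ
    have hbb : b ≤ b' + 1 := by
      have := ringKrullDim_quotient_le_sup_span_singleton Q hφϖ
      rw [hb, hb'] at this
      exact_mod_cast this
    have hφ0 : φ ϖ ≠ 0 := fun h => hQ (h ▸ zero_mem _)
    have hmem : φ ϖ ∈ Q ⊔ Ideal.span {φ ϖ} :=
      Ideal.mem_sup_right (Ideal.mem_span_singleton_self _)
    have hres : HasFiniteResolution
        ((Q ⊔ Ideal.span {φ ϖ}).map (Ideal.Quotient.mk (Ideal.span {φ ϖ}))) := by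
      rw [Ideal.map_sup, Ideal.map_quotient_self, sup_bot_eq]
      refine (hasFiniteResolution_of_regular hx hd (Ideal.IsPrime.ne_top ‹Q.IsPrime›)).map_mk
        (fun y hy => (mul_eq_zero.1 hy).resolve_left hφ0)
        (fun y hy => (Ideal.IsPrime.mem_or_mem ‹Q.IsPrime› hy).resolve_left hQ)
    have hprim' : maximalIdeal T ≤ (P ⊔ (Q ⊔ Ideal.span {φ ϖ})).radical :=
      hprim.trans (Ideal.radical_mono (sup_le_sup_left le_sup_left _))
    rcases le_total a b' with h | h
    · have := add_lt_of_mem hϖ hφϖ hφ0 hφ hx hd hprim' hP hmem ha hb' h (Or.inr hres)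
      omega
    · have := add_lt_of_mem hϖ hφϖ hφ0 hφ hx hd (by rwa [sup_comm]) hmem hP hb' ha h (Or.inl hres)
      omega
  by_cases hP : φ ϖ ∈ P <;> by_cases hQ : φ ϖ ∈ Q
  · have := isLocalRing_quotient hItop
    have hq : Surjective (Ideal.Quotient.mk (Ideal.span {φ ϖ})) := Ideal.Quotient.mk_surjective
    have := isAdicComplete_of_surjective hq
    obtain ⟨ψ, -, hψ⟩ := exists_residueField_quotient hϖ hφ
    have hmT : (maximalIdeal T).map (Ideal.Quotient.mk (Ideal.span {φ ϖ})) =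
        maximalIdeal (T ⧸ Ideal.span {φ ϖ}) := by
      rw [← comap_maximalIdeal_of_surjective hq, Ideal.map_comap_of_surjective _ hq]
    have hquot (J : Ideal T) (hJ : φ ϖ ∈ J) : ringKrullDim ((T ⧸ Ideal.span {φ ϖ}) ⧸
        J.map (Ideal.Quotient.mk (Ideal.span {φ ϖ}))) = ringKrullDim (T ⧸ J) := by
      rw [← ringKrullDim_quotient_comap_of_surjective hq, Ideal.comap_map_of_surjective' _ hq,
        Ideal.mk_ker, sup_eq_left.2 ((Ideal.span_singleton_le_iff_mem _).2 hJ)]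
    refine add_le_of_coefficientField hψ (x := fun i => Ideal.Quotient.mk _ (x i)) ?_
      (P := P.map (Ideal.Quotient.mk (Ideal.span {φ ϖ})))
      (Q := Q.map (Ideal.Quotient.mk (Ideal.span {φ ϖ}))) ?_ ((hquot P hP).trans ha)
      ((hquot Q hQ).trans hb).ge
    · rw [← hmT, hx, Ideal.map_span, ← Set.range_comp]
      rfl
    · rw [← hmT, ← Ideal.map_sup]
      exact (Ideal.map_mono hprim).trans (Ideal.map_radical_le _)
  · exact hmixed P Q hprim a b ha hb hP hQ
  · rw [add_comm]
    exact hmixed Q P (by rwa [sup_comm]) b a hb ha hQ hP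
  · rcases le_total a b with h | h
    · exact add_le_of_notMem hϖ hφϖ hφ hx hd hprim hP hQ ha hb h
    · rw [add_comm]
      exact add_le_of_notMem hϖ hφϖ hφ hx hd (by rwa [sup_comm]) hQ hP hb ha h

end Cases

section IntegralExtension

open IsLocalRing

variable {R C : Type u} [CommRing R] [CommRing C] [IsLocalRing R] [IsNoetherianRing R]
  [IsLocalRing C] [Algebra R C] [Algebra.IsIntegral R C]

/-- A dimension bound from a system of parameters in an integral local extension. -/
lemma ringKrullDim_quotient_le_of_pow_le (hinj : Function.Injective (algebraMap R C)) {P : Ideal R}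
    [P.IsPrime] {e N : ℕ} {y : Fin e → C} (hy : ∀ i, y i ∈ maximalIdeal C)
    (hN : ((maximalIdeal R) ^ N).map (algebraMap R C) ≤
      P.map (algebraMap R C) ⊔ Ideal.span (Set.range y)) :
    ringKrullDim (R ⧸ P) ≤ (e : ℕ) := by
  obtain ⟨k, p, hp⟩ := Submodule.fg_iff_exists_fin_generating_family.1
    (IsNoetherian.noetherian P)
  obtain ⟨s, z, hz⟩ := Submodule.fg_iff_exists_fin_generating_family.1
    (IsNoetherian.noetherian (maximalIdeal R ^ N))
  have hz' : ∀ i, ∃ c : Fin (k + e) → C, ∑ j, c j * Fin.append (fun i => algebraMap R C (p i)) y j =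
      algebraMap R C (z i) := fun i => by
    refine Ideal.mem_span_range_iff_exists_fun.1 ?_
    rw [span_range_append]
    have h1 : Ideal.span (Set.range fun i => algebraMap R C (p i)) = P.map (algebraMap R C) := by
      have : P = Ideal.span (Set.range p) := hp.symm
      rw [this, Ideal.map_span, ← Set.range_comp]
      rfl
    rw [h1]
    refine hN (Ideal.mem_map_of_mem _ ?_)
    rw [← hz]
    exact Submodule.subset_span ⟨i, rfl⟩
  choose c hc using hz'
  let F : Set C := Set.range y ∪ Set.range fun ij : Fin s × Fin (k + e) => c ij.1 ij.2
  have hF : F.Finite := (Set.finite_range _).union (Set.finite_range _)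
  let D : Subalgebra R C := Algebra.adjoin R F
  have hDfin : Module.Finite R D := Algebra.finite_adjoin_of_finite_of_isIntegral hF
    fun x _ => Algebra.IsIntegral.isIntegral x
  have hDnoeth : IsNoetherianRing D := IsNoetherianRing.of_finite R D
  have hCD : Algebra.IsIntegral D C := Algebra.IsIntegral.tower_top R
  have hDloc : IsLocalRing D := RingHom.domain_isLocalRing (algebraMap D C)
  have hRD : Function.Injective (algebraMap R D) := fun a b h =>
    hinj (congrArg (algebraMap D C) h)
  let y' : Fin e → D := fun i => ⟨y i, Algebra.subset_adjoin (Or.inl ⟨i, rfl⟩)⟩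
  let c' : Fin s → Fin (k + e) → D := fun i j =>
    ⟨c i j, Algebra.subset_adjoin (Or.inr ⟨(i, j), rfl⟩)⟩
  have hy' : ∀ i, y' i ∈ maximalIdeal D := fun i => by
    rw [mem_maximalIdeal, mem_nonunits_iff]
    intro h
    exact (mem_nonunits_iff.1 ((mem_maximalIdeal _).1 (hy i))) (h.map (algebraMap D C))
  set J := P.map (algebraMap R D) ⊔ Ideal.span (Set.range y') with hJ
  have hNJ : (maximalIdeal R ^ N).map (algebraMap R D) ≤ J := by
    have : maximalIdeal R ^ N = Ideal.span (Set.range z) := hz.symm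
    rw [this, Ideal.map_span, Ideal.span_le]
    rintro _ ⟨_, ⟨i, rfl⟩, rfl⟩
    have h : algebraMap R D (z i) =
        ∑ j, c' i j * Fin.append (fun i => algebraMap R D (p i)) y' j := by
      apply Subtype.ext
      rw [AddSubmonoidClass.coe_finsetSum]
      refine (hc i).symm.trans (Finset.sum_congr rfl fun j _ => ?_)
      refine congrArg (c i j * ·) ?_
      induction j using Fin.addCases with
      | left j => simp
      | right j => simp [y']
    rw [SetLike.mem_coe, h]
    refine sum_mem fun j _ => Ideal.mul_mem_left _ _ ?_
    induction j using Fin.addCases with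
    | left j =>
      rw [Fin.append_left]
      refine Ideal.mem_sup_left (Ideal.mem_map_of_mem _ ?_)
      rw [← hp]
      exact Submodule.subset_span ⟨j, rfl⟩
    | right j =>
      rw [Fin.append_right]
      exact Ideal.mem_sup_right (Ideal.subset_span ⟨j, rfl⟩)
  have hrad : maximalIdeal D ≤ J.radical := by
    rw [Ideal.radical_eq_sInf]
    refine le_sInf fun 𝔮 h𝔮 => ?_
    have := h𝔮.2
    have h1 : maximalIdeal R ^ N ≤ 𝔮.comap (algebraMap R D) :=
      Ideal.map_le_iff_le_comap.1 (hNJ.trans h𝔮.1)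
    have h2 : maximalIdeal R ≤ 𝔮.comap (algebraMap R D) :=
      fun x hx => Ideal.IsPrime.mem_of_pow_mem inferInstance N (h1 (Ideal.pow_mem_pow hx N))
    have h3 : (𝔮.comap (algebraMap R D)).IsMaximal := by
      rw [← (maximalIdeal.isMaximal R).eq_of_le (Ideal.IsPrime.ne_top inferInstance) h2]
      infer_instance
    have h4 := Ideal.isMaximal_of_isIntegral_of_isMaximal_comap 𝔮 h3
    exact (eq_maximalIdeal h4).ge
  obtain ⟨𝔓, -, h𝔓, h𝔓P⟩ := Ideal.exists_ideal_over_prime_of_isIntegral (S := D) P ⊥ (by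
    rw [← RingHom.ker_eq_comap_bot, (RingHom.injective_iff_ker_eq_bot _).1 hRD]
    exact bot_le)
  have hintegral : (algebraMap R D).IsIntegral := fun x => Algebra.IsIntegral.isIntegral x
  have h5 := hintegral.ringKrullDim_quotient 𝔓
  rw [h𝔓P] at h5
  rw [← h5]
  refine (ringKrullDim_quotient_anti (Ideal.map_le_iff_le_comap.2 h𝔓P.ge)).trans ?_
  refine (ringKrullDim_quotient_le_sup_span_range hy').trans ?_
  refine (add_le_add_left (ringKrullDim_quotient_le_zero hrad) _).trans ?_
  rw [zero_add]

variable {T : Type u} [CommRing T] [IsLocalRing T] [IsNoetherianRing T]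

/-- Passing to the completion of an integral local extension with the same maximal ideal does not
decrease dimensions. -/
theorem ringKrullDim_quotient_le_map (hinj : Function.Injective (algebraMap R C))
    (hm : (maximalIdeal R).map (algebraMap R C) = maximalIdeal C) {g : C →+* T}
    (hg : (maximalIdeal C).map g = maximalIdeal T)
    (hdense : ∀ t n, ∃ c, t - g c ∈ maximalIdeal T ^ n)
    (hcomap : ∀ n c, g c ∈ maximalIdeal T ^ n → c ∈ maximalIdeal C ^ n) {P : Ideal R}
    [P.IsPrime] :
    ringKrullDim (R ⧸ P) ≤ ringKrullDim (T ⧸ P.map (g.comp (algebraMap R C))) := by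
  obtain ⟨d, x, hx⟩ := Submodule.fg_iff_exists_fin_generating_family.1
    (IsNoetherian.noetherian (maximalIdeal T))
  have hPm : P.map (g.comp (algebraMap R C)) ≤ maximalIdeal T := by
    rw [← hg, ← hm, Ideal.map_map]
    exact Ideal.map_mono (le_maximalIdeal (Ideal.IsPrime.ne_top ‹_›))
  set PT := P.map (g.comp (algebraMap R C)) with hPT
  obtain ⟨e, hed, he⟩ := exists_ringKrullDim_quotient_eq_nat (x := x) hx.symm (I := PT)
    (fun h => (maximalIdeal.isMaximal T).ne_top (top_le_iff.1 (h ▸ hPm)))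
  obtain ⟨l, rfl⟩ := Nat.exists_eq_add_of_le hed
  obtain ⟨u, v, huv, h1, -⟩ := exists_coordinates PT PT e l 0 0 x hx.symm (by rw [he, zero_add])
    (by rw [he, zero_add])
  obtain ⟨N, hN⟩ := Ideal.exists_pow_le_of_le_radical_of_fg
    (maximalIdeal_le_radical_of_ringKrullDim_le_zero (by exact_mod_cast h1))
    (IsNoetherian.noetherian (maximalIdeal T))
  choose y hy using fun i => hdense (u i) (N + 1)
  have hu : ∀ i, u i ∈ maximalIdeal T := fun i =>
    huv ▸ Ideal.mem_sup_left (Ideal.subset_span ⟨i, rfl⟩)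
  have hyC : ∀ i, y i ∈ maximalIdeal C := fun i => by
    rw [← pow_one (maximalIdeal C)]
    refine hcomap 1 _ ?_
    rw [pow_one]
    have := sub_mem (hu i) (Ideal.pow_le_self (Nat.succ_ne_zero N) (hy i))
    rwa [sub_sub_cancel] at this
  set J := P.map (algebraMap R C) ⊔ Ideal.span (Set.range y) with hJ
  have hfg : (maximalIdeal C).FG := by
    rw [← hm]
    exact Ideal.FG.map (IsNoetherian.noetherian (maximalIdeal R)) _
  have h2 : maximalIdeal T ^ N ≤ J.map g := by
    refine Submodule.le_of_le_smul_of_le_jacobson_bot (I := maximalIdeal T)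
      (IsNoetherian.noetherian _) (jacobson_eq_maximalIdeal ⊥ bot_ne_top).ge (hN.trans ?_)
    rw [smul_eq_mul, ← pow_succ']
    refine sup_le ?_ ?_
    · rw [hPT, ← Ideal.map_map]
      exact (Ideal.map_mono le_sup_left).trans le_sup_left
    · rw [Ideal.span_le]
      rintro _ ⟨i, rfl⟩
      have := add_mem (Ideal.mem_sup_right (S := J.map g) (hy i)) (Ideal.mem_sup_left
        (Ideal.mem_map_of_mem g (Ideal.mem_sup_right (S := P.map (algebraMap R C))
          (Ideal.subset_span ⟨i, rfl⟩))))
      rwa [sub_add_cancel] at this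
  have h3 : ∀ t ∈ J.map g, ∃ j ∈ J, t - g j ∈ maximalIdeal T ^ (N + 1) := by
    intro t ht
    induction ht using Submodule.span_induction with
    | mem t ht =>
      obtain ⟨j, hj, rfl⟩ := ht
      exact ⟨j, hj, by rw [sub_self]; exact zero_mem _⟩
    | zero => exact ⟨0, zero_mem _, by rw [map_zero, sub_zero]; exact zero_mem _⟩
    | add t t' _ _ h h' =>
      obtain ⟨j, hj, hjt⟩ := h
      obtain ⟨j', hj', hjt'⟩ := h'
      refine ⟨j + j', add_mem hj hj', ?_⟩
      rw [map_add, add_sub_add_comm]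
      exact add_mem hjt hjt'
    | smul s t _ h =>
      obtain ⟨j, hj, hjt⟩ := h
      obtain ⟨c, hc⟩ := hdense s (N + 1)
      refine ⟨c * j, Ideal.mul_mem_left _ _ hj, ?_⟩
      have : s • t - g (c * j) = s * (t - g j) + g j * (s - g c) := by
        rw [map_mul, smul_eq_mul]
        ring
      rw [this]
      exact add_mem (Ideal.mul_mem_left _ _ hjt) (Ideal.mul_mem_left _ _ hc)
  have h4 : maximalIdeal C ^ N ≤ J := by
    refine Submodule.le_of_le_smul_of_le_jacobson_bot (I := maximalIdeal C)
      (hfg.pow) (jacobson_eq_maximalIdeal ⊥ bot_ne_top).ge fun c hc => ?_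
    obtain ⟨j, hj, hcj⟩ := h3 (g c) (h2 (by
      rw [← hg, ← Ideal.map_pow]
      exact Ideal.mem_map_of_mem g hc))
    rw [← map_sub] at hcj
    have := add_mem (Ideal.mem_sup_right (S := J) (hcomap _ _ hcj)) (Ideal.mem_sup_left hj)
    rwa [sub_add_cancel, pow_succ'] at this
  rw [he]
  refine ringKrullDim_quotient_le_of_pow_le hinj hyC (N := N) ?_
  rw [Ideal.map_pow, hm]
  exact h4

end IntegralExtension

section PerfectResidue

open IsLocalRing Polynomial

variable {R : Type u} [CommRing R] [IsLocalRing R]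

lemma map_maximalIdeal_le_of_isIntegral {S : Type*} [CommRing S] [Algebra R S]
    [Algebra.IsIntegral R S] (M : Ideal S) [M.IsMaximal] :
    (maximalIdeal R).map (algebraMap R S) ≤ M := by
  have h : (M.comap (algebraMap R S)).IsMaximal := Ideal.isMaximal_comap_of_isIntegral_of_isMaximal M
  rw [Ideal.map_le_iff_le_comap, IsLocalRing.eq_maximalIdeal h]

lemma isUnit_of_sub_one_mem_map_maximalIdeal {S : Type*} [CommRing S] [Algebra R S]
    [Algebra.IsIntegral R S] {x : S} (hx : x - 1 ∈ (maximalIdeal R).map (algebraMap R S)) :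
    IsUnit x := by
  by_contra h
  obtain ⟨M, hM, hxM⟩ := exists_max_ideal_of_mem_nonunits h
  refine hM.ne_top ((Ideal.eq_top_iff_one _).2 ?_)
  simpa using sub_mem hxM (map_maximalIdeal_le_of_isIntegral M hx)

lemma isLocalRing_of_isUnit_of_notMem_map {S : Type*} [CommRing S] [Nontrivial S] [Algebra R S]
    [Algebra.IsIntegral R S]
    (h : ∀ c : S, c ∉ (maximalIdeal R).map (algebraMap R S) → IsUnit c) :
    ∃ _ : IsLocalRing S, (maximalIdeal R).map (algebraMap R S) = maximalIdeal S := by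
  have hle : ∀ M : Ideal S, M.IsMaximal → M = (maximalIdeal R).map (algebraMap R S) := fun M hM =>
    le_antisymm (fun c hc => by
      by_contra hn
      exact hM.ne_top (Ideal.eq_top_of_isUnit_mem _ hc (h c hn)))
      (map_maximalIdeal_le_of_isIntegral M)
  obtain ⟨M, hM⟩ := Ideal.exists_maximal S
  have hl : IsLocalRing S := IsLocalRing.of_unique_max_ideal
    ⟨M, hM, fun N hN => (hle N hN).trans (hle M hM).symm⟩
  exact ⟨hl, (hle _ (maximalIdeal.isMaximal S)).symm⟩

/-- Adjoining a `p`-th root whose residue is not a `p`-th power preserves unramifiedness. -/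
lemma isUnit_or_mem_map_of_surjective_polynomial {C S : Type*} [CommRing C] [CommRing S]
    [Algebra R C] [IsLocalRing C] [Algebra R S] [Algebra.IsIntegral R S]
    (hm : (maximalIdeal R).map (algebraMap R C) = maximalIdeal C) {p : ℕ} (hp : p.Prime) {a : C}
    (ha : ∀ b, b ^ p - a ∉ maximalIdeal C) {f : C[X] →ₐ[R] S} (hf : Function.Surjective f)
    (hfa : f (X ^ p - Polynomial.C a) = 0) (c : S)
    (hc : c ∉ (maximalIdeal R).map (algebraMap R S)) : IsUnit c := by
  have hirr : Irreducible (X ^ p - Polynomial.C (residue C a) : (ResidueField C)[X]) := by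
    refine X_pow_sub_C_irreducible_of_prime hp fun b hb => ?_
    obtain ⟨b, rfl⟩ := residue_surjective b
    refine ha b ?_
    rw [← residue_eq_zero_iff, map_sub, map_pow, hb, sub_self]
  have hker : ∀ g : C[X], g.map (residue C) = 0 → f g ∈ (maximalIdeal R).map (algebraMap R S) := by
    intro g hg
    have h1 : g ∈ (maximalIdeal C).map (Polynomial.C : C →+* C[X]) := by
      rw [Ideal.mem_map_C_iff]
      intro n
      rw [← residue_eq_zero_iff, ← coeff_map, hg, coeff_zero]
    have h2 := Ideal.mem_map_of_mem (f : C[X] →+* S) h1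
    rw [← hm, Ideal.map_map, Ideal.map_map] at h2
    have h3 : ((f : C[X] →+* S).comp Polynomial.C).comp (algebraMap R C) = algebraMap R S := by
      ext r
      exact f.commutes r
    rw [h3] at h2
    exact h2
  obtain ⟨g, rfl⟩ := hf c
  have hsur := Polynomial.map_surjective (residue C) residue_surjective
  rcases em' (X ^ p - Polynomial.C (residue C a) ∣ g.map (residue C)) with h | ⟨q, hq⟩
  · obtain ⟨u, v, huv⟩ := hirr.coprime_iff_not_dvd.2 h
    obtain ⟨u, rfl⟩ := hsur u
    obtain ⟨v, rfl⟩ := hsur v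
    have h1 := hker (u * (X ^ p - Polynomial.C a) + v * g - 1) (by simp [huv])
    rw [map_sub, map_add, map_mul, hfa, mul_zero, zero_add, map_one, map_mul] at h1
    exact isUnit_of_mul_isUnit_right (isUnit_of_sub_one_mem_map_maximalIdeal h1)
  · refine absurd ?_ hc
    obtain ⟨q, rfl⟩ := hsur q
    have h1 := hker (g - (X ^ p - Polynomial.C a) * q) (by simp [hq])
    rwa [map_sub, map_mul, hfa, zero_mul, sub_zero] at h1

lemma mem_sSup_of_isChain {k A : Type*} [CommRing k] [CommRing A] [Algebra k A]
    {c : Set (Subalgebra k A)} {S₀ : Subalgebra k A} (hS₀ : S₀ ∈ c) (hc : IsChain (· ≤ ·) c) {x : A} :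
    x ∈ sSup c ↔ ∃ S ∈ c, x ∈ S := by
  have : Nonempty c := ⟨⟨S₀, hS₀⟩⟩
  rw [sSup_eq_iSup', ← SetLike.mem_coe, Subalgebra.coe_iSup_of_directed hc.directedOn.directed_val]
  simp

variable (R) in
/-- A local domain has an integral local extension, with the same generators of the maximal
ideal, in whose residue field every element is a `p`-th power. -/
theorem exists_integral_extension_pow_surjective [IsDomain R] {p : ℕ} (hp : p.Prime) :
    ∃ (C : Type u) (_ : CommRing C) (_ : IsLocalRing C) (_ : Algebra R C),
      Algebra.IsIntegral R C ∧ Function.Injective (algebraMap R C) ∧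
      (maximalIdeal R).map (algebraMap R C) = maximalIdeal C ∧
      ∀ a : C, ∃ b, b ^ p - a ∈ maximalIdeal C := by
  let Ω := AlgebraicClosure (FractionRing R)
  have hΩ : Function.Injective (algebraMap R Ω) := by
    rw [IsScalarTower.algebraMap_eq R (FractionRing R) Ω]
    exact (algebraMap (FractionRing R) Ω).injective.comp (IsFractionRing.injective R _)
  let F : Set (Subalgebra R Ω) := {S | Algebra.IsIntegral R S ∧
    ∀ c : S, c ∉ (maximalIdeal R).map (algebraMap R S) → IsUnit c}
  have hbot : (⊥ : Subalgebra R Ω) ∈ F := by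
    refine ⟨inferInstance, fun c hc => ?_⟩
    obtain ⟨r, hr⟩ := Algebra.mem_bot.1 c.2
    have hr' : algebraMap R (⊥ : Subalgebra R Ω) r = c := Subtype.ext hr
    rw [← hr'] at hc ⊢
    refine IsUnit.map _ ?_
    by_contra h
    exact hc (Ideal.mem_map_of_mem _ ((mem_maximalIdeal _).2 h))
  obtain ⟨S, -, hS⟩ := zorn_le_nonempty₀ F (fun c hcF hc S₀ hS₀ => by
    refine ⟨sSup c, ⟨⟨fun x => ?_⟩, fun x hx => ?_⟩, fun S hS => le_sSup hS⟩
    · have hx := x.2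
      rw [mem_sSup_of_isChain hS₀ hc] at hx
      obtain ⟨S, hS, hxS⟩ := hx
      have := (hcF hS).1
      have h1 := (Algebra.IsIntegral.isIntegral (R := R) (⟨x, hxS⟩ : S)).map
        (Subalgebra.inclusion (le_sSup hS))
      exact h1
    · have hx' := x.2
      rw [mem_sSup_of_isChain hS₀ hc] at hx'
      obtain ⟨S, hS, hxS⟩ := hx'
      have h1 : Subalgebra.inclusion (le_sSup hS) (⟨x, hxS⟩ : S) = x := rfl
      rw [← h1]
      refine IsUnit.map _ ((hcF hS).2 _ fun h => hx ?_)
      have h2 := Ideal.mem_map_of_mem (Subalgebra.inclusion (le_sSup hS) : S →+* (sSup c : Subalgebra R Ω)) h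
      rw [Ideal.map_map] at h2
      have h3 : ((Subalgebra.inclusion (le_sSup hS) : S →+* (sSup c : Subalgebra R Ω))).comp (algebraMap R S) =
        algebraMap R (sSup c : Subalgebra R Ω) := by ext; rfl
      rw [h3] at h2
      exact h2) ⊥ hbot
  have hintegral := hS.prop.1
  obtain ⟨hl, hm⟩ := isLocalRing_of_isUnit_of_notMem_map hS.prop.2
  refine ⟨S, inferInstance, hl, inferInstance, hintegral, fun x y h => hΩ (congrArg Subtype.val h), hm,
    fun a => ?_⟩
  by_contra! ha
  obtain ⟨θ, hθ⟩ := IsAlgClosed.exists_pow_nat_eq (a : Ω) hp.pos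
  let f : S[X] →ₐ[R] Ω := (aeval θ : S[X] →ₐ[S] Ω).restrictScalars R
  have hθS : IsIntegral S θ := ⟨X ^ p - C a, monic_X_pow_sub_C a hp.ne_zero, by
    simp only [eval₂_sub, eval₂_X_pow, eval₂_C, hθ]
    exact sub_self _⟩
  have hfint : Algebra.IsIntegral R f.range := ⟨fun x => by
    obtain ⟨x, g, rfl⟩ := x
    refine (isIntegral_algHom_iff f.range.val Subtype.val_injective).1 ?_
    refine isIntegral_trans (A := S) _ ?_
    have : f g ∈ Algebra.adjoin S {θ} := aeval_mem_adjoin_singleton S θ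
    exact IsIntegral.of_mem_of_fg _ hθS.fg_adjoin_singleton _ this⟩
  have hF : f.range ∈ F := ⟨hfint, fun c hc =>
    isUnit_or_mem_map_of_surjective_polynomial hm hp ha f.rangeRestrict_surjective
      (Subtype.ext (by
        change (aeval θ) (X ^ p - C a) = (0 : Ω)
        simp only [map_sub, map_pow, aeval_X, aeval_C, hθ]
        exact sub_self _)) c hc⟩
  have hle : S ≤ f.range := fun s hs => ⟨C ⟨s, hs⟩, by
    change (aeval θ) (C _) = s
    rw [aeval_C]; rfl⟩
  have hθ' : θ ∈ S := hS.le_of_ge hF hle ⟨X, aeval_X θ⟩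
  refine ha ⟨θ, hθ'⟩ ?_
  have : (⟨θ, hθ'⟩ : S) ^ p - a = 0 := sub_eq_zero.2 (Subtype.ext hθ)
  rw [this]
  exact zero_mem _

end PerfectResidue

section Completion

open IsLocalRing

/-- The completion of a local ring with finitely generated maximal ideal. -/
theorem exists_completion (C : Type u) [CommRing C] [IsLocalRing C] (hfg : (maximalIdeal C).FG) :
    ∃ (T : Type u) (_ : CommRing T) (_ : IsLocalRing T) (_ : IsAdicComplete (maximalIdeal T) T)
      (g : C →+* T), (maximalIdeal C).map g = maximalIdeal T ∧
      (∀ t n, ∃ c, t - g c ∈ maximalIdeal T ^ n) ∧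
      ∀ n c, g c ∈ maximalIdeal T ^ n → c ∈ maximalIdeal C ^ n := by
  have hl := AdicCompletion.isLocalRing_of_fg hfg
  have hm := AdicCompletion.maximalIdeal_eq_map_of_fg hfg
  have hker : ∀ n (t : AdicCompletion (maximalIdeal C) C),
      t ∈ maximalIdeal (AdicCompletion (maximalIdeal C) C) ^ n ↔
        AdicCompletion.eval (maximalIdeal C) C n t = 0 := fun n t => by
    rw [← LinearMap.mem_ker, ← AdicCompletion.pow_smul_top_eq_ker_eval hfg, hm, ← Ideal.map_pow,
      Ideal.smul_top_eq_map]
    rfl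
  refine ⟨AdicCompletion (maximalIdeal C) C, inferInstance, hl,
    AdicCompletion.isAdicComplete_of_fg hfg, algebraMap _ _, hm.symm, fun t n => ?_,
    fun n c hc => ?_⟩
  · obtain ⟨c, hc⟩ := Submodule.Quotient.mk_surjective _ (AdicCompletion.eval (maximalIdeal C) C n t)
    refine ⟨c, (hker _ _).2 ?_⟩
    rw [map_sub, ← hc, sub_eq_zero]
    rfl
  · have h := (hker _ _).1 hc
    have h' : (Submodule.Quotient.mk c : C ⧸ (maximalIdeal C ^ n • ⊤ : Ideal C)) = 0 := h
    rw [Submodule.Quotient.mk_eq_zero] at h'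
    simpa using h'

end Completion

section CoefficientRing

open IsLocalRing IsAdicComplete

lemma ghostComponent_mem_pow {T : Type*} [CommRing T] {I : Ideal T} {p : ℕ} [hp : Fact p.Prime] (hpI : (p : T) ∈ I)
    {x : WittVector p T} (hx : ∀ i, x.coeff i ∈ I) (n : ℕ) :
    WittVector.ghostComponent n x ∈ I ^ (n + 1) := by
  rw [WittVector.ghostComponent_apply, aeval_wittPolynomial]
  refine sum_mem fun i hi => ?_
  have hi := Finset.mem_range_succ_iff.1 hi
  have h1 : n + 1 ≤ i + p ^ (n - i) := by
    have := (n - i).lt_pow_self hp.out.one_lt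
    omega
  refine Ideal.pow_le_pow_right h1 ?_
  rw [pow_add]
  exact Ideal.mul_mem_mul (Ideal.pow_mem_pow hpI _) (Ideal.pow_mem_pow (hx i) _)

variable {T : Type u} [CommRing T] [IsLocalRing T] [IsAdicComplete (maximalIdeal T) T]

/-- A complete local ring with perfect residue field of characteristic `p` receives a map from
the Witt vectors of its residue field, inducing the identity on residue fields. -/
theorem exists_wittVector_hom (p : ℕ) [hp : Fact p.Prime] [CharP (ResidueField T) p]
    [PerfectRing (ResidueField T) p] :
    ∃ φ : WittVector p (ResidueField T) →+* T, ∀ t, ∃ α, t - φ α ∈ maximalIdeal T := by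
  set K := ResidueField T
  set m := maximalIdeal T
  have hpm : (p : T) ∈ m := by
    rw [← residue_eq_zero_iff, map_natCast, CharP.cast_eq_zero]
  have hsur : Function.Surjective (WittVector.map (p := p) (residue T)) :=
    WittVector.map_surjective _ residue_surjective
  have hker : ∀ n, RingHom.ker (WittVector.map (p := p) (residue T)) ≤
      RingHom.ker ((Ideal.Quotient.mk (m ^ (n + 1))).comp (WittVector.ghostComponent n)) := by
    intro n x hx
    rw [RingHom.mem_ker, RingHom.comp_apply, Ideal.Quotient.eq_zero_iff_mem]
    refine ghostComponent_mem_pow hpm (fun i => ?_) n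
    rw [← residue_eq_zero_iff, ← WittVector.map_coeff, (RingHom.mem_ker).1 hx,
      WittVector.zero_coeff]
  let θ : ∀ n, WittVector p K →+* T ⧸ m ^ (n + 1) := fun n =>
    RingHom.liftOfSurjective (WittVector.map (residue T)) hsur ⟨_, hker n⟩
  have hθ : ∀ n x, θ n (WittVector.map (residue T) x) =
      Ideal.Quotient.mk _ (WittVector.ghostComponent n x) := fun n x =>
    RingHom.liftOfSurjective_comp_apply ..
  let φ : ∀ n, WittVector p K →+* T ⧸ m ^ (n + 1) := fun n => (θ n).comp
    (WittVector.map ((iterateFrobeniusEquiv K p n).symm : K →+* K))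
  have hφ : ∀ n y, φ n (WittVector.teichmuller p (residue T y ^ p ^ n)) =
      Ideal.Quotient.mk _ (y ^ p ^ n) := fun n y => by
    have h1 : ((iterateFrobeniusEquiv K p n).symm : K →+* K) (residue T y ^ p ^ n) = residue T y := by
      rw [← iterateFrobenius_def, ← coe_iterateFrobeniusEquiv]
      exact RingEquiv.symm_apply_apply _ _
    have h2 : φ n (WittVector.teichmuller p (residue T y ^ p ^ n)) =
        θ n (WittVector.map (residue T) (WittVector.teichmuller p y)) := by
      simp only [φ, RingHom.comp_apply, WittVector.map_teichmuller, h1]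
    rw [h2, hθ, WittVector.ghostComponent_teichmuller]
  have hroot : ∀ n (x : K), ∃ y, residue T y ^ p ^ n = x := fun n x => by
    obtain ⟨z, hz⟩ := (iterateFrobeniusEquiv K p n).surjective x
    obtain ⟨y, rfl⟩ := residue_surjective z
    exact ⟨y, by rw [← hz, iterateFrobeniusEquiv_apply, iterateFrobenius_def]⟩
  have hcompat : ∀ {n}, (Ideal.Quotient.factorPowSucc m (n + 1)).comp (φ (n + 1)) = φ n := by
    intro n
    refine WittVector.eq_of_apply_teichmuller_eq _ _ ⟨n + 1, ?_⟩ fun x => ?_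
    · have : ((p : ℕ) : T ⧸ m ^ (n + 1)) = Ideal.Quotient.mk _ (p : T) := by simp
      rw [this, ← map_pow, Ideal.Quotient.eq_zero_iff_mem]
      exact Ideal.pow_mem_pow hpm _
    · obtain ⟨y, rfl⟩ := hroot (n + 1) x
      rw [RingHom.comp_apply, hφ, pow_succ' p n, pow_mul, pow_mul, ← map_pow, hφ]
      rfl
  refine ⟨Order.succ_strictMono.liftRingHom m φ hcompat, fun t =>
    ⟨WittVector.teichmuller p (residue T t), ?_⟩⟩
  have h1 := Order.succ_strictMono.mk_liftRingHom m φ hcompat (n := 0)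
    (WittVector.teichmuller p (residue T t))
  have h2 : φ 0 (WittVector.teichmuller p (residue T t)) = Ideal.Quotient.mk _ t := by
    simpa only [pow_zero, pow_one] using hφ 0 t
  have h3 := Ideal.Quotient.eq.1 (h2.symm.trans h1.symm)
  simpa using h3

/-- A complete local ring with residue field of characteristic zero has a coefficient field. -/
theorem exists_residueField_hom [CharZero (ResidueField T)] :
    ∃ φ : ResidueField T →+* T, ∀ t, ∃ α, t - φ α ∈ maximalIdeal T := by
  have hu : ∀ n : ℕ, n ≠ 0 → IsUnit (n : T) := fun n hn => by
    rw [← residue_ne_zero_iff_isUnit, map_natCast]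
    exact_mod_cast hn
  have hu' : ∀ z : nonZeroDivisors ℤ, IsUnit (Int.castRingHom T z) := fun z => by
    rcases Int.natAbs_eq (z : ℤ) with h | h
    · rw [h]
      simpa using hu _ (Int.natAbs_ne_zero.2 (nonZeroDivisors.coe_ne_zero z))
    · rw [h]
      simpa using hu _ (Int.natAbs_ne_zero.2 (nonZeroDivisors.coe_ne_zero z))
  let := (IsLocalization.lift (S := ℚ) hu').toAlgebra
  have hsm : Algebra.FormallySmooth ℚ (ResidueField T) := by
    obtain ⟨ι, v, hv⟩ := exists_isTranscendenceBasis' ℚ (ResidueField T)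
    have := hv.isAlgebraic_field
    exact Algebra.FormallySmooth.of_algebraicIndependent_of_isSeparable hv.1
  let f : ResidueField T →ₐ[ℚ] T ⧸ maximalIdeal T :=
    { (RingHom.id (ResidueField T) : ResidueField T →+* T ⧸ maximalIdeal T) with
      commutes' := fun q => RingHom.congr_fun (Subsingleton.elim
        ((RingHom.id (ResidueField T) : ResidueField T →+* T ⧸ maximalIdeal T).comp
          (algebraMap ℚ (ResidueField T))) (algebraMap ℚ (T ⧸ maximalIdeal T))) q }
  obtain ⟨φ, hφ⟩ := Algebra.FormallySmooth.exists_mkₐ_comp_eq_of_isAdicComplete f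
  refine ⟨φ, fun t => ⟨residue T t, ?_⟩⟩
  have h := AlgHom.congr_fun hφ (residue T t)
  exact Ideal.Quotient.eq.1 h.symm

/-- A complete local ring with a coefficient ring and finitely generated maximal ideal is
Noetherian. -/
theorem isNoetherianRing_of_coefficientRing {V : Type u} [CommRing V] [IsLocalRing V]
    [IsDomain V] [IsNoetherianRing V] [IsAdicComplete (maximalIdeal V) V] {φ : V →+* T}
    (hφ : ∀ t, ∃ α, t - φ α ∈ maximalIdeal T) (hfg : (maximalIdeal T).FG) :
    IsNoetherianRing T := by
  obtain ⟨d, x, hx⟩ := Submodule.fg_iff_exists_fin_generating_family.1 hfg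
  have hxm : ∀ i, x i ∈ maximalIdeal T := fun i => hx ▸ Submodule.subset_span ⟨i, rfl⟩
  have h := eval_surjective_of_span (u := x) (v := (Fin.elim0 : Fin 0 → T)) hφ hxm
    (fun i => i.elim0) (by simpa using hx.symm)
  exact isNoetherianRing_of_surjective _ _ _ h

end CoefficientRing

section PrimaryCase

open IsLocalRing

/-- A Noetherian local domain maps to a complete Noetherian local ring with a coefficient ring
that is a field or a complete discrete valuation ring, without lowering the dimension of
quotients and preserving generators of the maximal ideal. -/
theorem exists_complete_extension (R : Type u) [CommRing R] [IsLocalRing R] [IsNoetherianRing R]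
    [IsDomain R] :
    ∃ (T V : Type u) (_ : CommRing T) (_ : IsLocalRing T) (_ : IsNoetherianRing T)
      (_ : IsAdicComplete (maximalIdeal T) T) (_ : CommRing V) (_ : IsLocalRing V)
      (_ : IsDomain V) (_ : IsNoetherianRing V) (_ : IsAdicComplete (maximalIdeal V) V)
      (ϖ : V) (φ : V →+* T) (h : R →+* T), maximalIdeal V = Ideal.span {ϖ} ∧
      φ ϖ ∈ maximalIdeal T ∧ (∀ t, ∃ α, t - φ α ∈ maximalIdeal T) ∧
      (maximalIdeal R).map h = maximalIdeal T ∧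
      ∀ P : Ideal R, P.IsPrime → ringKrullDim (R ⧸ P) ≤ ringKrullDim (T ⧸ P.map h) := by
  have hR : (maximalIdeal R).FG := IsNoetherian.noetherian _
  obtain ⟨p, hchar⟩ := CharP.exists (ResidueField R)
  rcases CharP.char_is_prime_or_zero (ResidueField R) p with hp | rfl
  · have : Fact p.Prime := ⟨hp⟩
    obtain ⟨C, _, _, _, hintegral, hinj, hm, hpow⟩ := exists_integral_extension_pow_surjective R hp
    obtain ⟨T, _, _, _, g, hg, hdense, hcomap⟩ := exists_completion C (hm ▸ hR.map _)
    have hmT : (maximalIdeal R).map (g.comp (algebraMap R C)) = maximalIdeal T := by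
      rw [← Ideal.map_map, hm, hg]
    have hloc : IsLocalHom (g.comp (algebraMap R C)) :=
      ((local_hom_TFAE _).out 0 2).2 hmT.le
    have : CharP (ResidueField T) p := charP_of_injective_ringHom
      (ResidueField.map (g.comp (algebraMap R C))).injective p
    have : PerfectRing (ResidueField T) p := PerfectRing.ofSurjective _ p fun t => by
      obtain ⟨t, rfl⟩ := residue_surjective t
      obtain ⟨c, hc⟩ := hdense t 1
      obtain ⟨b, hb⟩ := hpow c
      refine ⟨residue T (g b), ?_⟩
      rw [frobenius_def, ← map_pow, ← sub_eq_zero, ← map_sub, residue_eq_zero_iff]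
      rw [pow_one] at hc
      have h1 := Ideal.mem_map_of_mem g hb
      rw [hg, map_sub, map_pow] at h1
      have h2 := sub_mem h1 hc
      rwa [show g b ^ p - g c - (t - g c) = g b ^ p - t by ring] at h2
    obtain ⟨φ, hφ⟩ := exists_wittVector_hom (T := T) p
    have hV : maximalIdeal (WittVector p (ResidueField T)) =
        Ideal.span {(p : WittVector p (ResidueField T))} :=
      (WittVector.irreducible p).maximalIdeal_eq
    have hVc : IsAdicComplete (maximalIdeal (WittVector p (ResidueField T)))
        (WittVector p (ResidueField T)) := hV ▸ inferInstance
    have hN : IsNoetherianRing T := isNoetherianRing_of_coefficientRing hφ (hmT ▸ hR.map _)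
    refine ⟨T, WittVector p (ResidueField T), inferInstance, inferInstance, hN, inferInstance,
      inferInstance, inferInstance, inferInstance, inferInstance, hVc, p, φ,
      g.comp (algebraMap R C), hV, ?_, hφ, hmT, fun P hP =>
      ringKrullDim_quotient_le_map hinj hm hg hdense hcomap⟩
    rw [← residue_eq_zero_iff, map_natCast, map_natCast, CharP.cast_eq_zero]
  · have := CharP.charP_to_charZero (ResidueField R)
    obtain ⟨T, _, _, _, g, hg, hdense, hcomap⟩ := exists_completion R hR
    have hloc : IsLocalHom g := ((local_hom_TFAE _).out 0 2).2 hg.le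
    have : CharZero (ResidueField T) := charZero_of_injective_ringHom
      (ResidueField.map g).injective
    obtain ⟨φ, hφ⟩ := exists_residueField_hom (T := T)
    have hV : maximalIdeal (ResidueField T) = ⊥ := maximalIdeal_eq_bot
    have hVc : IsAdicComplete (maximalIdeal (ResidueField T)) (ResidueField T) :=
      hV ▸ inferInstance
    have hN : IsNoetherianRing T := isNoetherianRing_of_coefficientRing hφ (hg ▸ hR.map _)
    refine ⟨T, ResidueField T, inferInstance, inferInstance, hN, inferInstance,
      inferInstance, inferInstance, inferInstance, inferInstance, hVc, 0, φ, g, ?_, ?_, hφ, hg,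
      fun P hP => ?_⟩
    · rw [hV, Ideal.span_singleton_zero]
    · rw [map_zero]
      exact zero_mem _
    · exact ringKrullDim_quotient_le_map (C := R) (fun _ _ h => h) (Ideal.map_id _) hg hdense hcomap

/-- The dimension inequality for two primes of a regular local ring whose sum is primary to
the maximal ideal. -/
theorem add_le_of_maximalIdeal_le_radical {R : Type u} [CommRing R] [IsLocalRing R]
    [IsNoetherianRing R] {d : ℕ} {x : Fin d → R}
    (hx : maximalIdeal R = Ideal.span (Set.range x)) (hd : (d : WithBot ℕ∞) ≤ ringKrullDim R)
    {P Q : Ideal R} [P.IsPrime] [Q.IsPrime] (hprim : maximalIdeal R ≤ (P ⊔ Q).radical) {a b : ℕ}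
    (ha : (a : WithBot ℕ∞) ≤ ringKrullDim (R ⧸ P)) (hb : (b : WithBot ℕ∞) ≤ ringKrullDim (R ⧸ Q)) :
    a + b ≤ d := by
  have := isDomain_of_regular d R x hx hd
  obtain ⟨T, V, _, _, _, _, _, _, _, _, _, ϖ, φ, h, hϖ, hφϖ, hφ, hm, hdim⟩ :=
    exists_complete_extension R
  have hxT : maximalIdeal T = Ideal.span (Set.range fun i => h (x i)) := by
    rw [← hm, hx, Ideal.map_span, ← Set.range_comp]
    rfl
  have hdT : (d : WithBot ℕ∞) ≤ ringKrullDim T := by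
    refine hd.trans ?_
    have h1 := hdim ⊥ Ideal.isPrime_bot
    rw [Ideal.map_bot, ringKrullDim_eq_of_ringEquiv (RingEquiv.quotientBot R),
      ringKrullDim_eq_of_ringEquiv (RingEquiv.quotientBot T)] at h1
    exact h1
  obtain ⟨P', hP', hPP', haP'⟩ :=
    exists_isPrime_le_ringKrullDim_quotient (ha.trans (hdim P inferInstance))
  obtain ⟨Q', hQ', hQQ', hbQ'⟩ :=
    exists_isPrime_le_ringKrullDim_quotient (hb.trans (hdim Q inferInstance))
  obtain ⟨a', -, ha'⟩ := exists_ringKrullDim_quotient_eq_nat hxT hP'.ne_top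
  obtain ⟨b', -, hb'⟩ := exists_ringKrullDim_quotient_eq_nat hxT hQ'.ne_top
  have hprim' : maximalIdeal T ≤ (P' ⊔ Q').radical := by
    rw [← hm, Ideal.map_le_iff_le_comap]
    intro y hy
    obtain ⟨n, hn⟩ := hprim hy
    refine ⟨n, ?_⟩
    rw [← map_pow]
    have h1 := Ideal.mem_map_of_mem h hn
    rw [Ideal.map_sup] at h1
    exact sup_le_sup hPP' hQQ' h1
  have h1 := add_le_of_coefficientRing hϖ hφϖ hφ hxT hdT hprim' ha' hb'
  rw [ha'] at haP'
  rw [hb'] at hbQ'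
  have h2 : a ≤ a' := by exact_mod_cast haP'
  have h3 : b ≤ b' := by exact_mod_cast hbQ'
  omega

end PrimaryCase

section DimensionInequality

open IsLocalRing

/-- The dimension inequality for two ideals of a regular local ring. -/
theorem ringKrullDim_quotient_add_le {R : Type u} [CommRing R] [IsLocalRing R]
    [IsNoetherianRing R] {d : ℕ} {x : Fin d → R}
    (hx : maximalIdeal R = Ideal.span (Set.range x)) (hd : (d : WithBot ℕ∞) ≤ ringKrullDim R)
    {I J : Ideal R} (hI : I ≠ ⊤) (hJ : J ≠ ⊤) :
    ringKrullDim (R ⧸ I) + ringKrullDim (R ⧸ J) ≤ d + ringKrullDim (R ⧸ I ⊔ J) := by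
  obtain ⟨a, -, ha⟩ := exists_ringKrullDim_quotient_eq_nat hx hI
  obtain ⟨b, -, hb⟩ := exists_ringKrullDim_quotient_eq_nat hx hJ
  obtain ⟨P, hP, hIP, haP⟩ := exists_isPrime_le_ringKrullDim_quotient ha.ge
  obtain ⟨Q, hQ, hJQ, hbQ⟩ := exists_isPrime_le_ringKrullDim_quotient hb.ge
  have hPQ : P ⊔ Q ≠ ⊤ := fun h => (maximalIdeal.isMaximal R).ne_top
    (top_le_iff.1 (h ▸ sup_le (le_maximalIdeal hP.ne_top) (le_maximalIdeal hQ.ne_top)))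
  obtain ⟨c, hcd, hc⟩ := exists_ringKrullDim_quotient_eq_nat hx hPQ
  obtain ⟨l, rfl⟩ := Nat.exists_eq_add_of_le hcd
  obtain ⟨u, v, huv, hu, -⟩ := exists_coordinates (P ⊔ Q) (P ⊔ Q) c l 0 0 x hx
    (by rw [hc, zero_add]) (by rw [hc, zero_add])
  have hum : ∀ i, u i ∈ maximalIdeal R := fun i =>
    huv ▸ Ideal.mem_sup_left (Ideal.subset_span ⟨i, rfl⟩)
  have hprim := maximalIdeal_le_radical_of_ringKrullDim_le_zero hu
  have hQu : Q ⊔ Ideal.span (Set.range u) ≠ ⊤ := fun h => (maximalIdeal.isMaximal R).ne_top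
    (top_le_iff.1 (h ▸ sup_le (le_maximalIdeal hQ.ne_top)
      (Ideal.span_le.2 (Set.range_subset_iff.2 hum))))
  obtain ⟨e, -, he⟩ := exists_ringKrullDim_quotient_eq_nat hx hQu
  obtain ⟨Q₁, hQ₁, hQQ₁, heQ₁⟩ := exists_isPrime_le_ringKrullDim_quotient he.ge
  have hbe : b ≤ e + c := by
    have h := hbQ.trans (ringKrullDim_quotient_le_sup_span_range (I := Q) hum)
    rw [he] at h
    exact_mod_cast h
  have hprim' : maximalIdeal R ≤ (P ⊔ Q₁).radical := by
    refine hprim.trans (Ideal.radical_mono ?_)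
    rw [sup_assoc]
    exact sup_le_sup le_rfl hQQ₁
  have h := add_le_of_maximalIdeal_le_radical hx hd hprim' haP heQ₁
  have hcIJ : ((c : ℕ) : WithBot ℕ∞) ≤ ringKrullDim (R ⧸ I ⊔ J) :=
    hc ▸ ringKrullDim_quotient_anti (sup_le_sup hIP hJQ)
  calc ringKrullDim (R ⧸ I) + ringKrullDim (R ⧸ J) = ((a + b : ℕ) : WithBot ℕ∞) := by
        rw [ha, hb]
        norm_cast
    _ ≤ ((c + l + c : ℕ) : WithBot ℕ∞) := by
        have : a + b ≤ c + l + c := by omega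
        exact_mod_cast this
    _ = ((c + l : ℕ) : WithBot ℕ∞) + (c : ℕ) := by norm_cast
    _ ≤ _ := add_le_add le_rfl hcIJ

lemma annihilator_tensorProduct_le_radical (R : Type*) [CommRing R] (M N : Type*)
    [AddCommGroup M] [Module R M] [AddCommGroup N] [Module R N] [Module.Finite R M]
    [Module.Finite R N] :
    Module.annihilator R (M ⊗[R] N) ≤
      (Module.annihilator R M ⊔ Module.annihilator R N).radical := by
  rw [Ideal.radical_eq_sInf]
  refine le_sInf fun p ⟨hle, hp⟩ => ?_
  let p' : PrimeSpectrum R := ⟨p, hp⟩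
  have h1 : p' ∈ Module.support R M := by
    rw [Module.support_eq_zeroLocus]
    exact le_sup_left.trans hle
  have h2 : p' ∈ Module.support R N := by
    rw [Module.support_eq_zeroLocus]
    exact le_sup_right.trans hle
  have h3 : p' ∈ Module.support R (M ⊗[R] N) := by
    rw [Module.mem_support_iff_nontrivial_residueField_tensorProduct] at h1 h2 ⊢
    exact (TensorProduct.AlgebraTensorModule.distribBaseChange R p'.asIdeal.ResidueField M
      N).toEquiv.nontrivial
  rw [Module.support_eq_zeroLocus] at h3
  exact h3

end DimensionInequality

theorem stmt_14 (R : Type u) [CommRing R] [IsLocalRing R] (hR : IsRegularLocal R)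
    (M N : Type u) [AddCommGroup M] [Module R M] [AddCommGroup N] [Module R N]
    [Module.Finite R M] [Module.Finite R N] [Nontrivial M] [Nontrivial N] :
    moduleDim R M + moduleDim R N ≤ ringDim R + moduleDim R (M ⊗[R] N) := by
  obtain ⟨_, s, hs, hd⟩ := hR
  have hx : IsLocalRing.maximalIdeal R =
      Ideal.span (Set.range fun i => (s.equivFin.symm i : R)) := by
    have h : (fun i => (s.equivFin.symm i : R)) = Subtype.val ∘ s.equivFin.symm := rfl
    rw [h, s.equivFin.symm.surjective.range_comp, Subtype.range_coe, ← hs]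
  refine (ringKrullDim_quotient_add_le hx hd.le (I := Module.annihilator R M)
    (J := Module.annihilator R N) ?_ ?_).trans ?_
  · rw [Ne, Module.annihilator_eq_top_iff]
    exact not_subsingleton M
  · rw [Ne, Module.annihilator_eq_top_iff]
    exact not_subsingleton N
  · refine add_le_add hd.le ?_
    rw [← ringKrullDim_quotient_radical]
    exact ringKrullDim_quotient_anti (annihilator_tensorProduct_le_radical R M N)
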